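/- For every κ ∈ (0,1/2] and s ∈ (0,1], there exist ε = ε(κ,s) > 0 and δ₀ = δ₀(ε,κ,s) > 0 such that the following holds for all δ ∈ (0,δ₀]: let Ω = {(p,v) : p ∈ P and v ∈ E(p)} be a (δ,δ,s,δ^{−ε})-configuration with |P| ≤ δ^{−s−ε}. Then there exists a subset G ⊂ Ω of cardinality |G| ≥ δ^κ |Ω| such that, simultaneously for all δ ≤ λ ≤ t ≤ 1, m^{δ^{−ε},κ^{−1}}_{δ,λ,t}(ω | G) ≤ δ^{−κ} for all ω ∈ G. -/

import Mathlib

open Metric Set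

noncomputable section

/-- The plane `ℝ²`. -/
abbrev Plane := EuclideanSpace ℝ (Fin 2)

/-- The parameter space `ℝ² × ℝ` of circles: a pair `(x, r)` of a centre and a radius. -/
abbrev Param := (EuclideanSpace ℝ (Fin 2)) × ℝ

/-- The point of `ℝ²` with coordinates `a`, `b`. -/
def mk2 (a b : ℝ) : Plane := (WithLp.equiv 2 (Fin 2 → ℝ)).symm ![a, b]

/-- The Euclidean distance on `ℝ² × ℝ`, viewed as `ℝ³`. -/
def pdist (p q : Param) : ℝ := Real.sqrt (dist p.1 q.1 ^ 2 + (p.2 - q.2) ^ 2)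

/-- The tangency parameter `Δ(p,q) = ||x - x'| - |r - r'||`. -/
def tang (p q : Param) : ℝ := abs (dist p.1 q.1 - |p.2 - q.2|)

/-- The domain `𝐃 = {(x,r) : |x| ≤ 1/4, r ∈ [1/2, 1]}`. -/
def domD : Set Param := {p | ‖p.1‖ ≤ 1 / 4 ∧ p.2 ∈ Set.Icc (1 / 2 : ℝ) 1}

/-- The circle `S(p)` with centre `p.1` and radius `p.2`. -/
def circ (p : Param) : Set Plane := Metric.sphere p.1 p.2

/-- The closed `δ`-annulus `S^δ(p)` around the circle `S(p)`. -/
def annulus (δ : ℝ) (p : Param) : Set Plane := {w | Metric.infDist w (circ p) ≤ δ}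

/-- The `(δ,σ)`-rectangle `R^δ_σ(p,v) = S^δ(p) ∩ B(v,σ)`. -/
def rect (δ σ : ℝ) (p : Param) (v : Plane) : Set Plane :=
  annulus δ p ∩ Metric.closedBall v σ

/-- Admissible data `(p, v)` for a rectangle: `p ∈ 𝐃` and `v ∈ S(p)`. -/
def IsRectData (r : Param × Plane) : Prop := r.1 ∈ domD ∧ r.2 ∈ circ r.1

/-- `C`-comparability of two rectangles (given by their data): there is a third
`(δ,σ)`-rectangle `R` with `R₁ ∪ R₂ ⊆ C·R`. -/
def Comp (δ σ C : ℝ) (r₁ r₂ : Param × Plane) : Prop :=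
  ∃ r : Param × Plane, IsRectData r ∧
    rect δ σ r₁.1 r₁.2 ∪ rect δ σ r₂.1 r₂.2 ⊆ rect (C * δ) (C * σ) r.1 r.2

/-- The index of the dyadic `δ`-cube of `ℝ²` containing a point. -/
def idx2 (δ : ℝ) (v : Plane) : ℤ × ℤ := (⌊v 0 / δ⌋, ⌊v 1 / δ⌋)

/-- The index of the dyadic `δ`-cube of `ℝ³ = ℝ² × ℝ` containing a point. -/
def idx3 (δ : ℝ) (p : Param) : (ℤ × ℤ) × ℤ := (idx2 δ p.1, ⌊p.2 / δ⌋)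

/-- `|E|_δ`: the number of dyadic `δ`-cubes intersecting `E ⊆ ℝ²`. -/
def count2 (δ : ℝ) (E : Set Plane) : ℕ := Nat.card (idx2 δ '' E)

/-- `|P|_δ`: the number of dyadic `δ`-cubes intersecting `P ⊆ ℝ³`. -/
def count3 (δ : ℝ) (P : Set Param) : ℕ := Nat.card (idx3 δ '' P)

/-- `|Ω|_δ`: the number of dyadic `δ`-cubes of `ℝ⁵ = ℝ³ × ℝ²` intersecting `Ω`. -/
def count5 (δ : ℝ) (Ω : Set (Param × Plane)) : ℕ :=
  Nat.card ((fun ω => (idx3 δ ω.1, idx2 δ ω.2)) '' Ω)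

/-- A `(δ,s,C)`-set in the plane. -/
def IsDSet2 (δ s C : ℝ) (E : Set Plane) : Prop :=
  Bornology.IsBounded E ∧ ∀ (x : Plane) (r : ℝ), δ ≤ r →
    (count2 δ (E ∩ Metric.closedBall x r) : ℝ) ≤ C * r ^ s * (count2 δ E : ℝ)

/-- A `(δ,s,C)`-set in `ℝ³ = ℝ² × ℝ`. -/
def IsDSet3 (δ s C : ℝ) (P : Set Param) : Prop :=
  Bornology.IsBounded P ∧ ∀ (x : Param) (r : ℝ), δ ≤ r →
    (count3 δ (P ∩ {q | pdist q x ≤ r}) : ℝ) ≤ C * r ^ s * (count3 δ P : ℝ)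

/-- `x ∈ 2^{-ℕ}`. -/
def IsDyadic (x : ℝ) : Prop := ∃ n : ℕ, x = (2 : ℝ) ^ (-(n : ℤ))

/-- The smallest dyadic rational `2^{-n} ≥ σ` (for `σ ∈ (0,1]`). -/
def dyadicCeil (σ : ℝ) : ℝ := (2 : ℝ) ^ (-⌊Real.logb 2 σ⁻¹⌋)

/-- Indices of dyadic cubes in `ℝ³ = ℝ² × ℝ`. -/
abbrev CubeIdx := (ℤ × ℤ) × ℤ

/-- The dyadic cube of side length `δ` with index `k`. -/
def cubeSet (δ : ℝ) (k : CubeIdx) : Set Param :=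
  {p | (k.1.1 : ℝ) * δ ≤ p.1 0 ∧ p.1 0 < ((k.1.1 : ℝ) + 1) * δ ∧
       (k.1.2 : ℝ) * δ ≤ p.1 1 ∧ p.1 1 < ((k.1.2 : ℝ) + 1) * δ ∧
       (k.2 : ℝ) * δ ≤ p.2 ∧ p.2 < ((k.2 : ℝ) + 1) * δ}

/-- The centre of the dyadic cube of side length `δ` with index `k`. -/
def cubeCtr (δ : ℝ) (k : CubeIdx) : Param :=
  (mk2 (((k.1.1 : ℝ) + 1 / 2) * δ) (((k.1.2 : ℝ) + 1 / 2) * δ), ((k.2 : ℝ) + 1 / 2) * δ)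

/-- The unit vector with angle `θ`. -/
def dir (θ : ℝ) : Plane := mk2 (Real.cos θ) (Real.sin θ)

/-- The `j`-th (half-open) arc of the partition `𝒮_σ(p)` of the circle `S(p)`
into arcs of length `2πrσ`. -/
def arcSet (p : Param) (σ : ℝ) (j : ℤ) : Set Plane :=
  {w | ∃ θ : ℝ, (j : ℝ) * (2 * Real.pi * σ) ≤ θ ∧ θ < ((j : ℝ) + 1) * (2 * Real.pi * σ) ∧
    w = p.1 + p.2 • dir θ}

/-- The centre of the `j`-th arc of `𝒮_σ(p)`. -/
def arcCenterAt (p : Param) (σ : ℝ) (j : ℤ) : Plane :=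
  p.1 + p.2 • dir (((j : ℝ) + 1 / 2) * (2 * Real.pi * σ))

/-- Valid indices for the arcs of `𝒮_σ(p)`. -/
def validArc (σ : ℝ) (j : ℤ) : Prop := 0 ≤ j ∧ (j : ℝ) < σ⁻¹

/-- The (one-sided) cone `V(p, I)` centred at the centre of `p` and spanned by `I`. -/
def cone (p : Param) (I : Set Plane) : Set Plane :=
  {x | ∃ e ∈ I, ∃ t : ℝ, 0 ≤ t ∧ x = p.1 + t • (e - p.1)}

/-- A pair: (index of a dyadic cube in `ℝ³`, index of an arc). -/
abbrev DPair := CubeIdx × ℤ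

/-- The relation `(p,v) ≺ (𝐩,𝐯)` between pairs at scales `(δ,σ)` and `(Δ,Σ)`. -/
def prec (δ σ Δ Sg : ℝ) (ω W : DPair) : Prop :=
  cubeSet δ ω.1 ⊆ cubeSet Δ W.1 ∧
  arcCenterAt (cubeCtr δ ω.1) σ ω.2 ∈ cone (cubeCtr Δ W.1) (arcSet (cubeCtr Δ W.1) Sg W.2)

/-- The `(Δ,Σ)`-skeleton `Ω^Δ_Σ` of a set of pairs at scales `(δ,σ)`. -/
def skeleton (δ σ Δ Sg : ℝ) (Ω : Set DPair) : Set DPair :=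
  {W | cubeSet Δ W.1 ⊆ domD ∧ validArc Sg W.2 ∧ ∃ ω ∈ Ω, prec δ σ Δ Sg ω W}

/-- The cube family `P` of a configuration. -/
def configP (Ω : Set DPair) : Set CubeIdx := Prod.fst '' Ω

/-- The arc family `E_σ(p)` of a configuration. -/
def configE (Ω : Set DPair) (k : CubeIdx) : Set ℤ := {j | (k, j) ∈ Ω}

/-- A (dyadic) `(δ,σ,s,C,M)`-configuration. -/
def IsConfigD (δ σ s C : ℝ) (M : ℕ) (Ω : Set DPair) : Prop :=
  (configP Ω).Nonempty ∧
  (∀ k ∈ configP Ω, cubeSet δ k ⊆ domD) ∧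
  IsDSet3 δ s C (⋃ k ∈ configP Ω, cubeSet δ k) ∧
  ∀ k ∈ configP Ω,
    (∀ j ∈ configE Ω k, validArc σ j) ∧
    IsDSet2 σ s C (⋃ j ∈ configE Ω k, arcSet (cubeCtr δ k) σ j) ∧
    Nat.card (configE Ω k) = M

/-- The partial multiplicity function `m^{ρ_λ,ρ_t,C}_{Δ,λ,t}(ω ∣ G)`, counting pairs in the
`(Δ, σa)`-skeleton of `G`; the geometric data of `ω` is given by the circle parameter `pω`
(the centre of the cube of `ω`) and the arc centre `vω`. -/
def pMult (baseδ baseσ Δ σa lam t ρl ρt C : ℝ) (G : Set DPair) (pω : Param) (vω : Plane) : ℕ :=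
  Nat.card {ω' : DPair | ω' ∈ skeleton baseδ baseσ Δ σa G ∧
    (lam ≤ ρl * Δ ∨ lam / ρl ≤ tang pω (cubeCtr Δ ω'.1)) ∧
    tang pω (cubeCtr Δ ω'.1) ≤ ρl * lam ∧
    t / ρt ≤ pdist pω (cubeCtr Δ ω'.1) ∧
    pdist pω (cubeCtr Δ ω'.1) ≤ ρt * t ∧
    (rect (C * Δ) (C * σa) pω vω ∩
      rect (C * Δ) (C * σa) (cubeCtr Δ ω'.1) (arcCenterAt (cubeCtr Δ ω'.1) σa ω'.2)).Nonempty}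

/-- A `δ`-separated set in `ℝ³ = ℝ² × ℝ`. -/
def sep3 (δ : ℝ) (A : Set Param) : Prop := ∀ p ∈ A, ∀ q ∈ A, p ≠ q → δ ≤ pdist p q

/-- A `(δ,ε)`-almost `t`-bipartite pair. -/
def AlmostBipartite (δ ε t : ℝ) (W B : Set Param) : Prop :=
  sep3 δ W ∧ sep3 δ B ∧ (∀ p ∈ W, ∀ q ∈ B, δ ^ ε * t ≤ pdist p q) ∧
    ∀ p ∈ W ∪ B, ∀ q ∈ W ∪ B, pdist p q ≤ δ ^ (-ε) * t

/-- A `t`-bipartite pair (relative to the scale `δ`). -/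
def Bipartite (δ t : ℝ) (W B : Set Param) : Prop :=
  sep3 δ W ∧ sep3 δ B ∧
  (∀ p ∈ W, ∀ q ∈ W, pdist p q ≤ t) ∧ (∀ p ∈ B, ∀ q ∈ B, pdist p q ≤ t) ∧
  (∀ p ∈ B, ∀ q ∈ W, t ≤ pdist p q) ∧
  ∀ p ∈ W ∪ B, ∀ q ∈ W ∪ B, pdist p q ≤ 100 * t

section
open Finset

theorem sq_classes {β γ : Type*} [DecidableEq γ] (C : Finset β) (cl : β → γ) (ϕ : β → ℝ) :
    ∑ q ∈ C, ∑ q' ∈ C, (if cl q = cl q' then ϕ q * ϕ q' else 0)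
      = ∑ c ∈ C.image cl, (∑ q ∈ C with cl q = c, ϕ q) ^ 2 := by
  rw [← Finset.sum_fiberwise_of_maps_to (g := cl) (t := C.image cl)
    (fun q hq => Finset.mem_image_of_mem cl hq)]
  refine Finset.sum_congr rfl fun c _ => ?_
  rw [sq, Finset.sum_mul]
  refine Finset.sum_congr rfl fun q hq => ?_
  rw [Finset.mul_sum, Finset.sum_filter]
  refine Finset.sum_congr rfl fun q' _ => ?_
  have : cl q = c := (Finset.mem_filter.1 hq).2
  rw [this]
  by_cases h : c = cl q'
  · simp [h]
  · simp [h, Ne.symm h]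

theorem pm_third {a b c : ℝ} (ha : a = 1 ∨ a = -1) (hb : b = 1 ∨ b = -1) (hc : c = 1 ∨ c = -1)
    (h1 : a ≠ b) (h2 : a ≠ c) : b = c := by
  rcases ha with rfl | rfl <;> rcases hb with rfl | rfl <;> rcases hc with rfl | rfl <;> simp_all

theorem pure_classes {β γ : Type*} [DecidableEq β] [DecidableEq γ] (C V : Finset β) (cl : β → γ)
    (ϕ : β → ℝ) (hϕ : ∀ q ∈ C, ϕ q = 1 ∨ ϕ q = -1) (hV : V ⊆ C)
    (hd : ∀ q ∈ V, ∀ q' ∈ C, cl q' = cl q → ϕ q' = ϕ q) (m : ℕ) (hm : (V.image cl).card ≤ m) :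
    (V.card : ℝ) ^ 2 ≤ m * ∑ q ∈ C, ∑ q' ∈ C, (if cl q = cl q' then ϕ q * ϕ q' else 0) := by
  rw [sq_classes]
  have e1 : (V.card : ℝ) = ∑ c ∈ V.image cl, ((V.filter (fun q => cl q = c)).card : ℝ) := by
    have := Finset.card_eq_sum_card_image cl V
    exact_mod_cast this
  have e2 : ∀ c ∈ V.image cl, ((V.filter (fun q => cl q = c)).card : ℝ) ^ 2 ≤
      (∑ q ∈ C with cl q = c, ϕ q) ^ 2 := by
    intro c hc
    obtain ⟨q0, hq0, rfl⟩ := Finset.mem_image.1 hc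
    have hall : ∀ q ∈ C.filter (fun q => cl q = cl q0), ϕ q = ϕ q0 := fun q hq =>
      hd q0 hq0 q (Finset.mem_filter.1 hq).1 (Finset.mem_filter.1 hq).2
    rw [Finset.sum_congr rfl hall, Finset.sum_const, nsmul_eq_mul, mul_pow]
    have : ϕ q0 ^ 2 = 1 := by rcases hϕ q0 (hV hq0) with a | a <;> rw [a] <;> norm_num
    rw [this, mul_one]
    have h9 := Finset.card_le_card (Finset.filter_subset_filter (fun q => cl q = cl q0) hV)
    have h10 : ((V.filter (fun q => cl q = cl q0)).card : ℝ) ≤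
      ((C.filter (fun q => cl q = cl q0)).card : ℝ) := by exact_mod_cast h9
    exact pow_le_pow_left₀ (Nat.cast_nonneg _) h10 2
  rw [e1]
  refine sq_sum_le_card_mul_sum_sq.trans ?_
  refine mul_le_mul (by exact_mod_cast hm) ?_ (Finset.sum_nonneg fun _ _ => sq_nonneg _)
    (Nat.cast_nonneg _)
  exact (Finset.sum_le_sum e2).trans (Finset.sum_le_sum_of_subset_of_nonneg
            (Finset.image_subset_image hV) (fun _ _ _ => sq_nonneg _))

theorem mixed_unique {β : Type*} [DecidableEq β] (C : Finset β) (f g : β → ℕ) (ϕ : β → ℝ)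
    (hϕ : ∀ q ∈ C, ϕ q = 1 ∨ ϕ q = -1)
    (h1 : ∀ q ∈ C, ∀ q' ∈ C, q ≠ q' → ϕ q = ϕ q' → (f q < f q' ↔ g q' < g q))
    (h2 : ∀ q ∈ C, ∀ q' ∈ C, q ≠ q' → ϕ q ≠ ϕ q' → (f q < f q' ↔ g q < g q')) (j : ℕ)
    (cl : β → ℕ × ℕ) (hcl : cl = fun q => (f q / 2 ^ j, g q / 2 ^ j)) (q y q' y' : β)
    (hqC : q ∈ C) (hy : y ∈ C) (cy : cl y = cl q) (ey : ϕ y ≠ ϕ q)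
    (hqC' : q' ∈ C) (hy' : y' ∈ C) (cy' : cl y' = cl q') (ey' : ϕ y' ≠ ϕ q') : cl q = cl q' := by
  have hs : ∀ (x y x' y' : β), x ∈ C → y ∈ C → x' ∈ C → y' ∈ C → ϕ x = ϕ x' → ϕ y = ϕ y' →
      ϕ x ≠ ϕ y → ¬ (f x < f x' ∧ f x < f y' ∧ f y < f x' ∧ f y < f y') := by
    rintro x y x' y' hx hy hx' hy' e1 e2 e3 ⟨a1, a2, a3, a4⟩
    have b1 := (h2 y hy x' hx' (by rintro rfl; omega) (by rw [← e1]; exact e3.symm)).1 a3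
    have b2 := (h1 x hx x' hx' (by rintro rfl; omega) e1).1 a1
    have b3 := (h2 x hx y' hy' (by rintro rfl; omega) (by rw [← e2]; exact e3)).1 a2
    have b4 := (h1 y hy y' hy' (by rintro rfl; omega) e2).1 a4
    omega
  have hs' : ∀ (x y x' y' : β), x ∈ C → y ∈ C → x' ∈ C → y' ∈ C → ϕ x = ϕ x' → ϕ y = ϕ y' →
      ϕ x ≠ ϕ y → ¬ (g x < g x' ∧ g x < g y' ∧ g y < g x' ∧ g y < g y') := by
    rintro x y x' y' hx hy hx' hy' e1 e2 e3 ⟨a1, a2, a3, a4⟩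
    have b1 := (h2 y hy x' hx' (by rintro rfl; omega) (by rw [← e1]; exact e3.symm)).2 a3
    have b2 := (h1 x' hx' x hx (by rintro rfl; omega) e1.symm).2 a1
    have b3 := (h2 x hx y' hy' (by rintro rfl; omega) (by rw [← e2]; exact e3)).2 a2
    have b4 := (h1 y' hy' y hy (by rintro rfl; omega) e2.symm).2 a4
    omega
  have hdiv : ∀ j (a b : ℕ), a / 2 ^ j < b / 2 ^ j → a < b := by
    intro j a b h
    by_contra hc
    exact absurd (Nat.div_le_div_right (c := 2 ^ j) (not_lt.1 hc)) (by omega)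
  have key : ∀ x ∈ C, ∀ y ∈ C, ∀ x' ∈ C, ∀ y' ∈ C, cl y = cl x → cl y' = cl x' →
      ϕ x = ϕ x' → ϕ y = ϕ y' → ϕ x ≠ ϕ y → cl x = cl x' := by
    intro x hx y hy x' hx' y' hy' c1 c2 e1 e2 e3
    simp only [hcl, Prod.mk.injEq] at c1 c2 ⊢
    constructor
    · by_contra hne
      rcases Nat.lt_or_gt_of_ne hne with hlt | hlt
      · exact hs x y x' y' hx hy hx' hy' e1 e2 e3 ⟨hdiv j _ _ (by omega), hdiv j _ _ (by omega),
          hdiv j _ _ (by omega), hdiv j _ _ (by omega)⟩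
      · exact hs x' y' x y hx' hy' hx hy e1.symm e2.symm (by rw [← e1, ← e2]; exact e3)
          ⟨hdiv j _ _ (by omega), hdiv j _ _ (by omega),
          hdiv j _ _ (by omega), hdiv j _ _ (by omega)⟩
    · by_contra hne
      rcases Nat.lt_or_gt_of_ne hne with hlt | hlt
      · exact hs' x y x' y' hx hy hx' hy' e1 e2 e3 ⟨hdiv j _ _ (by omega), hdiv j _ _ (by omega),
          hdiv j _ _ (by omega), hdiv j _ _ (by omega)⟩
      · exact hs' x' y' x y hx' hy' hx hy e1.symm e2.symm (by rw [← e1, ← e2]; exact e3)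
          ⟨hdiv j _ _ (by omega), hdiv j _ _ (by omega),
          hdiv j _ _ (by omega), hdiv j _ _ (by omega)⟩
  by_cases e : ϕ q = ϕ q'
  · refine key q hqC y hy q' hqC' y' hy' cy cy' e ?_ ey.symm
    exact pm_third (hϕ q hqC) (hϕ y hy) (hϕ y' hy') ey.symm (by rw [e]; exact ey'.symm)
  · have : cl q = cl y' := by
      refine key q hqC y hy y' hy' q' hqC' cy cy'.symm ?_ ?_ ey.symm
      · exact pm_third (hϕ q' hqC') (hϕ q hqC) (hϕ y' hy') (Ne.symm e) ey'.symm
      · exact pm_third (hϕ q hqC) (hϕ y hy) (hϕ q' hqC') ey.symm e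
    rw [this, cy']

set_option maxHeartbeats 800000 in
theorem pair_lemma {β : Type*} [DecidableEq β] (C : Finset β) (f g : β → ℕ) (ϕ : β → ℝ) (L : ℕ)
    (hf : ∀ q ∈ C, f q < 2 ^ L) (hg : ∀ q ∈ C, g q < 2 ^ L)
    (hϕ : ∀ q ∈ C, ϕ q = 1 ∨ ϕ q = -1)
    (hfi : ∀ q ∈ C, ∀ q' ∈ C, f q = f q' → q = q')
    (h1 : ∀ q ∈ C, ∀ q' ∈ C, q ≠ q' → ϕ q = ϕ q' → (f q < f q' ↔ g q' < g q))
    (h2 : ∀ q ∈ C, ∀ q' ∈ C, q ≠ q' → ϕ q ≠ ϕ q' → (f q < f q' ↔ g q < g q')) :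
    (C.card : ℝ) ^ 2 ≤ 4 * (L + 1) * ∑ j ∈ range (L + 1), ∑ q ∈ C, ∑ q' ∈ C,
      (if (f q / 2 ^ j, g q / 2 ^ j) = (f q' / 2 ^ j, g q' / 2 ^ j) then ϕ q * ϕ q' else 0) := by
  classical
  let cl : ℕ → β → ℕ × ℕ := fun j q => (f q / 2 ^ j, g q / 2 ^ j)
  obtain ⟨Φ, hΦ⟩ : ∃ Φ : ℕ → ℝ, Φ = fun j => ∑ q ∈ C, ∑ q' ∈ C,
    (if cl j q = cl j q' then ϕ q * ϕ q' else 0) := ⟨_, rfl⟩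
  suffices (C.card : ℝ) ^ 2 ≤ 4 * (L + 1) * ∑ j ∈ range (L + 1), Φ j by rw [hΦ] at this; exact this
  obtain ⟨cl', hcl'⟩ : ∃ cl' : ℕ → β → ℕ × ℕ, cl' = cl := ⟨_, rfl⟩
  rw [← hcl'] at hΦ
  have hcl : cl' = fun j q => (f q / 2 ^ j, g q / 2 ^ j) := hcl'
  clear hcl' cl
  rename' cl' => cl
  have hΦ0 : ∀ j, 0 ≤ Φ j := fun j => by
    rw [hΦ]; simp only []; rw [sq_classes]; exact Finset.sum_nonneg fun _ _ => sq_nonneg _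
  obtain ⟨U, hU⟩ : ∃ U : ℕ → Finset β, U = fun j =>
    {q ∈ C | ∃ q' ∈ C, cl j q' = cl j q ∧ ϕ q' ≠ ϕ q} := ⟨_, rfl⟩
  have hmU : ∀ j q, q ∈ U j ↔ q ∈ C ∧ ∃ q' ∈ C, cl j q' = cl j q ∧ ϕ q' ≠ ϕ q := fun j q => by
    rw [hU]; simp
  have huniq : ∀ j, ∀ q ∈ U j, ∀ q' ∈ U j, cl j q = cl j q' := by
    intro j q hq q' hq'
    obtain ⟨hqC, y, hy, cy, ey⟩ := (hmU _ _).1 hq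
    obtain ⟨hqC', y', hy', cy', ey'⟩ := (hmU _ _).1 hq'
    exact mixed_unique C f g ϕ hϕ h1 h2 j (cl j) (by rw [hcl]) q y q' y' hqC hy cy ey hqC' hy' cy' ey'
  have hpure : ∀ j, ∀ V ⊆ C, Disjoint V (U j) → ∀ m : ℕ, (V.image (cl j)).card ≤ m →
      (V.card : ℝ) ^ 2 ≤ m * Φ j := by
    intro j V hV hd m hm
    rw [hΦ]
    refine pure_classes C V (cl j) ϕ hϕ hV ?_ m hm
    intro q hq q' hq' hc
    by_contra hne
    exact Finset.disjoint_left.1 hd hq ((hmU _ _).2 ⟨hV hq, q', hq', hc, hne⟩)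
  have hU0 : U 0 = ∅ := by
    rw [Finset.eq_empty_iff_forall_notMem]
    intro q hqq
    obtain ⟨hq, q', hq', c, e⟩ := (hmU _ _).1 hqq
    simp only [hcl, pow_zero, Nat.div_one, Prod.mk.injEq] at c
    exact e (by rw [hfi q' hq' q hq c.1])
  have hstep : ∀ j, (((U (j+1)).card : ℝ) - (U j).card) ≤ ((U (j+1) \ U j).card : ℝ) := by
    intro j
    have := Finset.le_card_sdiff (U j) (U (j+1))
    rw [sub_le_iff_le_add]
    have h3 : (U (j+1)).card ≤ (U (j+1) \ U j).card + (U j).card := by omega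
    exact_mod_cast h3
  have hstep2 : ∀ j, ((U (j+1) \ U j).card : ℝ) ^ 2 ≤ 4 * Φ j := by
    intro j
    have hsub : U (j+1) \ U j ⊆ C := fun q hq => ((hmU _ _).1 (Finset.mem_sdiff.1 hq).1).1
    have := hpure j _ hsub (Finset.sdiff_disjoint) 4 ?_
    · exact_mod_cast this
    · rcases (U (j+1) \ U j).eq_empty_or_nonempty with he | ⟨q0, hq0⟩
      · rw [he]; simp
      · have : (U (j+1) \ U j).image (cl j) ⊆
          ({2 * (cl (j+1) q0).1, 2 * (cl (j+1) q0).1 + 1} : Finset ℕ) ×ˢ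
          ({2 * (cl (j+1) q0).2, 2 * (cl (j+1) q0).2 + 1} : Finset ℕ) := by
          intro c hc
          obtain ⟨q, hq, rfl⟩ := Finset.mem_image.1 hc
          have := huniq (j+1) q (Finset.mem_sdiff.1 hq).1 q0 (Finset.mem_sdiff.1 hq0).1
          rw [← this]
          simp only [hcl, pow_succ, ← Nat.div_div_eq_div_mul, Finset.mem_product,
            Finset.mem_insert, Finset.mem_singleton]
          omega
        refine (Finset.card_le_card this).trans ?_
        rw [Finset.card_product]
        have := Finset.card_le_two (a := 2 * (cl (j+1) q0).1) (b := 2 * (cl (j+1) q0).1 + 1)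
        have := Finset.card_le_two (a := 2 * (cl (j+1) q0).2) (b := 2 * (cl (j+1) q0).2 + 1)
        nlinarith
  have hsumle : ∀ j ∈ range (L+1), Φ j ≤ ∑ j ∈ range (L + 1), Φ j := fun j hj =>
    Finset.single_le_sum (fun i _ => hΦ0 i) hj
  have hL0 : (0:ℝ) ≤ L := Nat.cast_nonneg _
  by_cases hm : U L = C
  · have htel : (C.card : ℝ) = ∑ j ∈ range L, (((U (j+1)).card : ℝ) - (U j).card) := by
      rw [Finset.sum_range_sub (fun j => ((U j).card : ℝ)), hm, hU0]; simp
    have hle : (C.card : ℝ) ≤ ∑ j ∈ range L, ((U (j+1) \ U j).card : ℝ) := by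
      rw [htel]; exact Finset.sum_le_sum fun j _ => hstep j
    calc (C.card : ℝ) ^ 2 ≤ (∑ j ∈ range L, ((U (j+1) \ U j).card : ℝ)) ^ 2 :=
        pow_le_pow_left₀ (Nat.cast_nonneg _) hle 2
      _ ≤ (range L).card * ∑ j ∈ range L, ((U (j+1) \ U j).card : ℝ) ^ 2 :=
        sq_sum_le_card_mul_sum_sq
      _ ≤ (L + 1) * ∑ j ∈ range (L + 1), 4 * Φ j := by
        rw [Finset.card_range]
        refine mul_le_mul (by linarith) ?_ (Finset.sum_nonneg fun _ _ => sq_nonneg _) (by linarith)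
        · exact (Finset.sum_le_sum fun j _ => hstep2 j).trans
            (Finset.sum_le_sum_of_subset_of_nonneg (Finset.range_subset_range.2 (by omega))
              (fun j _ _ => by linarith [hΦ0 j]))
      _ = _ := by rw [← Finset.mul_sum]; ring
  · -- some element is not mixed at the top level: all colours agree
    have hcl0 : ∀ q ∈ C, cl L q = (0, 0) := fun q hq => by
      simp only [hcl, Nat.div_eq_of_lt (hf q hq), Nat.div_eq_of_lt (hg q hq)]
    have hUe : Disjoint C (U L) := by
      rw [Finset.disjoint_right]
      intro q hq hqC
      apply hm
      obtain ⟨hqC, y, hy, cy, ey⟩ := (hmU _ _).1 hq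
      refine Finset.Subset.antisymm (fun x hx => ((hmU _ _).1 hx).1) fun x hx => ?_
      refine (hmU _ _).2 ⟨hx, ?_⟩
      by_cases e : ϕ q = ϕ x
      · exact ⟨y, hy, by rw [hcl0 y hy, hcl0 x hx], by rw [← e]; exact ey⟩
      · exact ⟨q, hqC, by rw [hcl0 q hqC, hcl0 x hx], e⟩
    have := hpure L C (Finset.Subset.refl _) hUe 1 (by
      have : C.image (cl L) ⊆ {(0,0)} := by
        intro c hc
        obtain ⟨q, hq, rfl⟩ := Finset.mem_image.1 hc
        simp [hcl0 q hq]
      simpa using Finset.card_le_card this)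
    have h5 := hsumle L (by simp)
    have h6 := hΦ0 L
    rw [Nat.cast_one, one_mul] at this
    nlinarith
end

section
open Finset

theorem rank_lt_iff {β : Type*} (N : Finset β) (f : β → ℝ)
    (q q' : β) (hq : q ∈ N) :
    (N.filter (fun x => f x < f q)).card < (N.filter (fun x => f x < f q')).card ↔ f q < f q' := by
  constructor
  · intro h
    by_contra hc
    push Not at hc
    refine absurd (Finset.card_le_card (s := N.filter (fun x => f x < f q'))
      (t := N.filter (fun x => f x < f q)) ?_) (by omega)
    intro x hx
    rw [Finset.mem_filter] at hx ⊢
    exact ⟨hx.1, hx.2.trans_le hc⟩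
  · intro h
    apply Finset.card_lt_card
    rw [Finset.ssubset_iff_of_subset]
    · exact ⟨q, by simp [hq, h], by simp⟩
    · intro x hx
      rw [Finset.mem_filter] at hx ⊢
      exact ⟨hx.1, hx.2.trans h⟩

theorem sgn_mul_eq {x y : ℝ} (hx : x = 1 ∨ x = -1) (hy : y = 1 ∨ y = -1) {z w : ℝ}
    (hz : z = 1 ∨ z = -1) (hw : w = 1 ∨ w = -1) (h : 0 < x * y * (-z) * w) : y * w = - (x * z) := by
  rcases hx with rfl | rfl <;> rcases hy with rfl | rfl <;> rcases hz with rfl | rfl <;>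
    rcases hw with rfl | rfl <;> first | (exfalso; norm_num at h; done) | norm_num

theorem sgn_pm {x : ℝ} (h : x ≠ 0) : Real.sign x = 1 ∨ Real.sign x = -1 := by
  rcases lt_or_gt_of_ne h with h | h
  · right; exact Real.sign_of_neg h
  · left; exact Real.sign_of_pos h

theorem sgn_mul (x y : ℝ) : Real.sign (x * y) = Real.sign x * Real.sign y := by
  rcases lt_trichotomy x 0 with h | h | h <;> rcases lt_trichotomy y 0 with h' | h' | h' <;>
  simp [h, h', Real.sign_of_neg, Real.sign_of_pos, mul_pos_of_neg_of_neg, mul_neg_of_neg_of_pos,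
    mul_neg_of_pos_of_neg, mul_pos]

open Classical in
/-- sign of the ordered pair inside a rank block -/
noncomputable def sBlk {α β : Type*} (H : α → β → Prop) (φ : α → β → ℝ) (rk : α → β → ℕ) (j : ℕ)
    (p : α) (q q' : β) : ℝ :=
  if H p q ∧ H p q' ∧ rk p q / 2 ^ j = rk p q' / 2 ^ j then Real.sign (φ p q - φ p q') else 0

set_option maxHeartbeats 800000 in
open Classical in
theorem off_diag {α β : Type*} (B : Finset β) (H : α → β → Prop)
    (φ : α → β → ℝ) (L : ℕ) (hB : B.card < 2 ^ L) (p p' : α) (hpp : p ≠ p')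
    (hi2 : ∀ q ∈ B, H p q → H p' q → φ p q ≠ φ p' q)
    (hi : ∀ x, x = p ∨ x = p' → ∀ q ∈ B, ∀ q' ∈ B, H x q → H x q' → φ x q = φ x q' → q = q')
    (h4 : ∀ q ∈ B, ∀ q' ∈ B, q ≠ q' → H p q → H p q' → H p' q → H p' q' →
      0 < (φ p q - φ p' q) * (φ p' q - φ p' q') * (φ p' q' - φ p q') * (φ p q - φ p q'))
    (rk : α → β → ℕ) (hrk : rk = fun x q => ((B.filter (H x)).filter (fun y => φ x y < φ x q)).card) :
    ∑ j ∈ range (L + 1), ∑ q ∈ B, ∑ q' ∈ B, sBlk H φ rk j p q q' * sBlk H φ rk j p' q q' ≤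
      (L + 1) * ((B.filter (fun q => H p q ∧ H p' q)).card : ℝ) -
        ((B.filter (fun q => H p q ∧ H p' q)).card : ℝ) ^ 2 / (4 * (L + 1)) := by
  have hC : ∀ q, q ∈ B.filter (fun q => H p q ∧ H p' q) ↔ q ∈ B ∧ H p q ∧ H p' q := by simp
  generalize hCC : B.filter (fun q => H p q ∧ H p' q) = C at hC ⊢
  clear hCC
  let ϕ : β → ℝ := fun q => Real.sign (φ p q - φ p' q)
  have hϕ : ∀ q ∈ C, ϕ q = 1 ∨ ϕ q = -1 := fun q hq =>
    sgn_pm (sub_ne_zero.2 (hi2 q ((hC q).1 hq).1 ((hC q).1 hq).2.1 ((hC q).1 hq).2.2))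
  have hrlt : ∀ x q, rk x q < 2 ^ L := fun x q => by
    rw [hrk]
    exact ((Finset.card_le_card ((Finset.filter_subset _ _).trans (Finset.filter_subset _ _)))).trans_lt hB
  have hrki : ∀ x q q', q ∈ B → H x q → (rk x q < rk x q' ↔ φ x q < φ x q') := fun x q q' h h' => by
    rw [hrk]; exact rank_lt_iff _ _ _ _ (by simp [h, h'])
  have hs : ∀ q ∈ C, ∀ q' ∈ C, q ≠ q' →
      Real.sign (φ p q - φ p q') * Real.sign (φ p' q - φ p' q') = - (ϕ q * ϕ q') := by
    intro q hq q' hq' hne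
    obtain ⟨a1, a2, a3⟩ := (hC q).1 hq
    obtain ⟨b1, b2, b3⟩ := (hC q').1 hq'
    have := h4 q a1 q' b1 hne a2 b2 a3 b3
    have h5 := Real.sign_of_pos this
    rw [sgn_mul, sgn_mul, sgn_mul, show φ p' q' - φ p q' = -(φ p q' - φ p' q') by ring,
      Real.sign_neg] at h5
    rw [mul_comm]
    refine sgn_mul_eq (hϕ q hq) (sgn_pm ?_) (hϕ q' hq') (sgn_pm ?_) (by rw [h5]; norm_num)
    · rw [sub_ne_zero]; intro h; exact hne (hi p' (Or.inr rfl) q a1 q' b1 a3 b3 h)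
    · rw [sub_ne_zero]; intro h; exact hne (hi p (Or.inl rfl) q a1 q' b1 a2 b2 h)
  have hx1 : ∀ x y : ℝ, Real.sign (x - y) * 1 = Real.sign (x-y) := by simp
  have hsgn : ∀ x y : ℝ, x ≠ y → (x < y ∧ Real.sign (x - y) = -1) ∨ (y < x ∧ Real.sign (x-y) = 1) := by
    intro x y h
    rcases lt_or_gt_of_ne h with h | h
    · left; exact ⟨h, Real.sign_of_neg (by linarith)⟩
    · right; exact ⟨h, Real.sign_of_pos (by linarith)⟩
  have hord : ∀ q ∈ C, ∀ q' ∈ C, q ≠ q' → 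
      (ϕ q = ϕ q' → (rk p q < rk p q' ↔ rk p' q' < rk p' q)) ∧ 
      (ϕ q ≠ ϕ q' → (rk p q < rk p q' ↔ rk p' q < rk p' q')) := by
    intro q hq q' hq' hne
    have h6 := hs q hq q' hq' hne
    obtain ⟨a1, a2, a3⟩ := (hC q).1 hq
    obtain ⟨b1, b2, b3⟩ := (hC q').1 hq'
    rw [hrki p q q' a1 a2, hrki p' q' q b1 b3, hrki p' q q' a1 a3]
    have n1 : φ p q ≠ φ p q' := fun h => hne (hi p (Or.inl rfl) q a1 q' b1 a2 b2 h)
    have n2 : φ p' q ≠ φ p' q' := fun h => hne (hi p' (Or.inr rfl) q a1 q' b1 a3 b3 h)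
    rcases hϕ q hq with c | c <;> rcases hϕ q' hq' with d | d <;> rw [c, d] at h6 ⊢ <;>
    rcases hsgn _ _ n1 with ⟨e, e'⟩ | ⟨e, e'⟩ <;> rcases hsgn _ _ n2 with ⟨f, f'⟩ | ⟨f, f'⟩ <;>
    rw [e', f'] at h6 <;> norm_num at h6 <;> constructor <;> intro h <;> norm_num at h <;>
    constructor <;> intro <;> linarith
  have hpl := pair_lemma C (rk p) (rk p') ϕ L (fun q _ => hrlt _ _) (fun q _ => hrlt _ _) hϕ
    (by
      intro q hq q' hq' h
      obtain ⟨a1, a2, a3⟩ := (hC q).1 hq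
      obtain ⟨b1, b2, b3⟩ := (hC q').1 hq'
      apply hi p (Or.inl rfl) q a1 q' b1 a2 b2
      apply le_antisymm
      · by_contra hc; push Not at hc; exact absurd ((hrki p q' q b1 b2).2 hc) (by omega)
      · by_contra hc; push Not at hc; exact absurd ((hrki p q q' a1 a2).2 hc) (by omega))
    (fun q hq q' hq' hne => (hord q hq q' hq' hne).1)
    (fun q hq q' hq' hne => (hord q hq q' hq' hne).2)
  have hCB : C ⊆ B := fun q hq => ((hC q).1 hq).1
  have hj : ∀ j, ∑ q ∈ B, ∑ q' ∈ B, sBlk H φ rk j p q q' * sBlk H φ rk j p' q q' =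
      C.card - ∑ q ∈ C, ∑ q' ∈ C, (if (rk p q / 2 ^ j, rk p' q / 2 ^ j) =
        (rk p q' / 2 ^ j, rk p' q' / 2 ^ j) then ϕ q * ϕ q' else 0) := by
    intro j
    have e1 : ∑ q ∈ B, ∑ q' ∈ B, sBlk H φ rk j p q q' * sBlk H φ rk j p' q q' =
      ∑ q ∈ C, ∑ q' ∈ C, sBlk H φ rk j p q q' * sBlk H φ rk j p' q q' := by
      symm
      have z : ∀ q ∈ B, q ∉ C → ∀ q', sBlk H φ rk j p q q' * sBlk H φ rk j p' q q' = 0 ∧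
          sBlk H φ rk j p q' q * sBlk H φ rk j p' q' q = 0 := by
        intro q hq hqC q'
        rw [hC] at hqC
        have hn : ¬ H p q ∨ ¬ H p' q := by tauto
        clear hord hs hrki hrlt hpl
        rcases hn with h | h
        · unfold sBlk; simp [h]
        · unfold sBlk; simp [h]
      calc _ = ∑ q ∈ C, ∑ q' ∈ B, sBlk H φ rk j p q q' * sBlk H φ rk j p' q q' := by
            refine Finset.sum_congr rfl fun q hq => ?_
            exact Finset.sum_subset hCB fun q' h h' => (z q' h h' q).2
        _ = _ := Finset.sum_subset hCB fun q' h h' => Finset.sum_eq_zero fun q _ => (z q' h h' q).1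
    rw [e1]
    have e2 : (C.card : ℝ) = ∑ q ∈ C, ∑ q' ∈ C, if q = q' then (1:ℝ) else 0 := by simp
    rw [e2, ← Finset.sum_sub_distrib]
    refine Finset.sum_congr rfl fun q hq => ?_
    rw [← Finset.sum_sub_distrib]
    refine Finset.sum_congr rfl fun q' hq' => ?_
    obtain ⟨a1, a2, a3⟩ := (hC q).1 hq
    obtain ⟨b1, b2, b3⟩ := (hC q').1 hq'
    unfold sBlk
    simp only [a2, a3, b2, b3, true_and, Prod.mk.injEq]
    by_cases hqq : q = q'
    · subst hqq
      have : ϕ q * ϕ q = 1 := by rcases hϕ q hq with a | a <;> rw [a] <;> norm_num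
      simp [this]
    · rw [if_neg hqq]
      have := hs q hq q' hq' hqq
      by_cases c1 : rk p q / 2 ^ j = rk p q' / 2 ^ j <;>
      by_cases c2 : rk p' q / 2 ^ j = rk p' q' / 2 ^ j <;> simp [c1, c2, this]
  rw [Finset.sum_congr rfl (fun j _ => hj j), Finset.sum_sub_distrib, Finset.sum_const,
    Finset.card_range, nsmul_eq_mul]
  have hL : (0:ℝ) < 4 * (L + 1) := by positivity
  push_cast
  have := (div_le_iff₀' hL).2 hpl
  linarith
end

section
open Finset

open Classical in
theorem mt_half {α β : Type*} (W : Finset α) (B : Finset β) (H : α → β → Prop)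
    (φ : α → β → ℝ) (L : ℕ) (hB : B.card < 2 ^ L)
    (hi1 : ∀ p ∈ W, ∀ q ∈ B, ∀ q' ∈ B, H p q → H p q' → φ p q = φ p q' → q = q')
    (hi2 : ∀ q ∈ B, ∀ p ∈ W, ∀ p' ∈ W, H p q → H p' q → φ p q = φ p' q → p = p')
    (h4 : ∀ p ∈ W, ∀ p' ∈ W, ∀ q ∈ B, ∀ q' ∈ B, p ≠ p' → q ≠ q' →
      H p q → H p q' → H p' q → H p' q' →
      0 < (φ p q - φ p' q) * (φ p' q - φ p' q') * (φ p' q' - φ p q') * (φ p q - φ p q'))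
    (k : α → α → ℝ) (hk : k = fun p p' => ((B.filter (fun q => H p q ∧ H p' q)).card : ℝ)) :
    ∑ p ∈ W, ∑ p' ∈ W, k p p' ^ 2 ≤
      8 * (L + 1) ^ 2 * (∑ p ∈ W, ∑ p' ∈ W, k p p' + ∑ p ∈ W, k p p ^ 2) := by
  obtain ⟨rk, hrk⟩ : ∃ rk : α → β → ℕ, rk = fun x q =>
    ((B.filter (H x)).filter (fun y => φ x y < φ x q)).card := ⟨_, rfl⟩
  have hL : (0:ℝ) < L + 1 := by positivity
  have hk0 : ∀ p p', 0 ≤ k p p' := fun p p' => by rw [hk]; exact Nat.cast_nonneg _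
  have key : ∀ p ∈ W, ∀ p' ∈ W, 
      ∑ j ∈ range (L + 1), ∑ q ∈ B, ∑ q' ∈ B, sBlk H φ rk j p q q' * sBlk H φ rk j p' q q' ≤
      (L + 1) * (k p p' + if p = p' then 2 * k p p ^ 2 else 0) - k p p' ^ 2 / (4 * (L + 1)) := by
    intro p hp p' hp'
    by_cases hpp : p = p'
    · subst hpp
      rw [if_pos rfl]
      have h1 : ∀ j ∈ range (L+1), ∑ q ∈ B, ∑ q' ∈ B, sBlk H φ rk j p q q' * sBlk H φ rk j p q q' ≤
          k p p ^ 2 := by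
        intro j _
        have h2 : k p p = ∑ q ∈ B, if H p q then 1 else 0 := by
          rw [hk]; simp
        rw [h2, sq, Finset.sum_mul_sum]
        refine Finset.sum_le_sum fun q _ => Finset.sum_le_sum fun q' _ => ?_
        have hs2 : Real.sign (φ p q - φ p q') * Real.sign (φ p q - φ p q') ≤ 1 := by
          rcases Real.sign_apply_eq (φ p q - φ p q') with h | h | h <;> rw [h] <;> norm_num
        unfold sBlk
        by_cases h : H p q <;> by_cases h' : H p q' <;> simp [h, h']
        split_ifs
        · exact hs2
        · norm_num
      have h3 := Finset.sum_le_sum h1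
      rw [Finset.sum_const, Finset.card_range, nsmul_eq_mul] at h3
      push_cast at h3
      have h4 : k p p ^ 2 / (4 * (L + 1)) ≤ (L + 1) * k p p ^ 2 := by
        rw [div_le_iff₀ (by positivity)]
        have : (1:ℝ) ≤ L + 1 := by linarith [Nat.cast_nonneg (α := ℝ) L]
        have h5 : (1:ℝ) ≤ (L+1) * (4 * (L+1)) := by nlinarith
        nlinarith [sq_nonneg (k p p)]
      have := mul_nonneg hL.le (hk0 p p)
      linarith
    · rw [if_neg hpp, add_zero, hk]
      refine off_diag B H φ L hB p p' hpp (fun q hq h h' he => hpp (hi2 q hq p hp p' hp' h h' he)) ?_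
        (fun q hq q' hq' hne a b c d => h4 p hp p' hp' q hq q' hq' hpp hne a b c d) rk hrk
      rintro x (rfl | rfl)
      · exact hi1 _ hp
      · exact hi1 _ hp'
  have hpos : 0 ≤ ∑ p ∈ W, ∑ p' ∈ W,
      ∑ j ∈ range (L + 1), ∑ q ∈ B, ∑ q' ∈ B, sBlk H φ rk j p q q' * sBlk H φ rk j p' q q' := by
    have e : ∑ p ∈ W, ∑ p' ∈ W,
      ∑ j ∈ range (L + 1), ∑ q ∈ B, ∑ q' ∈ B, sBlk H φ rk j p q q' * sBlk H φ rk j p' q q' =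
      ∑ j ∈ range (L + 1), ∑ q ∈ B, ∑ q' ∈ B, (∑ p ∈ W, sBlk H φ rk j p q q') ^ 2 := by
      rw [← Finset.sum_product', Finset.sum_comm]
      refine Finset.sum_congr rfl fun j _ => ?_
      rw [Finset.sum_comm]
      refine Finset.sum_congr rfl fun q _ => ?_
      rw [Finset.sum_comm]
      refine Finset.sum_congr rfl fun q' _ => ?_
      rw [sq, Finset.sum_mul_sum, Finset.sum_product]
    rw [e]
    exact Finset.sum_nonneg fun _ _ => Finset.sum_nonneg fun _ _ => Finset.sum_nonneg fun _ _ =>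
      sq_nonneg _
  have hsum := hpos.trans (Finset.sum_le_sum fun p hp => Finset.sum_le_sum fun p' hp' => key p hp p' hp')
  have e2 : ∑ p ∈ W, ∑ p' ∈ W, ((L + 1) * (k p p' + if p = p' then 2 * k p p ^ 2 else 0)
      - k p p' ^ 2 / (4 * (L + 1))) = (L + 1) * (∑ p ∈ W, ∑ p' ∈ W, k p p' + 2 * ∑ p ∈ W, k p p ^ 2)
        - (∑ p ∈ W, ∑ p' ∈ W, k p p' ^ 2) / (4 * (L + 1)) := by
    simp only [Finset.sum_sub_distrib, ← Finset.mul_sum, ← Finset.sum_div, Finset.sum_add_distrib]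
    congr 3
    rw [Finset.mul_sum]
    refine Finset.sum_congr rfl fun p hp => ?_
    simp [hp]
  rw [e2, sub_nonneg, div_le_iff₀ (by positivity)] at hsum
  have hX : 0 ≤ ∑ p ∈ W, ∑ p' ∈ W, k p p' :=
    Finset.sum_nonneg fun _ _ => Finset.sum_nonneg fun _ _ => hk0 _ _
  refine hsum.trans ?_
  have : (0:ℝ) ≤ 4 * (L+1)^2 * ∑ p ∈ W, ∑ p' ∈ W, k p p' := by positivity
  linarith

open Classical in
theorem mt_double {α β : Type*} (W : Finset α) (B : Finset β) (H : α → β → Prop) :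
    ∑ p ∈ W, ∑ p' ∈ W, ((B.filter (fun q => H p q ∧ H p' q)).card : ℝ) =
      ∑ q ∈ B, ((W.filter (fun p => H p q ∧ H p q)).card : ℝ) ^ 2 := by
  have h1 : ∀ p p', ((B.filter (fun q => H p q ∧ H p' q)).card : ℝ) =
      ∑ q ∈ B, (if H p q then (1:ℝ) else 0) * (if H p' q then 1 else 0) := by
    intro p p'
    rw [Finset.card_filter]
    push_cast
    refine Finset.sum_congr rfl fun q _ => ?_
    by_cases h : H p q <;> by_cases h' : H p' q <;> simp [h, h']
  have h2 : ∀ q, ((W.filter (fun p => H p q ∧ H p q)).card : ℝ) = ∑ p ∈ W, if H p q then (1:ℝ) else 0 := by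
    intro q; simp
  simp only [h1, h2, sq, Finset.sum_mul_sum]
  rw [← Finset.sum_product', Finset.sum_comm]
  refine Finset.sum_congr rfl fun q _ => ?_
  rw [Finset.sum_product]

open Classical in
/-- The Marcus–Tardos type bound. -/
theorem mt_lemma {α β : Type*} (W : Finset α) (B : Finset β) (H : α → β → Prop)
    (φ : α → β → ℝ) (L n : ℕ) (hW : W.card ≤ n) (hB : B.card ≤ n) (hn : n < 2 ^ L)
    (hi1 : ∀ p ∈ W, ∀ q ∈ B, ∀ q' ∈ B, H p q → H p q' → φ p q = φ p q' → q = q')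
    (hi2 : ∀ q ∈ B, ∀ p ∈ W, ∀ p' ∈ W, H p q → H p' q → φ p q = φ p' q → p = p')
    (h4 : ∀ p ∈ W, ∀ p' ∈ W, ∀ q ∈ B, ∀ q' ∈ B, p ≠ p' → q ≠ q' →
      H p q → H p q' → H p' q → H p' q' →
      0 < (φ p q - φ p' q) * (φ p' q - φ p' q') * (φ p' q' - φ p q') * (φ p q - φ p q')) :
    (((W ×ˢ B).filter (fun x => H x.1 x.2)).card : ℝ) ^ 2 ≤ 16 * (L + 1) ^ 2 * (n:ℝ) ^ 3 := by
  have a1 := mt_half W B H φ L (hB.trans_lt hn) hi1 hi2 h4 _ rfl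
  have a2 := mt_half B W (fun q p => H p q) (fun q p => φ p q) L (hW.trans_lt hn)
    (fun q hq p hp p' hp' h h' e => hi2 q hq p hp p' hp' h h' e)
    (fun p hp q hq q' hq' h h' e => hi1 p hp q hq q' hq' h h' e)
    (fun q hq q' hq' p hp p' hp' hne hne' c1 c2 c3 c4 => by
      have := h4 p hp p' hp' q hq q' hq' hne' hne c1 c3 c2 c4
      have e : (φ p q - φ p q') * (φ p q' - φ p' q') * (φ p' q' - φ p' q) * (φ p q - φ p' q) =
       (φ p q - φ p' q) * (φ p' q - φ p' q') * (φ p' q' - φ p q') * (φ p q - φ p q') := by ring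
      linarith) _ rfl
  have cs : ∀ {γ : Type _} (V : Finset γ) (k : γ → γ → ℝ) (_ : ∀ a b, 0 ≤ k a b) (_ : V.card ≤ n),
      (∑ p ∈ V, ∑ p' ∈ V, k p p') ^ 2 ≤ (n:ℝ)^2 * ∑ p ∈ V, ∑ p' ∈ V, k p p' ^ 2 := by
    intro γ V k hk hV
    rw [← Finset.sum_product', ← Finset.sum_product']
    refine sq_sum_le_card_mul_sum_sq.trans ?_
    refine mul_le_mul_of_nonneg_right ?_ (Finset.sum_nonneg fun _ _ => sq_nonneg _)
    rw [Finset.card_product]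
    have : (V.card : ℝ) ≤ n := by exact_mod_cast hV
    push_cast
    nlinarith [Nat.cast_nonneg (α := ℝ) V.card]
  have c1 := cs W (fun p p' => ((B.filter (fun q => H p q ∧ H p' q)).card : ℝ))
    (fun _ _ => Nat.cast_nonneg _) hW
  have cs' : ∀ (V : Finset β) (k : β → β → ℝ) (_ : ∀ a b, 0 ≤ k a b) (_ : V.card ≤ n),
      (∑ p ∈ V, ∑ p' ∈ V, k p p') ^ 2 ≤ (n:ℝ)^2 * ∑ p ∈ V, ∑ p' ∈ V, k p p' ^ 2 := by
    intro V k hk hV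
    rw [← Finset.sum_product', ← Finset.sum_product']
    refine sq_sum_le_card_mul_sum_sq.trans ?_
    refine mul_le_mul_of_nonneg_right ?_ (Finset.sum_nonneg fun _ _ => sq_nonneg _)
    rw [Finset.card_product]
    have : (V.card : ℝ) ≤ n := by exact_mod_cast hV
    push_cast
    nlinarith [Nat.cast_nonneg (α := ℝ) V.card]
  have c2 := cs' B (fun q q' => ((W.filter (fun p => H p q ∧ H p q')).card : ℝ))
    (fun _ _ => Nat.cast_nonneg _) hB
  have d1 := mt_double W B H
  have d2 := mt_double B W (fun q p => H p q)
  simp only [← d2] at a1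
  simp only [← d1] at a2
  generalize hX : ∑ p ∈ W, ∑ p' ∈ W, ((B.filter (fun q => H p q ∧ H p' q)).card : ℝ) = X at *
  generalize hY : ∑ q ∈ B, ∑ q' ∈ B, ((W.filter (fun p => H p q ∧ H p q')).card : ℝ) = Y at *
  have hX0 : 0 ≤ X := by
    rw [← hX]; exact Finset.sum_nonneg fun _ _ => Finset.sum_nonneg fun _ _ => Nat.cast_nonneg _
  have hY0 : 0 ≤ Y := by
    rw [← hY]; exact Finset.sum_nonneg fun _ _ => Finset.sum_nonneg fun _ _ => Nat.cast_nonneg _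
  obtain ⟨c, hc⟩ : ∃ c : ℝ, c = (n:ℝ)^2 * (8 * (L+1)^2) := ⟨_, rfl⟩
  have hc0 : 0 ≤ c := by rw [hc]; positivity
  have e1 : X ^ 2 ≤ c * (X + Y) := by
    refine c1.trans ((mul_le_mul_of_nonneg_left a1 (by positivity)).trans (le_of_eq ?_))
    rw [hc]; ring
  have e2 : Y ^ 2 ≤ c * (X + Y) := by
    refine c2.trans ((mul_le_mul_of_nonneg_left a2 (by positivity)).trans (le_of_eq ?_))
    rw [hc]; ring
  have hXle : X ≤ 2 * c := by
    by_contra hcon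
    push Not at hcon
    rcases le_total X Y with h | h <;> nlinarith
  have e3 : (((W ×ˢ B).filter (fun x => H x.1 x.2)).card : ℝ) =
      ∑ q ∈ B, ((W.filter (fun p => H p q ∧ H p q)).card : ℝ) := by
    rw [Finset.card_filter, Finset.sum_product_right]
    push_cast
    refine Finset.sum_congr rfl fun q _ => ?_
    simp
  rw [e3]
  refine sq_sum_le_card_mul_sum_sq.trans ?_
  rw [← d1]
  have : (B.card : ℝ) ≤ n := by exact_mod_cast hB
  calc (B.card : ℝ) * X ≤ n * (2 * c) := mul_le_mul this hXle hX0 (Nat.cast_nonneg _)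
    _ = _ := by rw [hc]; ring
end

section
open Finset

theorem samp_weight {α : Type*} [DecidableEq α] (P T : Finset α) (hT : T ⊆ P) (π : ℝ) :
    ∑ S ∈ P.powerset, π ^ S.card * (1 - π) ^ (P \ S).card * (if T ⊆ S then (1:ℝ) else 0) = π ^ T.card := by
  have h := Finset.prod_add (fun _ : α => π) (fun i => if i ∈ T then 0 else 1 - π) P
  have e1 : ∏ i ∈ P, (π + if i ∈ T then 0 else 1 - π) = π ^ T.card := by
    rw [← Finset.prod_const, ← Finset.prod_subset hT]
    · exact Finset.prod_congr rfl fun i hi => by simp [hi]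
    · intro i _ hi; simp [hi]
  rw [← e1, h]
  refine Finset.sum_congr rfl fun S hS => ?_
  rw [Finset.mem_powerset] at hS
  rw [Finset.prod_const]
  by_cases hTS : T ⊆ S
  · rw [if_pos hTS, mul_one]
    congr 1
    rw [← Finset.prod_const]
    refine Finset.prod_congr rfl fun i hi => ?_
    rw [if_neg (fun h => (Finset.mem_sdiff.1 hi).2 (hTS h))]
  · rw [if_neg hTS, mul_zero]
    obtain ⟨i, hiT, hiS⟩ := Finset.not_subset.1 hTS
    rw [Finset.prod_eq_zero (Finset.mem_sdiff.2 ⟨hT hiT, hiS⟩) (by simp [hiT]), mul_zero]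

set_option maxHeartbeats 800000 in
open Classical in
theorem sampling {α : Type*} (P : Finset α) (E : Finset (α × α)) (φ : α → α → ℝ)
    (Conf : α × α → Finset α) (L : ℕ) (G c π : ℝ) (hL : P.card < 2 ^ L) (hG : 0 < G)
    (hE : ∀ e ∈ E, e.1 ∈ P ∧ e.2 ∈ P ∧ e.1 ≠ e.2)
    (hconf : ∀ e ∈ E, Conf e ⊆ P ∧ (∀ x ∈ Conf e, x ≠ e.1 ∧ x ≠ e.2) ∧ ((Conf e).card : ℝ) ≤ c)
    (hc1 : ∀ p q q', (p, q) ∈ E → (p, q') ∈ E → q ≠ q' → |φ p q - φ p q'| < G → q' ∈ Conf (p, q))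
    (hc2 : ∀ p p' q, (p, q) ∈ E → (p', q) ∈ E → p ≠ p' → |φ p q - φ p' q| < G → p' ∈ Conf (p, q))
    (h4 : ∀ p p' q q', p ≠ p' → q ≠ q' → (p, q) ∈ E → (p, q') ∈ E → (p', q) ∈ E → (p', q') ∈ E →
      G ≤ |φ p q - φ p' q| → G ≤ |φ p' q - φ p' q'| → G ≤ |φ p' q' - φ p q'| → G ≤ |φ p q - φ p q'| →
      0 < (φ p q - φ p' q) * (φ p' q - φ p' q') * (φ p' q' - φ p q') * (φ p q - φ p q'))
    (hπ0 : 0 < π) (hπ1 : π ≤ 1) (hcπ : c * π ≤ 1 / 2) (hN : 1 ≤ P.card * π) :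
    (E.card : ℝ) ^ 2 * π ≤ 144 * (L + 1) ^ 2 * (P.card : ℝ) ^ 3 := by
  have hper : ∀ S ⊆ P, ∀ y : ℝ, 0 < y → ∑ e ∈ E, (if ({e.1, e.2} : Finset α) ⊆ S then (1:ℝ) else 0) ≤
      ∑ e ∈ E, ∑ x ∈ Conf e, (if ({e.1, e.2, x} : Finset α) ⊆ S then (1:ℝ) else 0) +
      2 * (L + 1) * ((∑ a ∈ P, ∑ b ∈ P, if ({a, b} : Finset α) ⊆ S then (1:ℝ) else 0) / y +
        y * ∑ a ∈ P, if ({a} : Finset α) ⊆ S then (1:ℝ) else 0) := by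
    intro S hS y hy
    have hcard : (∑ a ∈ P, if ({a} : Finset α) ⊆ S then (1:ℝ) else 0) = S.card := by
      simp only [Finset.singleton_subset_iff]
      rw [Finset.sum_ite_mem, Finset.inter_eq_right.2 hS]; simp
    have hcard2 : (∑ a ∈ P, ∑ b ∈ P, if ({a, b} : Finset α) ⊆ S then (1:ℝ) else 0) = (S.card:ℝ) ^ 2 := by
      rw [← hcard, sq, Finset.sum_mul_sum]
      refine Finset.sum_congr rfl fun a _ => Finset.sum_congr rfl fun b _ => ?_
      by_cases ha : a ∈ S <;> by_cases hb : b ∈ S <;> simp [Finset.insert_subset_iff, ha, hb]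
    rw [hcard, hcard2]
    let H : α → α → Prop := fun p q => (p, q) ∈ E ∧ ∀ x ∈ Conf (p, q), x ∉ S
    have g1 : ∀ p ∈ S, ∀ q ∈ S, ∀ q' ∈ S, H p q → H p q' → q ≠ q' → G ≤ |φ p q - φ p q'| := by
      intro p _ q _ q' hq' a b hne
      by_contra hlt
      push Not at hlt
      exact a.2 q' (hc1 p q q' a.1 b.1 hne hlt) hq'
    have g2 : ∀ p ∈ S, ∀ p' ∈ S, ∀ q ∈ S, H p q → H p' q → p ≠ p' → G ≤ |φ p q - φ p' q| := by
      intro p _ p' hp' q _ a b hne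
      by_contra hlt
      push Not at hlt
      exact a.2 p' (hc2 p p' q a.1 b.1 hne hlt) hp'
    have hmt := mt_lemma S S H φ L S.card le_rfl le_rfl ((Finset.card_le_card hS).trans_lt hL)
      (fun p hp q hq q' hq' a b e => by
        by_contra hne
        have := g1 p hp q hq q' hq' a b hne
        rw [e, sub_self, abs_zero] at this; linarith)
      (fun q hq p hp p' hp' a b e => by
        by_contra hne
        have := g2 p hp p' hp' q hq a b hne
        rw [e, sub_self, abs_zero] at this; linarith)
      (fun p hp p' hp' q hq q' hq' n1 n2 a b c d => h4 p p' q q' n1 n2 a.1 b.1 c.1 d.1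
        (g2 p hp p' hp' q hq a c n1) (g1 p' hp' q hq q' hq' c d n2)
        (g2 p' hp' p hp q' hq' d b n1.symm) (g1 p hp q hq q' hq' a b n2))
    have hle : (((S ×ˢ S).filter (fun x => H x.1 x.2)).card : ℝ) ≤
        2 * (L + 1) * ((S.card : ℝ) ^ 2 / y + y * S.card) := by
      refine abs_le_of_sq_le_sq' ?_ (by positivity) |>.2
      refine le_trans (le_of_eq (by congr!)) (hmt.trans ?_)
      have : (S.card:ℝ) ^ 3 * 4 ≤ ((S.card : ℝ) ^ 2 / y + y * S.card) ^ 2 := by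
        have e : ((S.card : ℝ) ^ 2 / y) * (y * S.card) = (S.card:ℝ)^3 := by field_simp
        nlinarith [sq_nonneg ((S.card : ℝ) ^ 2 / y - y * S.card)]
      have h2 : (0:ℝ) ≤ 4 * (L+1)^2 := by positivity
      calc _ = 4 * ((L:ℝ)+1)^2 * ((S.card:ℝ) ^ 3 * 4) := by ring
        _ ≤ 4 * ((L:ℝ)+1)^2 * ((S.card : ℝ) ^ 2 / y + y * S.card) ^ 2 := by
          exact mul_le_mul_of_nonneg_left this h2
        _ = _ := by ring
    refine le_trans ?_ (add_le_add le_rfl hle)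
    have hfc : (((S ×ˢ S).filter (fun x => H x.1 x.2)).card : ℝ) =
        ∑ e ∈ E, if (e.1 ∈ S ∧ e.2 ∈ S ∧ ∀ x ∈ Conf e, x ∉ S) then (1:ℝ) else 0 := by
      rw [← Finset.sum_filter, Finset.sum_const, nsmul_eq_mul, mul_one]
      congr 2
      ext ⟨p, q⟩
      simp only [Finset.mem_filter, Finset.mem_product, H]
      tauto
    rw [hfc, ← Finset.sum_add_distrib]
    refine Finset.sum_le_sum fun e he => ?_
    by_cases h : ({e.1, e.2} : Finset α) ⊆ S
    · rw [if_pos h]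
      have h' := h
      simp only [Finset.insert_subset_iff, Finset.singleton_subset_iff] at h
      by_cases hx : ∀ x ∈ Conf e, x ∉ S
      · rw [if_pos ⟨h.1, h.2, hx⟩]
        have : (0:ℝ) ≤ ∑ x ∈ Conf e, (if ({e.1, e.2, x} : Finset α) ⊆ S then (1:ℝ) else 0) :=
          Finset.sum_nonneg fun _ _ => by split_ifs <;> norm_num
        linarith
      · push Not at hx
        obtain ⟨x, hx, hxS⟩ := hx
        have h3 := Finset.single_le_sum (f := fun x => (if ({e.1, e.2, x} : Finset α) ⊆ S then (1:ℝ) else 0))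
          (fun _ _ => by split_ifs <;> norm_num) hx
        simp only [Finset.insert_subset_iff, Finset.singleton_subset_iff, h.1, h.2, hxS, true_and,
          if_true] at h3 ⊢
        have h4 : (0:ℝ) ≤ (if ∀ x ∈ Conf e, x ∉ S then (1:ℝ) else 0) := by split_ifs <;> norm_num
        linarith
    · rw [if_neg h]
      refine add_nonneg (Finset.sum_nonneg fun _ _ => by split_ifs <;> norm_num) ?_
      split_ifs <;> norm_num
  obtain ⟨wt, hwt⟩ : ∃ wt : Finset α → ℝ, wt = fun S => π ^ S.card * (1 - π) ^ (P \ S).card := ⟨_, rfl⟩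
  have hw0 : ∀ S, 0 ≤ wt S := fun S => by
    rw [hwt]; exact mul_nonneg (pow_nonneg hπ0.le _) (pow_nonneg (by linarith) _)
  have hw : ∀ T ⊆ P, ∑ S ∈ P.powerset, wt S * (if T ⊆ S then (1:ℝ) else 0) = π ^ T.card := by
    intro T hT; rw [hwt]; exact samp_weight P T hT π
  obtain ⟨y, hy⟩ : ∃ y : ℝ, y = Real.sqrt (P.card * π) := ⟨_, rfl⟩
  have hy1 : 1 ≤ y := by rw [hy]; exact Real.one_le_sqrt.2 hN
  have hy2 : y ^ 2 = P.card * π := by rw [hy]; exact Real.sq_sqrt (by linarith)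
  have hsum := Finset.sum_le_sum (s := P.powerset) fun S hS =>
    mul_le_mul_of_nonneg_left (hper S (Finset.mem_powerset.1 hS) y (by linarith)) (hw0 S)
  have l1 : ∑ S ∈ P.powerset, wt S * ∑ e ∈ E, (if ({e.1, e.2} : Finset α) ⊆ S then (1:ℝ) else 0) =
      E.card * π ^ 2 := by
    simp only [Finset.mul_sum]
    rw [Finset.sum_comm, Finset.sum_congr rfl (g := fun _ => π ^ 2), Finset.sum_const, nsmul_eq_mul]
    intro e he
    obtain ⟨a, b, h⟩ := hE e he
    rw [hw _ (by simp [Finset.insert_subset_iff, a, b]), Finset.card_pair h]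
  have l2 : ∑ S ∈ P.powerset, wt S * ∑ e ∈ E, ∑ x ∈ Conf e,
      (if ({e.1, e.2, x} : Finset α) ⊆ S then (1:ℝ) else 0) ≤ E.card * (c * π ^ 3) := by
    simp only [Finset.mul_sum]
    rw [Finset.sum_comm, ← nsmul_eq_mul, ← Finset.sum_const]
    refine Finset.sum_le_sum fun e he => ?_
    obtain ⟨a, b, h⟩ := hE e he
    obtain ⟨f1, f2, f3⟩ := hconf e he
    rw [Finset.sum_comm, Finset.sum_congr rfl (g := fun _ => π ^ 3), Finset.sum_const, nsmul_eq_mul]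
    · exact mul_le_mul_of_nonneg_right f3 (by positivity)
    intro x hx
    have := f2 x hx
    rw [hw _ (by simp [Finset.insert_subset_iff, a, b, f1 hx]), Finset.card_eq_three.2
      ⟨_, _, _, h, this.1.symm, this.2.symm, rfl⟩]
  have l3 : ∑ S ∈ P.powerset, wt S * ∑ a ∈ P, (if ({a} : Finset α) ⊆ S then (1:ℝ) else 0) =
      P.card * π := by
    simp only [Finset.mul_sum]
    rw [Finset.sum_comm, Finset.sum_congr rfl (g := fun _ => π), Finset.sum_const, nsmul_eq_mul]
    intro a ha
    rw [hw _ (by simp [ha]), Finset.card_singleton, pow_one]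
  have l4 : ∑ S ∈ P.powerset, wt S * ∑ a ∈ P, ∑ b ∈ P, (if ({a, b} : Finset α) ⊆ S then (1:ℝ) else 0) ≤
      (P.card * π) ^ 2 + P.card * π := by
    simp only [Finset.mul_sum]
    rw [Finset.sum_comm]
    have : ∀ a ∈ P, ∑ S ∈ P.powerset, ∑ b ∈ P, wt S * (if ({a, b} : Finset α) ⊆ S then (1:ℝ) else 0) ≤
        P.card * π ^ 2 + π := by
      intro a ha
      rw [Finset.sum_comm]
      have : ∀ b ∈ P, ∑ S ∈ P.powerset, wt S * (if ({a, b} : Finset α) ⊆ S then (1:ℝ) else 0) ≤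
        π ^ 2 + if a = b then π else 0 := by
        intro b hb
        rw [hw _ (by simp [Finset.insert_subset_iff, ha, hb])]
        by_cases hab : a = b
        · subst hab; simp; positivity
        · rw [Finset.card_pair hab, if_neg hab, add_zero]
      refine (Finset.sum_le_sum this).trans ?_
      rw [Finset.sum_add_distrib]
      simp [ha]
    refine (Finset.sum_le_sum this).trans ?_
    rw [Finset.sum_const, nsmul_eq_mul]
    apply le_of_eq; ring
  rw [l1] at hsum
  have e5 : ∀ S, wt S * (∑ e ∈ E, ∑ x ∈ Conf e, (if ({e.1, e.2, x} : Finset α) ⊆ S then (1:ℝ) else 0) +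
      2 * (L + 1) * ((∑ a ∈ P, ∑ b ∈ P, if ({a, b} : Finset α) ⊆ S then (1:ℝ) else 0) / y +
        y * ∑ a ∈ P, if ({a} : Finset α) ⊆ S then (1:ℝ) else 0)) =
      wt S * ∑ e ∈ E, ∑ x ∈ Conf e, (if ({e.1, e.2, x} : Finset α) ⊆ S then (1:ℝ) else 0) +
      (2 * (L + 1) / y) * (wt S * ∑ a ∈ P, ∑ b ∈ P, if ({a, b} : Finset α) ⊆ S then (1:ℝ) else 0) +
      (2 * (L + 1) * y) * (wt S * ∑ a ∈ P, if ({a} : Finset α) ⊆ S then (1:ℝ) else 0) := by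
    intro S; ring
  rw [Finset.sum_congr rfl (fun S _ => e5 S), Finset.sum_add_distrib, Finset.sum_add_distrib,
    ← Finset.mul_sum, ← Finset.mul_sum, l3] at hsum
  have hyp : 0 < y := by linarith
  have f1 : (2 * (L + 1) / y) * ∑ S ∈ P.powerset, (wt S * ∑ a ∈ P, ∑ b ∈ P, if ({a, b} : Finset α) ⊆ S then (1:ℝ) else 0)
      ≤ 2 * (L + 1) * (2 * y ^ 3) := by
    refine (mul_le_mul_of_nonneg_left l4 (by positivity)).trans ?_
    rw [← hy2, div_mul_eq_mul_div, div_le_iff₀ hyp]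
    have : (y^2)^2 + y^2 ≤ 2 * y^3 * y := by nlinarith [sq_nonneg y, mul_nonneg hyp.le hyp.le]
    calc _ ≤ 2 * ((L:ℝ) + 1) * (2 * y^3 * y) := mul_le_mul_of_nonneg_left this (by positivity)
      _ = _ := by ring
  rw [← hy2] at hsum
  have f2 : (E.card:ℝ) * (c * π ^ 3) ≤ E.card * π ^ 2 / 2 := by
    have : (0:ℝ) ≤ E.card * π ^ 2 := by positivity
    nlinarith
  have f3 : (E.card:ℝ) * π ^ 2 ≤ 12 * (L + 1) * y ^ 3 := by linarith
  have f4 : ((E.card:ℝ) * π ^ 2) ^ 2 ≤ (12 * (L + 1) * y ^ 3) ^ 2 := pow_le_pow_left₀ (by positivity) f3 2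
  have f5 : (12 * ((L:ℝ) + 1) * y ^ 3) ^ 2 = 144 * (L + 1) ^ 2 * (P.card * π) ^ 3 := by
    rw [← hy2]; ring
  rw [f5] at f4
  have h3 : 0 < π ^ 3 := by positivity
  refine le_of_mul_le_mul_right ?_ h3
  calc _ = ((E.card:ℝ) * π ^ 2) ^ 2 := by ring
    _ ≤ _ := f4
    _ = _ := by ring
end

section
open Finset

theorem ptolemy_sin (x y z w : ℝ) : Real.sin (x - z) * Real.sin (y - w) =
    Real.sin (x - y) * Real.sin (z - w) + Real.sin (y - z) * Real.sin (x - w) := by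
  simp only [Real.sin_sub]
  have hx := Real.sin_sq_add_cos_sq x
  have hy := Real.sin_sq_add_cos_sq y
  have hz := Real.sin_sq_add_cos_sq z
  have hw := Real.sin_sq_add_cos_sq w
  ring_nf

theorem form_eq (τ υ f g α β : ℝ) :
    τ * Real.cos α * (υ * Real.cos β) + τ * Real.sin α * (υ * Real.sin β) - (-τ + f) * (-υ + g) =
      -(2 * (τ * υ) * Real.sin ((α - β) / 2) ^ 2) + τ * g + υ * f - f * g := by
  have h : Real.cos (α - β) = 1 - 2 * Real.sin ((α - β) / 2) ^ 2 := by
    have := Real.cos_two_mul ((α - β) / 2)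
    have h2 := Real.sin_sq_add_cos_sq ((α - β) / 2)
    rw [show 2 * ((α - β) / 2) = α - β by ring] at this
    linarith
  rw [Real.cos_sub] at h
  linear_combination τ * υ * h

theorem err_bd {T F τ υ f g : ℝ} (hτ : |τ| ≤ 2 * T) (hυ : |υ| ≤ 2 * T) (hf : |f| ≤ F) (hg : |g| ≤ F) :
    |τ * g + υ * f - f * g| ≤ 4 * T * F + F ^ 2 := by
  have h1 : |τ * g| ≤ 2 * T * F := by
    rw [abs_mul]; exact mul_le_mul hτ hg (abs_nonneg _) ((abs_nonneg _).trans hτ)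
  have h2 : |υ * f| ≤ 2 * T * F := by
    rw [abs_mul]; exact mul_le_mul hυ hf (abs_nonneg _) ((abs_nonneg _).trans hυ)
  have h3 : |f * g| ≤ F * F := by
    rw [abs_mul]; exact mul_le_mul hf hg (abs_nonneg _) ((abs_nonneg _).trans hf)
  rw [abs_le] at *
  constructor <;> nlinarith

theorem sin_half_lb {t G : ℝ} (hG : 0 ≤ G) (h1 : G ≤ |t|) (h2 : |t| ≤ 2) : G ^ 2 / 16 ≤ Real.sin (t / 2) ^ 2 := by
  have h3 : |t| / 4 ≤ Real.sin (|t| / 2) := by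
    have := Real.mul_le_sin (x := |t| / 2) (by positivity) (by linarith [Real.pi_gt_three])
    refine le_trans ?_ this
    have h4 : (1:ℝ)/2 ≤ 2 / Real.pi := by
      rw [div_le_div_iff₀ (by norm_num) Real.pi_pos]; linarith [Real.pi_le_four]
    nlinarith [abs_nonneg t]
  have h5 : Real.sin (t / 2) ^ 2 = Real.sin (|t| / 2) ^ 2 := by
    rcases abs_choice t with h | h <;> rw [h]
    rw [neg_div, Real.sin_neg]; ring
  rw [h5]
  nlinarith

theorem sin_half_sign {t : ℝ} (h0 : t ≠ 0) (h2 : |t| ≤ 2) : 0 < t * Real.sin (t / 2) := by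
  rw [abs_le] at h2
  rcases lt_or_gt_of_ne h0 with h | h
  · have := Real.sin_pos_of_pos_of_lt_pi (x := -(t/2)) (by linarith) (by linarith [Real.pi_gt_three])
    rw [Real.sin_neg] at this
    nlinarith
  · have := Real.sin_pos_of_pos_of_lt_pi (x := (t/2)) (by linarith) (by linarith [Real.pi_gt_three])
    nlinarith

theorem form_par (a1 b1 c1 d1 a2 b2 c2 d2 a3 b3 c3 d3 : ℝ) (e1 : a1 - b1 + c1 - d1 = 0)
    (e2 : a2 - b2 + c2 - d2 = 0) (e3 : a3 - b3 + c3 - d3 = 0) (B : ℝ → ℝ → ℝ → ℝ → ℝ → ℝ → ℝ)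
    (hB : B = fun x y z x' y' z' => x * x' + y * y' - z * z') :
    (B a1 a2 a3 a1 a2 a3 + B b1 b2 b3 b1 b2 b3 - 2 * B a1 a2 a3 b1 b2 b3 =
      B c1 c2 c3 c1 c2 c3 + B d1 d2 d3 d1 d2 d3 - 2 * B c1 c2 c3 d1 d2 d3) ∧
    (B a1 a2 a3 a1 a2 a3 + B d1 d2 d3 d1 d2 d3 - 2 * B a1 a2 a3 d1 d2 d3 =
      B c1 c2 c3 c1 c2 c3 + B b1 b2 b3 b1 b2 b3 - 2 * B b1 b2 b3 c1 c2 c3) ∧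
    (B a1 a2 a3 a1 a2 a3 + B c1 c2 c3 c1 c2 c3 + 2 * B a1 a2 a3 c1 c2 c3 =
      B b1 b2 b3 b1 b2 b3 + B d1 d2 d3 d1 d2 d3 + 2 * B b1 b2 b3 d1 d2 d3) ∧
    (B a1 a2 a3 a1 a2 a3 - B a1 a2 a3 b1 b2 b3 + B a1 a2 a3 c1 c2 c3 - B a1 a2 a3 d1 d2 d3 = 0) := by
  have h1 : d1 = a1 - b1 + c1 := by linarith
  have h2 : d2 = a2 - b2 + c2 := by linarith
  have h3 : d3 = a3 - b3 + c3 := by linarith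
  subst h1 h2 h3 hB
  refine ⟨?_, ?_, ?_, ?_⟩ <;> ring

theorem fin_alg {S U ξ : ℝ} (hξ : 0 ≤ ξ) (hS : 16 * ξ < S) (hU : 16 * ξ < U)
    (h : (S + U - 4 * ξ) * (S + U - 8 * ξ) ≤ S * (S + 4 * ξ) + (U + 4 * ξ) * U) : False := by
  have h1 : 16 * ξ * U < S * U := mul_lt_mul_of_pos_right hS (by linarith)
  have h2 : 16 * ξ * S < U * S := mul_lt_mul_of_pos_right hU (by linarith)
  have h3 : 0 ≤ ξ * ξ := mul_nonneg hξ hξ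
  nlinarith

theorem sq_add_le_of {x y : ℝ} (h : x * y ≤ 0) : (x + y) ^ 2 ≤ x ^ 2 + y ^ 2 := by
  have : (x + y) ^ 2 = x ^ 2 + y ^ 2 + 2 * (x * y) := by ring
  linarith

set_option maxHeartbeats 800000 in
theorem interleave (T F m G α β γ δ τa τb τc τd fa fb fc fd : ℝ) (hm : 0 < m) (hG : 0 < G)
    (hab : m ^ 2 ≤ τa * τb) (had : m ^ 2 ≤ τa * τd) (hcd : m ^ 2 ≤ τc * τd) (hbc : m ^ 2 ≤ τb * τc)
    (ha : |τa| ≤ 2 * T) (hb : |τb| ≤ 2 * T) (hc : |τc| ≤ 2 * T) (hd : |τd| ≤ 2 * T)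
    (hfa : |fa| ≤ F) (hfb : |fb| ≤ F) (hfc : |fc| ≤ F) (hfd : |fd| ≤ F)
    (e1 : τa * Real.cos α - τb * Real.cos β + τc * Real.cos γ - τd * Real.cos δ = 0)
    (e2 : τa * Real.sin α - τb * Real.sin β + τc * Real.sin γ - τd * Real.sin δ = 0)
    (e3 : (-τa + fa) - (-τb + fb) + (-τc + fc) - (-τd + fd) = 0)
    (g1 : G ≤ |α - β|) (g2 : G ≤ |β - γ|) (g3 : G ≤ |γ - δ|) (g4 : G ≤ |α - δ|)
    (k1 : |α - β| ≤ 2) (k2 : |β - γ| ≤ 2) (k3 : |γ - δ| ≤ 2) (k4 : |α - δ| ≤ 2)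
    (hbig : 128 * (4 * T * F + F ^ 2) < m ^ 2 * G ^ 2) :
    0 < (α - β) * (β - γ) * (γ - δ) * (α - δ) := by
  have n1 : α - β ≠ 0 := fun h => by rw [h, abs_zero] at g1; linarith
  have n2 : β - γ ≠ 0 := fun h => by rw [h, abs_zero] at g2; linarith
  have n3 : γ - δ ≠ 0 := fun h => by rw [h, abs_zero] at g3; linarith
  have n4 : α - δ ≠ 0 := fun h => by rw [h, abs_zero] at g4; linarith
  have p1 := sin_half_sign n1 k1
  have p2 := sin_half_sign n2 k2
  have p3 := sin_half_sign n3 k3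
  have p4 := sin_half_sign n4 k4
  suffices hP : 0 < (Real.sin ((α - β) / 2) * Real.sin ((γ - δ) / 2)) *
      (Real.sin ((β - γ) / 2) * Real.sin ((α - δ) / 2)) by
    have h := mul_pos (mul_pos (mul_pos p1 p2) p3) p4
    have e : (α - β) * (β - γ) * (γ - δ) * (α - δ) * ((Real.sin ((α - β) / 2) * Real.sin ((γ - δ) / 2)) *
      (Real.sin ((β - γ) / 2) * Real.sin ((α - δ) / 2))) = (α - β) * Real.sin ((α - β) / 2) *
       ((β - γ) * Real.sin ((β - γ) / 2)) * ((γ - δ) * Real.sin ((γ - δ) / 2)) *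
       ((α - δ) * Real.sin ((α - δ) / 2)) := by ring
    rw [← e] at h
    exact pos_of_mul_pos_left h hP.le
  by_contra hcon
  push Not at hcon
  obtain ⟨ξ, hξ⟩ : ∃ ξ : ℝ, ξ = 4 * T * F + F ^ 2 := ⟨_, rfl⟩
  have hF0 : 0 ≤ F := (abs_nonneg _).trans hfa
  have hT0 : 0 ≤ T := by linarith [(abs_nonneg _).trans ha]
  have hξ0 : 0 ≤ ξ := by rw [hξ]; positivity
  have Faa := form_eq τa τa fa fa α α
  have Fbb := form_eq τb τb fb fb β β
  have Fcc := form_eq τc τc fc fc γ γ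
  have Fdd := form_eq τd τd fd fd δ δ
  have Fab := form_eq τa τb fa fb α β
  have Fac := form_eq τa τc fa fc α γ
  have Fad := form_eq τa τd fa fd α δ
  have Fbc := form_eq τb τc fb fc β γ
  have Fbd := form_eq τb τd fb fd β δ
  have Fcd := form_eq τc τd fc fd γ δ
  have Eaa := err_bd ha ha hfa hfa
  have Ebb := err_bd hb hb hfb hfb
  have Ecc := err_bd hc hc hfc hfc
  have Edd := err_bd hd hd hfd hfd
  have Eab := err_bd ha hb hfa hfb
  have Eac := err_bd ha hc hfa hfc
  have Ead := err_bd ha hd hfa hfd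
  have Ebc := err_bd hb hc hfb hfc
  have Ebd := err_bd hb hd hfb hfd
  have Ecd := err_bd hc hd hfc hfd
  simp only [sub_self, zero_div, Real.sin_zero] at Faa Fbb Fcc Fdd
  have pt := ptolemy_sin (α/2) (β/2) (γ/2) (δ/2)
  simp only [← sub_div] at pt
  have lab := sin_half_lb hG.le g1 k1
  have lad := sin_half_lb hG.le g4 k4
  have q1 : ∀ x y : ℝ, m ^ 2 ≤ x → G ^ 2 / 16 ≤ y → 16 * ξ < 2 * x * y := by
    intro x y hx hy
    have : m^2 * (G^2/16) ≤ x * y := mul_le_mul hx hy (by positivity) ((sq_nonneg m).trans hx)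
    rw [hξ]; linarith
  have hS := q1 _ _ hab lab
  have hU := q1 _ _ had lad
  rw [← hξ] at Eaa Ebb Ecc Edd Eab Eac Ead Ebc Ebd Ecd
  generalize Real.sin ((α - β) / 2) = zab at *
  generalize Real.sin ((α - γ) / 2) = zac at *
  generalize Real.sin ((α - δ) / 2) = zad at *
  generalize Real.sin ((β - γ) / 2) = zbc at *
  generalize Real.sin ((β - δ) / 2) = zbd at *
  generalize Real.sin ((γ - δ) / 2) = zcd at *
  obtain ⟨I1, I2, I3, I4⟩ := form_par _ _ _ _ _ _ _ _ _ _ _ _ e1 e2 e3 _ rfl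
  simp only [Faa, Fbb, Fcc, Fdd, Fab, Fac, Fad, Fbc, Fbd, Fcd] at I1 I2 I3 I4
  rw [abs_le] at Eaa Ebb Ecc Edd Eab Eac Ead Ebc Ebd Ecd
  obtain ⟨S, hSe⟩ : ∃ S, S = 2 * (τa * τb) * zab ^ 2 := ⟨_, rfl⟩
  obtain ⟨U, hUe⟩ : ∃ S, S = 2 * (τa * τd) * zad ^ 2 := ⟨_, rfl⟩
  obtain ⟨Scd, hScd⟩ : ∃ S, S = 2 * (τc * τd) * zcd ^ 2 := ⟨_, rfl⟩
  obtain ⟨Sbc, hSbc⟩ : ∃ S, S = 2 * (τb * τc) * zbc ^ 2 := ⟨_, rfl⟩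
  obtain ⟨Sac, hSac⟩ : ∃ S, S = 2 * (τa * τc) * zac ^ 2 := ⟨_, rfl⟩
  obtain ⟨Sbd, hSbd⟩ : ∃ S, S = 2 * (τb * τd) * zbd ^ 2 := ⟨_, rfl⟩
  simp only [← hSe, ← hUe, ← hScd, ← hSbc, ← hSac, ← hSbd] at I1 I2 I3 I4
  have j1 : Scd ≤ S + 4 * ξ := by linarith [Eaa.1, Ebb.1, Ecc.1, Edd.1, Eab.1, Ecd.1, Eaa.2, Ebb.2, Ecc.2, Edd.2, Eab.2, Ecd.2]
  have j2 : Sbc ≤ U + 4 * ξ := by linarith [Eaa.1, Ebb.1, Ecc.1, Edd.1, Ead.1, Ebc.1, Eaa.2, Ebb.2, Ecc.2, Edd.2, Ead.2, Ebc.2]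
  have j3 : Sac ≤ Sbd + 4 * ξ := by linarith [Eaa.1, Ebb.1, Ecc.1, Edd.1, Eac.1, Ebd.1, Eaa.2, Ebb.2, Ecc.2, Edd.2, Eac.2, Ebd.2]
  have j4 : S + U ≤ Sac + 4 * ξ := by linarith [Eaa.1, Eab.1, Eac.1, Ead.1, Eaa.2, Eab.2, Eac.2, Ead.2]
  have hS' : 16 * ξ < S := by rw [hSe]; exact hS
  have hU' : 16 * ξ < U := by rw [hUe]; exact hU
  have hprod : Sac * Sbd ≤ S * Scd + Sbc * U := by
    have k0 : 0 ≤ τa * τb * (τc * τd) := mul_nonneg ((sq_nonneg m).trans hab) ((sq_nonneg m).trans hcd)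
    have w1 : Sac * Sbd = 4 * (τa * τb * (τc * τd)) * (zac * zbd) ^ 2 := by rw [hSac, hSbd]; ring
    have w2 : S * Scd = 4 * (τa * τb * (τc * τd)) * (zab * zcd) ^ 2 := by rw [hSe, hScd]; ring
    have w3 : Sbc * U = 4 * (τa * τb * (τc * τd)) * (zbc * zad) ^ 2 := by rw [hSbc, hUe]; ring
    rw [w1, w2, w3, pt, ← mul_add]
    exact mul_le_mul_of_nonneg_left (sq_add_le_of hcon) (mul_nonneg (by norm_num) k0)
  have k1 : (S + U - 4 * ξ) * (S + U - 8 * ξ) ≤ Sac * Sbd :=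
    mul_le_mul (by linarith) (by linarith) (by linarith) (by linarith)
  have k2 : S * Scd ≤ S * (S + 4 * ξ) := mul_le_mul_of_nonneg_left j1 (by linarith)
  have k3 : Sbc * U ≤ (U + 4 * ξ) * U := mul_le_mul_of_nonneg_right j2 (by linarith)
  exact fin_alg hξ0 hS' hU' (by linarith)
end

section
open Finset

noncomputable section

abbrev Pt := ℝ × ℝ × ℝ

def hF (θ : ℝ) (u : Pt) : ℝ := u.1 * Real.cos θ + u.2.1 * Real.sin θ + u.2.2
def gF (θ : ℝ) (u : Pt) : ℝ := -u.1 * Real.sin θ + u.2.1 * Real.cos θ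

def Slab (T σ θ : ℝ) (u : Pt) : Prop :=
  ‖u‖ ≤ T ∧ |hF θ u| ≤ 5 * (T * σ ^ 2) ∧ |gF θ u| ≤ 5 * (T * σ)

def FarS (A T σ ς θ : ℝ) (u : Pt) : Prop := Slab T σ θ u ∧ T / A < ‖u‖ ∧ ς * u.2.2 < 0

theorem nrm_coord (u : Pt) : |u.1| ≤ ‖u‖ ∧ |u.2.1| ≤ ‖u‖ ∧ |u.2.2| ≤ ‖u‖ :=
  ⟨norm_fst_le u, (norm_fst_le u.2).trans (norm_snd_le u), (norm_snd_le u.2).trans (norm_snd_le u)⟩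

theorem nrm_le_of (u : Pt) (c : ℝ) (h1 : |u.1| ≤ c) (h2 : |u.2.1| ≤ c) (h3 : |u.2.2| ≤ c) : ‖u‖ ≤ c := by
  rw [Prod.norm_def, Prod.norm_def]
  exact max_le h1 (max_le h2 h3)

set_option maxHeartbeats 1600000 in
theorem edge_geom (A T σ ς θ : ℝ) (u : Pt) (hA : 1000 ≤ A) (hT : 0 < T) (hσ : 0 < σ)
    (hσA : σ * A ^ 4 ≤ 1) (hς : ς = 1 ∨ ς = -1) (hu : FarS A T σ ς θ u) :
    ∃ x τ f : ℝ, |x| ≤ 10 * A * σ ∧ u.1 = τ * Real.cos (θ + x) ∧ u.2.1 = τ * Real.sin (θ + x) ∧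
      u.2.2 = -τ + f ∧ |f| ≤ A ^ 2 * (T * σ ^ 2) ∧ |τ| ≤ 2 * T ∧ T / (2 * A) ≤ ς * τ := by
  obtain ⟨⟨h1, h2, h3⟩, h4, h5⟩ := hu
  obtain ⟨c1, c2, c3⟩ := nrm_coord u
  unfold hF at h2
  unfold gF at h3
  have hcs := Real.sin_sq_add_cos_sq θ
  have hc1 := Real.abs_cos_le_one θ
  have hs1 := Real.abs_sin_le_one θ
  have hcos : ∀ x, Real.cos (θ + x) = Real.cos θ * Real.cos x - Real.sin θ * Real.sin x := Real.cos_add θ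
  have hsin : ∀ x, Real.sin (θ + x) = Real.sin θ * Real.cos x + Real.cos θ * Real.sin x := Real.sin_add θ
  generalize Real.cos θ = c at *
  generalize Real.sin θ = s at *
  obtain ⟨u1, u2, u3⟩ := u
  simp only at *
  obtain ⟨e, he⟩ : ∃ e, e = u1 * c + u2 * s := ⟨_, rfl⟩
  obtain ⟨g, hg⟩ : ∃ g, g = -u1 * s + u2 * c := ⟨_, rfl⟩
  rw [← hg] at h3
  rw [← he] at h2
  have k1 : u1 = e * c - g * s := by rw [he, hg]; linear_combination -u1 * hcs
  have k2 : u2 = e * s + g * c := by rw [he, hg]; linear_combination -u2 * hcs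
  have hTσ : 0 < T * σ := by positivity
  have hA4 : (1000:ℝ)^3 * A ≤ A ^ 4 := by
    have : (1000:ℝ)^3 ≤ A^3 := pow_le_pow_left₀ (by norm_num) hA 3
    calc (1000:ℝ)^3 * A ≤ A^3 * A := mul_le_mul_of_nonneg_right this (by linarith)
      _ = A ^ 4 := by ring
  have hA4' : A * A * 1000 ≤ A ^ 4 := by
    have : (1000:ℝ)^2 ≤ A^2 := pow_le_pow_left₀ (by norm_num) hA 2
    calc A * A * 1000 ≤ A * A * A^2 := mul_le_mul_of_nonneg_left (by linarith) (by positivity)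
      _ = A ^ 4 := by ring
  have hAσ : 1000 * (σ * A) ≤ 1 := by
    have h := mul_le_mul_of_nonneg_left hA4 hσ.le
    have h' : 0 ≤ σ * A := by positivity
    linarith
  have hσ1 : 1000 * σ ≤ 1 := by
    have h := mul_le_mul_of_nonneg_left hA hσ.le
    linarith
  have hlm : T * σ ^ 2 ≤ T * σ := by
    have h := mul_le_mul_of_nonneg_left (show σ ≤ 1 by linarith) hTσ.le
    linarith
  have hm : 20 * (T * σ) ≤ T / (2 * A) := by
    rw [le_div_iff₀ (by linarith)]
    have h := mul_le_mul_of_nonneg_left hAσ hT.le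
    have h' : 0 ≤ T * (σ * A) := by positivity
    linarith
  have hTA : T / A = 2 * (T / (2 * A)) := by field_simp
  have hTA0 : 0 < T / (2 * A) := by positivity
  have hbound : ∀ a b : ℝ, |a| ≤ 1 → |b * a| ≤ |b| := fun a b h => by
    rw [abs_mul]; exact mul_le_of_le_one_right (abs_nonneg b) h
  have hel : T / (2 * A) ≤ |e| := by
    by_contra hlt
    push Not at hlt
    have : ‖((u1, u2, u3) : Pt)‖ ≤ T / A := by
      have b1 := hbound _ e hc1
      have b2 := hbound _ e hs1
      have b3 := hbound _ g hc1
      have b4 := hbound _ g hs1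
      apply nrm_le_of <;> simp only
      · rw [k1]; exact (abs_sub _ _).trans (by linarith)
      · rw [k2]; exact (abs_add_le _ _).trans (by linarith)
      · have : u3 = (e + u3) - e := by ring
        rw [this]; exact (abs_sub _ _).trans (by linarith)
    linarith
  have he0 : e ≠ 0 := fun h => by rw [h, abs_zero] at hel; linarith
  obtain ⟨y, hy⟩ : ∃ y, y = g / e := ⟨_, rfl⟩
  have hge : g = e * y := by rw [hy]; field_simp
  have hyb : |y| ≤ 10 * A * σ := by
    rw [hy, abs_div, div_le_iff₀ (by linarith)]
    have : 10 * A * σ * (T / (2 * A)) = 5 * (T * σ) := by field_simp; ring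
    have h6 : 10 * A * σ * (T / (2 * A)) ≤ 10 * A * σ * |e| := by gcongr
    linarith
  obtain ⟨r, hr⟩ : ∃ r, r = Real.sqrt (1 + y ^ 2) := ⟨_, rfl⟩
  have hr1 : 1 ≤ r := by rw [hr]; exact Real.one_le_sqrt.2 (by linarith [sq_nonneg y])
  have hr2 : r ^ 2 = 1 + y ^ 2 := by rw [hr]; exact Real.sq_sqrt (by positivity)
  have hct : e * r * Real.cos (Real.arctan y) = e := by
    rw [Real.cos_arctan, ← hr]; field_simp
  have hst : e * r * Real.sin (Real.arctan y) = g := by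
    rw [Real.sin_arctan, ← hr, hge]; field_simp
  have hsq : (e * r) ^ 2 = u1 ^ 2 + u2 ^ 2 := by
    rw [mul_pow, hr2, k1, k2, hge]; linear_combination (-(e^2) - e^2*y^2) * hcs
  refine ⟨Real.arctan y, e * r, u3 + e * r, ?_, ?_, ?_, by ring, ?_, ?_, ?_⟩
  · refine le_trans ?_ hyb
    have h7 : ∀ z : ℝ, 0 ≤ z → |Real.arctan z| ≤ |z| := fun z hz => by
      rw [abs_of_nonneg hz, abs_of_nonneg (Real.arctan_nonneg.2 hz)]
      have := Real.le_tan (Real.arctan_nonneg.2 hz) (Real.arctan_lt_pi_div_two z)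
      rwa [Real.tan_arctan] at this
    rcases le_total 0 y with h | h
    · exact h7 y h
    · have := h7 (-y) (by linarith)
      rwa [Real.arctan_neg, abs_neg, abs_neg] at this
  · rw [hcos, mul_sub]
    linear_combination k1 - c * hct + s * hst
  · rw [hsin, mul_add]
    linear_combination k2 - s * hct - c * hst
  · have hrr : r - 1 ≤ y ^ 2 / 2 := by linarith [sq_nonneg (r - 1), (by ring : (r-1)^2 = r^2 - 2*r+1)]
    have h8 : |e * r - e| ≤ 25 * A * (T * σ ^ 2) := by
      rw [show e * r - e = e * (r - 1) by ring, abs_mul, abs_of_nonneg (by linarith : 0 ≤ r - 1)]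
      have h9 : |e| * (r - 1) ≤ |e| * (y ^ 2 / 2) := by gcongr
      refine h9.trans ?_
      have : |e| * (y^2/2) = |g| * |y| / 2 := by
        rw [hge, abs_mul, ← sq_abs y]; ring
      rw [this]
      have : |g| * |y| ≤ 5 * (T * σ) * (10 * A * σ) := mul_le_mul h3 hyb (abs_nonneg _) (by positivity)
      linarith
    rw [show u3 + e * r = (e + u3) + (e * r - e) by ring]
    refine (abs_add_le _ _).trans ?_
    have hl0 : 0 ≤ T * σ ^ 2 := by positivity
    have hq : (5 + 25 * A) * (T * σ ^ 2) ≤ A ^ 2 * (T * σ ^ 2) :=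
      mul_le_mul_of_nonneg_right (by nlinarith) hl0
    linarith
  · refine abs_le_of_sq_le_sq ?_ (by linarith)
    have a1 : u1 ^ 2 ≤ T ^ 2 := by rw [← sq_abs]; exact pow_le_pow_left₀ (abs_nonneg _) (c1.trans h1) 2
    have a2 : u2 ^ 2 ≤ T ^ 2 := by rw [← sq_abs]; exact pow_le_pow_left₀ (abs_nonneg _) (c2.trans h1) 2
    rw [hsq]; linarith [sq_nonneg T]
  · have hςe : T / (2 * A) ≤ ς * e := by
      have hh : 5 * (T * σ ^ 2) < T / (2 * A) := by linarith
      rw [abs_le] at h2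
      rcases hς with rfl | rfl
      · rcases abs_cases e with ⟨h, _⟩ | ⟨h, _⟩ <;> linarith
      · rcases abs_cases e with ⟨h, _⟩ | ⟨h, _⟩ <;> linarith
    have := mul_le_mul_of_nonneg_left hr1 (hTA0.le.trans hςe)
    linarith

theorem int_count (S : Finset ℤ) (w c R : ℝ) (hw : 0 < w) (hR : 0 ≤ R)
    (h : ∀ j ∈ S, |j * w - c| ≤ R) : (S.card : ℝ) ≤ 2 * R / w + 1 := by
  have hsub : S ⊆ Finset.Icc ⌈(c - R) / w⌉ ⌊(c + R) / w⌋ := by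
    intro j hj
    have := abs_le.1 (h j hj)
    rw [Finset.mem_Icc]
    constructor
    · rw [Int.ceil_le, div_le_iff₀ hw]; linarith
    · rw [Int.le_floor, le_div_iff₀ hw]; linarith
  have h1 := Finset.card_le_card hsub
  rw [Int.card_Icc] at h1
  have h2 : (S.card : ℝ) ≤ ((⌊(c + R) / w⌋ + 1 - ⌈(c - R) / w⌉).toNat : ℝ) := by exact_mod_cast h1
  refine h2.trans ?_
  have h3 : 0 ≤ 2 * R / w := by positivity
  have h4 := Int.floor_le ((c + R) / w)
  have h5 := Int.le_ceil ((c - R) / w)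
  have h6 : (c + R) / w - (c - R) / w = 2 * R / w := by ring
  rcases le_total 0 (⌊(c + R) / w⌋ + 1 - ⌈(c - R) / w⌉) with h7 | h7
  · have : ((⌊(c + R) / w⌋ + 1 - ⌈(c - R) / w⌉).toNat : ℝ) = ((⌊(c + R) / w⌋ + 1 - ⌈(c - R) / w⌉ : ℤ) : ℝ) := by
      exact_mod_cast Int.toNat_of_nonneg h7
    rw [this]; push_cast; linarith
  · rw [Int.toNat_of_nonpos h7]; push_cast; linarith

end
end

section
open Finset

noncomputable section

theorem hF_sub (θ : ℝ) (a b : Pt) : hF θ (a - b) = hF θ a - hF θ b := by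
  simp [hF]; ring
theorem gF_sub (θ : ℝ) (a b : Pt) : gF θ (a - b) = gF θ a - gF θ b := by
  simp [gF]; ring

theorem floor_eq_abs {x y c : ℝ} (hc : 0 < c) (h : ⌊x / c⌋ = ⌊y / c⌋) : |x - y| ≤ c := by
  have h1 := Int.abs_sub_lt_one_of_floor_eq_floor h
  rw [← sub_div, abs_div, abs_of_pos hc, div_lt_one hc] at h1
  exact h1.le

theorem floor_mem {x c : ℝ} (hc : 0 < c) (h : |x| ≤ 5 * c) : ⌊x / c⌋ ∈ Finset.Icc (-5 : ℤ) 5 := by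
  rw [abs_le] at h
  rw [Finset.mem_Icc]
  constructor
  · rw [Int.le_floor, le_div_iff₀ hc]; push_cast; linarith
  · have : x / c ≤ 5 := by rw [div_le_iff₀ hc]; linarith
    have h2 := (Int.floor_le (x / c)).trans this
    exact_mod_cast h2

/-- number of far neighbours with an index near a given one, same base point or same target -/
theorem conf_count (T σ w : ℝ) (hT : 0 < T) (hσ : 0 < σ) (P : Finset Pt)
    (W : Finset (Pt × ℤ)) (hdiam : ∀ x ∈ W, ∀ y ∈ W, ‖y.1 - x.1‖ ≤ T) (n1 : ℕ)
    (hn1 : ∀ x ∈ W, ∀ S ⊆ P, (∀ q ∈ S, Slab T σ (x.2 * w) (q - x.1)) → S.card ≤ n1)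
    (J : Finset ℤ) (p0 q0 : Pt) (S1 S2 : Finset Pt) (h1 : S1 ⊆ P) (h2 : S2 ⊆ P) (j1 j2 : Pt → ℤ)
    (hS1 : ∀ q ∈ S1, j1 q ∈ J ∧ (p0, j1 q) ∈ W ∧ Slab T σ (j1 q * w) (q - p0))
    (hS2 : ∀ p ∈ S2, j2 p ∈ J ∧ (p, j2 p) ∈ W ∧ Slab T σ (j2 p * w) (q0 - p)) :
    S1.card + S2.card ≤ 122 * n1 * J.card := by
  classical
  have a1 : S1.card ≤ n1 * J.card := by
    refine Finset.card_le_mul_card_image_of_maps_to (f := j1) (fun q hq => (hS1 q hq).1) n1 ?_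
    intro j hj
    rcases (S1.filter (fun q => j1 q = j)).eq_empty_or_nonempty with he | ⟨q, hq⟩
    · rw [he]; simp
    · rw [Finset.mem_filter] at hq
      refine hn1 (p0, j) (hq.2 ▸ (hS1 q hq.1).2.1) _ ((Finset.filter_subset _ _).trans h1) ?_
      intro q' hq'
      rw [Finset.mem_filter] at hq'
      have := (hS1 q' hq'.1).2.2
      rw [hq'.2] at this
      exact this
  have a2 : S2.card ≤ n1 * (J ×ˢ (Finset.Icc (-5:ℤ) 5 ×ˢ Finset.Icc (-5:ℤ) 5)).card := by
    refine Finset.card_le_mul_card_image_of_maps_to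
      (f := fun p => (j2 p, ⌊hF (j2 p * w) (q0 - p) / (T * σ ^ 2)⌋, ⌊gF (j2 p * w) (q0 - p) / (T * σ)⌋))
      (fun p hp => ?_) n1 ?_
    · obtain ⟨b1, -, -, b2, b3⟩ := hS2 p hp
      simp only [Finset.mem_product]
      exact ⟨b1, floor_mem (by positivity) b2, floor_mem (by positivity) b3⟩
    rintro ⟨j, a, b⟩ hj
    rcases (S2.filter (fun p => (j2 p, ⌊hF (j2 p * w) (q0 - p) / (T * σ ^ 2)⌋, 
      ⌊gF (j2 p * w) (q0 - p) / (T * σ)⌋) = (j, a, b))).eq_empty_or_nonempty with he | ⟨p, hp⟩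
    · rw [he]; simp
    · rw [Finset.mem_filter, Prod.mk.injEq, Prod.mk.injEq] at hp
      obtain ⟨hp, e1, e2, e3⟩ := hp
      refine hn1 (p, j) (e1 ▸ (hS2 p hp).2.1) _ ((Finset.filter_subset _ _).trans h2) ?_
      intro p' hp'
      rw [Finset.mem_filter, Prod.mk.injEq, Prod.mk.injEq] at hp'
      obtain ⟨hp', f1, f2, f3⟩ := hp'
      rw [f1] at f2 f3
      rw [e1] at e2 e3
      have g1 := floor_eq_abs (by positivity) (e2.trans f2.symm)
      have g2 := floor_eq_abs (by positivity) (e3.trans f3.symm)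
      rw [← hF_sub, show q0 - p - (q0 - p') = p' - p by abel] at g1
      rw [← gF_sub, show q0 - p - (q0 - p') = p' - p by abel] at g2
      refine ⟨hdiam (p, j2 p) (hS2 p hp).2.1 (p', j2 p') (hS2 p' hp').2.1, g1.trans ?_, g2.trans ?_⟩
      · have : 0 < T * σ ^ 2 := by positivity
        linarith
      · have : 0 < T * σ := by positivity
        linarith
  rw [Finset.card_product, Finset.card_product, Int.card_Icc] at a2
  norm_num at a2
  calc S1.card + S2.card ≤ n1 * J.card + n1 * (J.card * 121) := add_le_add a1 a2
    _ = _ := by ring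

set_option maxHeartbeats 1600000 in
theorem core (A T σ w : ℝ) (hA : 1000 ≤ A) (hT : 0 < T) (hσ : 0 < σ) (hσA : σ * A ^ 4 ≤ 1)
    (hw : w = σ / A ^ 2) (P : Finset Pt) (L : ℕ) (hL : P.card < 2 ^ L) (hLA : 12 * ((L:ℝ) + 1) ≤ A ^ 2)
    (ς : ℝ) (hς : ς = 1 ∨ ς = -1) (W : Finset (Pt × ℤ)) (hW : ∀ x ∈ W, x.1 ∈ P)
    (hdiam : ∀ x ∈ W, ∀ y ∈ W, ‖y.1 - x.1‖ ≤ T)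
    (hsec : ∀ x ∈ W, ∀ y ∈ W, |(x.2:ℝ) * w - y.2 * w| ≤ 1) (n0 : ℝ) (n1 : ℕ) (hn0p : 0 ≤ n0)
    (hn0 : ∀ x ∈ W, ∃ S ⊆ P, (∀ q ∈ S, FarS A T σ ς (x.2 * w) (q - x.1)) ∧ n0 ≤ S.card)
    (hn1 : ∀ x ∈ W, ∀ S ⊆ P, (∀ q ∈ S, Slab T σ (x.2 * w) (q - x.1)) → S.card ≤ n1) :
    (W.card * n0) ^ 2 ≤ A ^ 20 * (P.card : ℝ) ^ 3 * n1 := by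
  classical
  have hA0 : 0 < A := by linarith
  have hw0 : 0 < w := by rw [hw]; positivity
  obtain ⟨E, hE⟩ : ∃ E : Finset (Pt × Pt), ∀ p q, (p, q) ∈ E ↔ (p ∈ P ∧ q ∈ P ∧ ∃ j, (p, j) ∈ W ∧
      FarS A T σ ς (j * w) (q - p)) :=
    ⟨(P ×ˢ P).filter (fun e => ∃ j, (e.1, j) ∈ W ∧ FarS A T σ ς (j * w) (e.2 - e.1)),
      by intro p q; simp [and_assoc]⟩
  have hAσ : 1000 * (A * σ) ≤ 1 := by
    have : (1000:ℝ) ≤ A ^ 3 := by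
      calc (1000:ℝ) ≤ 1000 ^ 3 := by norm_num
        _ ≤ A ^ 3 := pow_le_pow_left₀ (by norm_num) hA 3
    calc 1000 * (A * σ) ≤ A ^ 3 * (A * σ) := mul_le_mul_of_nonneg_right this (by positivity)
      _ = σ * A ^ 4 := by ring
      _ ≤ 1 := hσA
  have hex : ∀ p q, (p, q) ∈ E → ∃ (j : ℤ) (x τ f : ℝ), (p, j) ∈ W ∧ FarS A T σ ς (j * w) (q - p) ∧
      |x| ≤ 10 * A * σ ∧ (q - p).1 = τ * Real.cos (j * w + x) ∧ (q - p).2.1 = τ * Real.sin (j * w + x) ∧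
      (q - p).2.2 = -τ + f ∧ |f| ≤ A ^ 2 * (T * σ ^ 2) ∧ |τ| ≤ 2 * T ∧ T / (2 * A) ≤ ς * τ := by
    intro p q h
    obtain ⟨-, -, j, hj, hF⟩ := (hE p q).1 h
    obtain ⟨x, τ, f, h⟩ := edge_geom A T σ ς (j * w) (q - p) hA hT hσ hσA hς hF
    exact ⟨j, x, τ, f, hj, hF, h⟩
  choose! jj x τ f hjW hjF hx e1 e2 e3 hf hτ hτ' using hex
  let φ : Pt → Pt → ℝ := fun p q => jj p q * w + x p q
  obtain ⟨G, hG⟩ : ∃ G, G = A ^ 4 * σ := ⟨_, rfl⟩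
  have hG0 : 0 < G := by rw [hG]; positivity
  -- count of indices for a given pair
  have hmult : ∀ p q, (p, q) ∈ E → ∀ S : Finset ℤ,
      (∀ j ∈ S, (p, j) ∈ W ∧ FarS A T σ ς (j * w) (q - p)) → (S.card : ℝ) ≤ A ^ 4 := by
    intro p q hpq S hS
    have hb : ∀ j ∈ S, |(j:ℝ) * w - φ p q| ≤ 20 * A * σ := by
      intro j hj
      obtain ⟨b1, ⟨-, -, b2⟩, -⟩ := hS j hj
      have b3 := hsec _ b1 _ (hjW p q hpq)
      simp only at b3
      have b4 : gF (j * w) (q - p) = τ p q * Real.sin (φ p q - j * w) := by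
        unfold gF
        rw [e1 p q hpq, e2 p q hpq, Real.sin_sub]
        simp only [φ]; ring
      have b5 : |φ p q - j * w| ≤ Real.pi / 2 := by
        have hxx := hx p q hpq
        have : φ p q - j * w = x p q - (j * w - jj p q * w) := by simp only [φ]; ring
        rw [this]
        refine (abs_sub _ _).trans ?_
        linarith [Real.pi_gt_three]
      have b6 := Real.mul_abs_le_abs_sin b5
      rw [b4, abs_mul] at b2
      have b7 : T / (2 * A) ≤ |τ p q| := by
        refine (hτ' p q hpq).trans ?_
        rcases hς with h | h <;> rw [h]
        · rw [one_mul]; exact le_abs_self _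
        · rw [neg_one_mul]; exact neg_le_abs _
      have b8 : (1:ℝ)/2 ≤ 2 / Real.pi := by
        rw [div_le_div_iff₀ (by norm_num) Real.pi_pos]; linarith [Real.pi_le_four]
      have b9 : 1 / 2 * |φ p q - j * w| ≤ |Real.sin (φ p q - j * w)| :=
        (mul_le_mul_of_nonneg_right b8 (abs_nonneg _)).trans b6
      have b10 : T / (2 * A) * (1 / 2 * |φ p q - j * w|) ≤ 5 * (T * σ) :=
        (mul_le_mul b7 b9 (by positivity) (abs_nonneg _)).trans b2
      rw [abs_sub_comm]
      have b11 : T / (2 * A) * (1 / 2 * |φ p q - j * w|) = |φ p q - j * w| * (T / (4 * A)) := by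
        field_simp; norm_num; ring
      rw [b11] at b10
      have b12 : 5 * (T * σ) = 20 * A * σ * (T / (4 * A)) := by field_simp; norm_num
      rw [b12] at b10
      exact le_of_mul_le_mul_right b10 (by positivity)
    refine (int_count S w _ _ hw0 (by positivity) hb).trans ?_
    have : 2 * (20 * A * σ) / w = 40 * A ^ 3 := by rw [hw]; field_simp; norm_num
    rw [this]
    have h3 : (1:ℝ) ≤ A ^ 3 := one_le_pow₀ (by linarith)
    calc 40 * A ^ 3 + 1 ≤ 41 * A ^ 3 := by linarith
      _ ≤ A * A ^ 3 := mul_le_mul_of_nonneg_right (by linarith) (by positivity)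
      _ = A ^ 4 := by ring
  have hWE : W.card * n0 ≤ E.card * A ^ 4 := by
    choose! FS hFS1 hFS2 hFS3 using hn0
    have k1 : W.card * n0 ≤ ∑ y ∈ W, ((FS y).card : ℝ) := by
      rw [← nsmul_eq_mul, ← Finset.sum_const]; exact Finset.sum_le_sum hFS3
    have k2 : ∑ y ∈ W, ((FS y).card : ℝ) = ((W.sigma FS).card : ℝ) := by
      rw [Finset.card_sigma]; push_cast; rfl
    have k3 : (W.sigma FS).card ≤ ⌊A ^ 4⌋₊ * E.card := by
      refine Finset.card_le_mul_card_image_of_maps_to (f := fun z => (z.1.1, z.2)) ?_ _ ?_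
      · rintro ⟨y, q⟩ hz
        rw [Finset.mem_sigma] at hz
        exact (hE _ _).2 ⟨hW _ hz.1, hFS1 y hz.1 hz.2, y.2, hz.1, hFS2 y hz.1 q hz.2⟩
      · rintro ⟨p, q⟩ hpq
        rw [Nat.le_floor_iff (by positivity)]
        have hinj : Set.InjOn (fun z : (Σ _ : Pt × ℤ, Pt) => z.1.2)
            (((W.sigma FS).filter (fun z => (z.1.1, z.2) = (p, q)) : Finset _) : Set _) := by
          rintro ⟨⟨p1, j1⟩, q1⟩ h1 ⟨⟨p2, j2⟩, q2⟩ h2 h3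
          simp only [Finset.coe_filter, Set.mem_ofPred_eq, Prod.mk.injEq] at h1 h2 h3
          obtain ⟨-, rfl, rfl⟩ := h1
          obtain ⟨-, rfl, rfl⟩ := h2
          rw [h3]
        rw [← Finset.card_image_of_injOn hinj]
        refine hmult p q hpq _ ?_
        intro j hj
        obtain ⟨⟨⟨p1, j1⟩, q1⟩, h1, h2⟩ := Finset.mem_image.1 hj
        rw [Finset.mem_filter, Finset.mem_sigma, Prod.mk.injEq] at h1
        obtain ⟨⟨h3, h4⟩, h5, h6⟩ := h1
        simp only at h2 h3 h4 h5 h6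
        subst h2 h5 h6
        exact ⟨h3, hFS2 _ h3 _ h4⟩
    have k4 : ((W.sigma FS).card : ℝ) ≤ ⌊A ^ 4⌋₊ * E.card := by exact_mod_cast k3
    have k5 : (⌊A ^ 4⌋₊ : ℝ) ≤ A ^ 4 := Nat.floor_le (by positivity)
    calc _ ≤ ∑ y ∈ W, ((FS y).card : ℝ) := k1
      _ ≤ ⌊A ^ 4⌋₊ * E.card := k2 ▸ k4
      _ ≤ A ^ 4 * E.card := mul_le_mul_of_nonneg_right k5 (Nat.cast_nonneg _)
      _ = _ := by ring
  have hEP : (E.card : ℝ) ≤ (P.card : ℝ) ^ 2 := by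
    have : E ⊆ P ×ˢ P := by
      rintro ⟨p, q⟩ h
      have := (hE p q).1 h
      exact Finset.mem_product.2 ⟨this.1, this.2.1⟩
    have h := Finset.card_le_card this
    rw [Finset.card_product] at h
    rw [sq]; exact_mod_cast h
  suffices hmain : (E.card : ℝ) ^ 2 ≤ A ^ 12 * (P.card : ℝ) ^ 3 * n1 by
    calc (W.card * n0) ^ 2 ≤ (E.card * A ^ 4) ^ 2 := pow_le_pow_left₀ (by positivity) hWE 2
      _ = (E.card : ℝ) ^ 2 * A ^ 8 := by ring
      _ ≤ (A ^ 12 * (P.card : ℝ) ^ 3 * n1) * A ^ 8 := mul_le_mul_of_nonneg_right hmain (by positivity)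
      _ = _ := by ring
  have hP0 : (0:ℝ) ≤ P.card := Nat.cast_nonneg _
  have hn10 : (0:ℝ) ≤ n1 := Nat.cast_nonneg _
  rcases lt_or_ge (P.card : ℝ) (A ^ 8 * n1) with hlt | hge
  · have hA12 : A ^ 8 ≤ A ^ 12 := pow_le_pow_right₀ (by linarith) (by norm_num)
    calc (E.card : ℝ) ^ 2 ≤ ((P.card : ℝ) ^ 2) ^ 2 := pow_le_pow_left₀ (by positivity) hEP 2
      _ = (P.card : ℝ) ^ 3 * P.card := by ring
      _ ≤ (P.card : ℝ) ^ 3 * (A ^ 8 * n1) := mul_le_mul_of_nonneg_left hlt.le (by positivity)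
      _ = A ^ 8 * ((P.card : ℝ) ^ 3 * n1) := by ring
      _ ≤ A ^ 12 * ((P.card : ℝ) ^ 3 * n1) := mul_le_mul_of_nonneg_right hA12 (by positivity)
      _ = _ := by ring
  rcases E.eq_empty_or_nonempty with he | ⟨⟨p0, q0⟩, h0⟩
  · rw [he]; simp; positivity
  have hn1' : 1 ≤ n1 := by
    have h1 := hjW p0 q0 h0
    have := hn1 _ h1 {q0} (by simpa using ((hE _ _).1 h0).2.1) (by
      intro q hq; rw [Finset.mem_singleton.1 hq]; exact (hjF p0 q0 h0).1)
    simpa using this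
  have hn1r : (1:ℝ) ≤ n1 := by exact_mod_cast hn1'
  let Conf : Pt × Pt → Finset Pt := fun e =>
    (P.filter (fun q' => q' ≠ e.1 ∧ q' ≠ e.2 ∧ (e.1, q') ∈ E ∧ |φ e.1 e.2 - φ e.1 q'| < G)) ∪
    (P.filter (fun p' => p' ≠ e.1 ∧ p' ≠ e.2 ∧ (p', e.2) ∈ E ∧ |φ e.1 e.2 - φ p' e.2| < G))
  have hne : ∀ p q, (p, q) ∈ E → p ≠ q := by
    rintro p q h rfl
    have := (hjF p p h).2.1
    rw [sub_self, norm_zero] at this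
    have h2 : 0 < T / A := by positivity
    linarith
  have hsamp := sampling P E φ Conf L G (A ^ 7 * n1) (1 / (A ^ 8 * n1)) hL hG0
    (by rintro ⟨p, q⟩ h; have := (hE p q).1 h; exact ⟨this.1, this.2.1, hne p q h⟩)
    (by
      rintro ⟨p, q⟩ hpq
      refine ⟨?_, ?_, ?_⟩
      · exact Finset.union_subset (Finset.filter_subset _ _) (Finset.filter_subset _ _)
      · intro y hy
        rcases Finset.mem_union.1 hy with h | h
        · have := (Finset.mem_filter.1 h).2; exact ⟨this.1, this.2.1⟩
        · have := (Finset.mem_filter.1 h).2; exact ⟨this.1, this.2.1⟩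
      · obtain ⟨J, hJ⟩ : ∃ J : Finset ℤ, J = Finset.Icc (jj p q - ⌊2 * A ^ 6⌋) (jj p q + ⌊2 * A ^ 6⌋) :=
          ⟨_, rfl⟩
        have hJm : ∀ j : ℤ, ∀ y : ℝ, |y| ≤ 10 * A * σ → |φ p q - (j * w + y)| < G → j ∈ J := by
          intro j y hy h
          have : |((j - jj p q : ℤ) : ℝ)| ≤ 2 * A ^ 6 := by
            have z1 : ((j - jj p q : ℤ) : ℝ) * w = -(φ p q - (j * w + y)) + x p q - y := by
              simp only [φ]; push_cast; ring
            have z2 : |((j - jj p q : ℤ) : ℝ) * w| ≤ 2 * A ^ 4 * σ := by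
              rw [z1]
              refine (abs_sub _ _).trans ?_
              have := abs_add_le (-(φ p q - (j * w + y))) (x p q)
              rw [abs_neg] at this
              have z3 := hx p q hpq
              have z4 : 20 * A * σ ≤ A ^ 4 * σ := by
                refine mul_le_mul_of_nonneg_right ?_ hσ.le
                calc 20 * A ≤ A ^ 3 * A := mul_le_mul_of_nonneg_right (by
                      calc (20:ℝ) ≤ 1000 ^ 3 := by norm_num
                        _ ≤ A ^ 3 := pow_le_pow_left₀ (by norm_num) hA 3) hA0.le
                  _ = A ^ 4 := by ring
              rw [hG] at h
              linarith
            rw [abs_mul, abs_of_pos hw0] at z2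
            have z5 : 2 * A ^ 4 * σ = 2 * A ^ 6 * w := by rw [hw]; field_simp
            rw [z5] at z2
            exact le_of_mul_le_mul_right z2 hw0
          rw [← Int.cast_abs] at this
          have := Int.le_floor.2 this
          have := abs_le.1 this
          rw [hJ, Finset.mem_Icc]
          omega
        have hJc : (J.card : ℝ) ≤ 5 * A ^ 6 := by
          rw [hJ, Int.card_Icc]
          have z0 : 0 ≤ ⌊2 * A ^ 6⌋ := Int.floor_nonneg.2 (by positivity)
          have z1 : ((jj p q + ⌊2 * A ^ 6⌋ + 1 - (jj p q - ⌊2 * A ^ 6⌋)).toNat : ℤ) = 2 * ⌊2 * A ^ 6⌋ + 1 := by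
            rw [Int.toNat_of_nonneg (by omega)]; ring
          have z2 : ((jj p q + ⌊2 * A ^ 6⌋ + 1 - (jj p q - ⌊2 * A ^ 6⌋)).toNat : ℝ) = 2 * ⌊2 * A ^ 6⌋ + 1 := by
            exact_mod_cast z1
          rw [z2]
          have z3 := Int.floor_le (2 * A ^ 6)
          have z4 : (1:ℝ) ≤ A ^ 6 := one_le_pow₀ (by linarith)
          linarith
        have hcc := conf_count T σ w hT hσ P W hdiam n1 hn1 J p q
          (P.filter (fun q' => q' ≠ p ∧ q' ≠ q ∧ (p, q') ∈ E ∧ |φ p q - φ p q'| < G))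
          (P.filter (fun p' => p' ≠ p ∧ p' ≠ q ∧ (p', q) ∈ E ∧ |φ p q - φ p' q| < G))
          (Finset.filter_subset _ _) (Finset.filter_subset _ _) (fun q' => jj p q') (fun p' => jj p' q)
          (by
            intro q' hq'
            obtain ⟨-, -, -, h1, h2⟩ := Finset.mem_filter.1 hq'
            exact ⟨hJm _ _ (hx _ _ h1) h2, hjW _ _ h1, (hjF _ _ h1).1⟩)
          (by
            intro q' hq'
            obtain ⟨-, -, -, h1, h2⟩ := Finset.mem_filter.1 hq'
            exact ⟨hJm _ _ (hx _ _ h1) h2, hjW _ _ h1, (hjF _ _ h1).1⟩)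
        have hcc' := (Finset.card_union_le _ _).trans hcc
        have : ((Conf (p, q)).card : ℝ) ≤ 122 * n1 * J.card := by exact_mod_cast hcc'
        refine this.trans ?_
        calc 122 * (n1:ℝ) * J.card ≤ 122 * n1 * (5 * A ^ 6) := mul_le_mul_of_nonneg_left hJc (by positivity)
          _ = 610 * (A ^ 6 * n1) := by ring
          _ ≤ A * (A ^ 6 * n1) := mul_le_mul_of_nonneg_right (by linarith) (by positivity)
          _ = _ := by ring)
    (by
      intro p q q' h h' hn hl
      exact Finset.mem_union_left _ (Finset.mem_filter.2 ⟨((hE _ _).1 h').2.1, (hne _ _ h').symm, hn.symm, h', hl⟩))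
    (by
      intro p p' q h h' hn hl
      exact Finset.mem_union_right _ (Finset.mem_filter.2 ⟨((hE _ _).1 h').1, hn.symm, (hne _ _ h'), h', hl⟩))
    (by
      intro p p' q q' hpp hqq a b c d g1 g2 g3 g4
      have hk : ∀ p q p' q', (p, q) ∈ E → (p', q') ∈ E → |φ p q - φ p' q'| ≤ 2 := by
        intro p q p' q' h h'
        have z1 : φ p q - φ p' q' = (jj p q * w - jj p' q' * w) + (x p q - x p' q') := by
          simp only [φ]; ring
        rw [z1]
        refine (abs_add_le _ _).trans ?_
        have z2 := hsec _ (hjW _ _ h) _ (hjW _ _ h')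
        have z3 := abs_sub (x p q) (x p' q')
        have z4 := hx _ _ h
        have z5 := hx _ _ h'
        simp only at z2
        linarith
      have hmm : ∀ p q p' q', (p, q) ∈ E → (p', q') ∈ E → (T / (2 * A)) ^ 2 ≤ τ p q * τ p' q' := by
        intro p q p' q' h h'
        have z1 := hτ' _ _ h
        have z2 := hτ' _ _ h'
        have z3 : 0 ≤ T / (2 * A) := by positivity
        have z4 := mul_le_mul z1 z2 z3 (z3.trans z1)
        rw [sq]
        refine z4.trans (le_of_eq ?_)
        rcases hς with h | h <;> rw [h] <;> ring
      have co : ∀ u : Pt → ℝ, (∀ a b, u (a - b) = u a - u b) →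
          u (q - p) - u (q - p') + u (q' - p') - u (q' - p) = 0 := by
        intro u hu; simp only [hu]; ring
      refine interleave T (A ^ 2 * (T * σ ^ 2)) (T / (2 * A)) G (φ p q) (φ p' q) (φ p' q') (φ p q')
        (τ p q) (τ p' q) (τ p' q') (τ p q') (f p q) (f p' q) (f p' q') (f p q') (by positivity) hG0
        (hmm _ _ _ _ a c) (hmm _ _ _ _ a b) (hmm _ _ _ _ d b) (hmm _ _ _ _ c d)
        (hτ _ _ a) (hτ _ _ c) (hτ _ _ d) (hτ _ _ b) (hf _ _ a) (hf _ _ c) (hf _ _ d) (hf _ _ b)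
        ?_ ?_ ?_ g1 g2 g3 g4 (hk _ _ _ _ a c) (hk _ _ _ _ c d) (hk _ _ _ _ d b) (hk _ _ _ _ a b) ?_
      · have := co (fun u => u.1) (fun _ _ => rfl)
        simp only [e1 _ _ a, e1 _ _ b, e1 _ _ c, e1 _ _ d] at this
        exact this
      · have := co (fun u => u.2.1) (fun _ _ => rfl)
        simp only [e2 _ _ a, e2 _ _ b, e2 _ _ c, e2 _ _ d] at this
        exact this
      · have := co (fun u => u.2.2) (fun _ _ => rfl)
        simp only [e3 _ _ a, e3 _ _ b, e3 _ _ c, e3 _ _ d] at this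
        exact this
      · have z1 : (T / (2 * A)) ^ 2 * G ^ 2 = (A ^ 2 * (T ^ 2 * σ ^ 2)) * (A ^ 4 / 4) := by
          rw [hG]; field_simp; norm_num
        have z2 : 128 * (4 * T * (A ^ 2 * (T * σ ^ 2)) + (A ^ 2 * (T * σ ^ 2)) ^ 2) =
            (A ^ 2 * (T ^ 2 * σ ^ 2)) * (128 * (4 + (A * σ) ^ 2)) := by ring
        rw [z1, z2]
        refine mul_lt_mul_of_pos_left ?_ (by positivity)
        have z3 : (A * σ) ^ 2 ≤ 1 := pow_le_one₀ (by positivity) (by linarith)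
        have z4 : (1000:ℝ) ^ 4 ≤ A ^ 4 := pow_le_pow_left₀ (by norm_num) hA 4
        linarith)
    (by positivity)
    (by
      rw [div_le_one (by positivity)]
      have : (1:ℝ) ≤ A ^ 8 := one_le_pow₀ (by linarith)
      nlinarith)
    (by
      have : A ^ 7 * n1 * (1 / (A ^ 8 * n1)) = 1 / A := by field_simp
      rw [this]
      exact one_div_le_one_div_of_le (by norm_num) (by linarith))
    (by
      rw [mul_one_div, le_div_iff₀ (by positivity), one_mul]; exact hge)
  rw [mul_one_div, div_le_iff₀ (by positivity)] at hsamp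
  refine hsamp.trans ?_
  have h12 : (12 * ((L:ℝ) + 1)) ^ 2 ≤ (A ^ 2) ^ 2 := pow_le_pow_left₀ (by positivity) hLA 2
  calc 144 * ((L:ℝ) + 1) ^ 2 * (P.card : ℝ) ^ 3 * (A ^ 8 * n1)
      = (12 * ((L:ℝ) + 1)) ^ 2 * ((P.card : ℝ) ^ 3 * (A ^ 8 * n1)) := by ring
    _ ≤ (A ^ 2) ^ 2 * ((P.card : ℝ) ^ 3 * (A ^ 8 * n1)) := mul_le_mul_of_nonneg_right h12 (by positivity)
    _ = _ := by ring

end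
end

section
open Finset

noncomputable section

theorem class_alg (A N X τ a M D0 D1 F w S : ℝ) (hA : 1000 ≤ A) (hN : 0 ≤ N) (hX : 0 < X) (hτ : 0 < τ)
    (ha : a = X * τ ^ 2) (hM : 0 ≤ M) (hD0 : A ^ 34 ≤ D0) (hD1 : A ^ 34 * D1 ≤ D0 ^ 2) (hD1' : 0 ≤ D1)
    (hF : 0 < F) (hw : 0 ≤ w) (hNX : N ≤ 2 * A * X)
    (hcore : (w * (F / 2)) ^ 2 ≤ A ^ 20 * N ^ 3 * (D1 * a + 2 * F))
    (hS0 : 0 ≤ S) (hS1 : S ≤ w * (A * M * τ)) (hS2 : S * (D0 * a) ≤ w * (2 * F * (M * τ))) :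
    S * A ^ 5 ≤ N * M := by
  have hA0 : 0 < A := by linarith
  have ha0 : 0 < a := by rw [ha]; positivity
  have hD00 : 0 < D0 := lt_of_lt_of_le (by positivity) hD0
  have hA2 : (1000000:ℝ) ≤ A ^ 2 := by nlinarith
  refine le_of_sq_le_sq (a := S * A ^ 5) ?_ (mul_nonneg hN hM)
  have hN3 : N ^ 3 ≤ N ^ 2 * (2 * A * X) := by
    rw [pow_succ]; exact mul_le_mul_of_nonneg_left hNX (by positivity)
  have hc : w ^ 2 * F ^ 2 ≤ 8 * A ^ 21 * X * N ^ 2 * (D1 * a + 2 * F) := by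
    have h1 : A ^ 20 * N ^ 3 * (D1 * a + 2 * F) ≤ A ^ 20 * (N ^ 2 * (2 * A * X)) * (D1 * a + 2 * F) :=
      mul_le_mul_of_nonneg_right (mul_le_mul_of_nonneg_left hN3 (by positivity)) (by positivity)
    have h2 : w ^ 2 * F ^ 2 = 4 * (w * (F / 2)) ^ 2 := by ring
    have h3 : 8 * A ^ 21 * X * N ^ 2 * (D1 * a + 2 * F) = 4 * (A ^ 20 * (N ^ 2 * (2 * A * X)) * (D1 * a + 2 * F)) := by ring
    linarith
  rcases le_total (D1 * a) (2 * F) with h | h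
  · -- large F
    have h1 : w ^ 2 * F ^ 2 ≤ 32 * A ^ 21 * X * N ^ 2 * F := by
      have : 8 * A ^ 21 * X * N ^ 2 * (D1 * a + 2 * F) ≤ 8 * A ^ 21 * X * N ^ 2 * (4 * F) :=
        mul_le_mul_of_nonneg_left (by linarith) (by positivity)
      linarith
    have h2 : w ^ 2 * F ≤ 32 * A ^ 21 * X * N ^ 2 := by
      have : (w ^ 2 * F) * F ≤ (32 * A ^ 21 * X * N ^ 2) * F := by linarith
      exact le_of_mul_le_mul_right this hF
    have h3 : S * (S * (D0 * a)) ≤ (w * (A * M * τ)) * (w * (2 * F * (M * τ))) :=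
      mul_le_mul hS1 hS2 (by positivity) (by positivity)
    have h4 : (w * (A * M * τ)) * (w * (2 * F * (M * τ))) = (w ^ 2 * F) * (2 * A * M ^ 2 * τ ^ 2) := by ring
    have h5 : (w ^ 2 * F) * (2 * A * M ^ 2 * τ ^ 2) ≤ (32 * A ^ 21 * X * N ^ 2) * (2 * A * M ^ 2 * τ ^ 2) :=
      mul_le_mul_of_nonneg_right h2 (by positivity)
    have h6 : S ^ 2 * D0 * a ≤ (64 * A ^ 22 * (N * M) ^ 2) * a := by
      rw [ha] at h3 ⊢
      have : (32 * A ^ 21 * X * N ^ 2) * (2 * A * M ^ 2 * τ ^ 2) = (64 * A ^ 22 * (N * M) ^ 2) * (X * τ ^ 2) := by ring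
      have : S ^ 2 * D0 * (X * τ ^ 2) = S * (S * (D0 * (X * τ ^ 2))) := by ring
      linarith
    have h7 := le_of_mul_le_mul_right h6 ha0
    have h8 : S ^ 2 * A ^ 34 ≤ S ^ 2 * D0 := mul_le_mul_of_nonneg_left hD0 (by positivity)
    have h9 : (S ^ 2 * A ^ 10 * A ^ 2) * A ^ 22 ≤ (64 * (N * M) ^ 2) * A ^ 22 := by
      have : (S ^ 2 * A ^ 10 * A ^ 2) * A ^ 22 = S ^ 2 * A ^ 34 := by ring
      linarith
    have h10 := le_of_mul_le_mul_right h9 (by positivity)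
    have h11 : (S * A ^ 5) ^ 2 * 64 ≤ S ^ 2 * A ^ 10 * A ^ 2 := by
      have : (S * A ^ 5) ^ 2 * 64 = (S ^ 2 * A ^ 10) * 64 := by ring
      rw [this]; exact mul_le_mul_of_nonneg_left (by linarith) (by positivity)
    linarith
  · have h1 : w ^ 2 * F ^ 2 ≤ 16 * A ^ 21 * X * N ^ 2 * (D1 * a) := by
      have : 8 * A ^ 21 * X * N ^ 2 * (D1 * a + 2 * F) ≤ 8 * A ^ 21 * X * N ^ 2 * (2 * (D1 * a)) :=
        mul_le_mul_of_nonneg_left (by linarith) (by positivity)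
      linarith
    have h3 : (S * (D0 * a)) ^ 2 ≤ (w * (2 * F * (M * τ))) ^ 2 := pow_le_pow_left₀ (by positivity) hS2 2
    have h4 : (w * (2 * F * (M * τ))) ^ 2 = (w ^ 2 * F ^ 2) * (4 * M ^ 2 * τ ^ 2) := by ring
    have h5 : (w ^ 2 * F ^ 2) * (4 * M ^ 2 * τ ^ 2) ≤ (16 * A ^ 21 * X * N ^ 2 * (D1 * a)) * (4 * M ^ 2 * τ ^ 2) :=
      mul_le_mul_of_nonneg_right h1 (by positivity)
    have h6 : (S ^ 2 * D0 ^ 2) * a ^ 2 ≤ (64 * A ^ 21 * D1 * (N * M) ^ 2) * a ^ 2 := by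
      have k1 : (16 * A ^ 21 * X * N ^ 2 * (D1 * a)) * (4 * M ^ 2 * τ ^ 2) = (64 * A ^ 21 * D1 * (N * M) ^ 2) * (a * (X * τ ^ 2)) := by ring
      have : (S ^ 2 * D0 ^ 2) * a ^ 2 = (S * (D0 * a)) ^ 2 := by ring
      have e : a * (X * τ ^ 2) = a ^ 2 := by rw [← ha]; ring
      rw [e] at k1
      linarith
    have h7 := le_of_mul_le_mul_right h6 (by positivity)
    have h8 : S ^ 2 * A ^ 34 * D0 ^ 2 ≤ (64 * A ^ 21 * (N * M) ^ 2) * D0 ^ 2 := by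
      have b1 : A ^ 34 * (S ^ 2 * D0 ^ 2) ≤ A ^ 34 * (64 * A ^ 21 * D1 * (N * M) ^ 2) :=
        mul_le_mul_of_nonneg_left h7 (by positivity)
      have b2 : (64 * A ^ 21 * (N * M) ^ 2) * (A ^ 34 * D1) ≤ (64 * A ^ 21 * (N * M) ^ 2) * D0 ^ 2 :=
        mul_le_mul_of_nonneg_left hD1 (by positivity)
      linarith
    have h9 := le_of_mul_le_mul_right h8 (by positivity)
    have h10 : (S ^ 2 * A ^ 10 * A ^ 3) * A ^ 21 ≤ (64 * (N * M) ^ 2) * A ^ 21 := by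
      have : (S ^ 2 * A ^ 10 * A ^ 3) * A ^ 21 = S ^ 2 * A ^ 34 := by ring
      linarith
    have h11 := le_of_mul_le_mul_right h10 (by positivity)
    have h12 : (S * A ^ 5) ^ 2 * 64 ≤ S ^ 2 * A ^ 10 * A ^ 3 := by
      have : (S * A ^ 5) ^ 2 * 64 = (S ^ 2 * A ^ 10) * 64 := by ring
      rw [this]; exact mul_le_mul_of_nonneg_left (by nlinarith) (by positivity)
    linarith

def nearF (P : Finset Pt) (A T σ θ : ℝ) (p : Pt) : Finset Pt :=
  open Classical in P.filter (fun q => Slab T σ θ (q - p) ∧ ‖q - p‖ ≤ T / A)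
def farF (P : Finset Pt) (A T σ θ : ℝ) (p : Pt) : Finset Pt :=
  open Classical in P.filter (fun q => Slab T σ θ (q - p) ∧ T / A < ‖q - p‖)

theorem class_bd (A T σ w X τ a D0 D1 : ℝ) (hA : 1000 ≤ A) (hT : 0 < T) (hσ : 0 < σ) (hσA : σ * A ^ 4 ≤ 1)
    (hw : w = σ / A ^ 2) (P Q : Finset Pt) (L : ℕ) (hL : Q.card < 2 ^ L) (hLA : 12 * ((L:ℝ) + 1) ≤ A ^ 2)
    (hX : 0 < X) (hτ : 0 < τ) (ha : a = X * τ ^ 2) (M : ℕ)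
    (hD0 : A ^ 34 ≤ D0) (hD1 : A ^ 34 * D1 ≤ D0 ^ 2) (hD1' : 0 ≤ D1)
    (hQX : (Q.card : ℝ) ≤ 2 * A * X) (hQP : Q ⊆ P)
    (W : Finset (Pt × ℤ)) (hWQ : ∀ x ∈ W, x.1 ∈ Q) (hcov : ∀ x ∈ W, ∀ q ∈ P, ‖q - x.1‖ ≤ T → q ∈ Q)
    (hdiam : ∀ x ∈ W, ∀ y ∈ W, ‖y.1 - x.1‖ ≤ T)
    (hsec : ∀ x ∈ W, ∀ y ∈ W, |(x.2:ℝ) * w - y.2 * w| ≤ 1) (ς : ℝ) (hς : ς = 1 ∨ ς = -1) (F : ℕ) (hF : 0 < F)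
    (hn0 : ∀ x ∈ W, ∃ S ⊆ P, (∀ q ∈ S, FarS A T σ ς (x.2 * w) (q - x.1)) ∧ (F:ℝ) / 2 ≤ S.card)
    (hn1 : ∀ x ∈ W, (farF P A T σ (x.2 * w) x.1).card ≤ 2 * F)
    (hnear : ∀ x ∈ W, ((nearF P A T σ (x.2 * w) x.1).card : ℝ) ≤ D1 * a)
    (e : Pt × ℤ → ℕ) (he1 : ∀ x ∈ W, (e x : ℝ) ≤ A * M * τ)
    (he2 : ∀ x ∈ W, (e x : ℝ) * (D0 * a) ≤ 2 * F * (M * τ)) :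
    (∑ x ∈ W, (e x : ℝ)) * A ^ 5 ≤ Q.card * M := by
  classical
  have hc := core A T σ w hA hT hσ hσA hw Q L hL hLA ς hς W hWQ hdiam hsec (F / 2) (⌊D1 * a⌋₊ + 2 * F)
    (by positivity) (fun x hx => by
      obtain ⟨S, h1, h2, h3⟩ := hn0 x hx
      exact ⟨S, fun q hq => hcov x hx q (h1 hq) (h2 q hq).1.1, h2, h3⟩) (fun x hx S hS hS2 => by
      have h1 : S ⊆ nearF P A T σ (x.2 * w) x.1 ∪ farF P A T σ (x.2 * w) x.1 := by
        intro q hq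
        rw [Finset.mem_union]; unfold nearF farF
        rw [Finset.mem_filter, Finset.mem_filter]
        rcases le_or_gt ‖q - x.1‖ (T / A) with h | h
        · exact Or.inl ⟨hQP (hS hq), hS2 q hq, h⟩
        · exact Or.inr ⟨hQP (hS hq), hS2 q hq, h⟩
      exact (Finset.card_le_card h1).trans ((Finset.card_union_le _ _).trans
        (add_le_add (Nat.le_floor (hnear x hx)) (hn1 x hx))))
  have hA0 : 0 < A := by linarith
  have ha0 : 0 < a := by rw [ha]; positivity
  refine class_alg A Q.card X τ a M D0 D1 F W.card _ hA (Nat.cast_nonneg _) hX hτ ha (Nat.cast_nonneg _) hD0 hD1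
    hD1' (by exact_mod_cast hF) (Nat.cast_nonneg _) hQX ?_ (Finset.sum_nonneg (fun x _ => Nat.cast_nonneg _)) ?_ ?_
  · refine hc.trans (mul_le_mul_of_nonneg_left ?_ (by positivity))
    push_cast
    have := Nat.floor_le (show 0 ≤ D1 * a by positivity)
    linarith
  · have := Finset.sum_le_sum he1
    simpa using this
  · have := Finset.sum_le_sum he2
    rw [Finset.sum_mul]
    simpa using this
end
end

section
open Finset

noncomputable section

structure Cfg (A δ s : ℝ) (P : Finset Pt) (E : Pt → Finset ℝ) (M L : ℕ) : Prop where
  hA : 1000 ≤ A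
  hδ : 0 < δ
  hδ1 : δ ≤ 1
  hs : 0 < s
  hs1 : s ≤ 1
  reg : ∀ p ∈ P, p.1 ^ 2 + p.2.1 ^ 2 ≤ 1 / 16 ∧ 1 / 2 ≤ p.2.2 ∧ p.2.2 ≤ 1
  hE : ∀ p ∈ P, (E p).card = M
  hE7 : ∀ p ∈ P, ∀ θ ∈ E p, 0 ≤ θ ∧ θ ≤ 7
  frE : ∀ p ∈ P, ∀ S ⊆ E p, ∀ φ ρ, δ ≤ ρ → (∀ θ ∈ S, |θ - φ| ≤ ρ) → (S.card : ℝ) ≤ A * M * ρ ^ s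
  frP : ∀ S ⊆ P, ∀ x ρ, δ ≤ ρ → (∀ p ∈ S, ‖p - x‖ ≤ ρ) → (S.card : ℝ) ≤ A * (ρ / δ) ^ s
  hL : P.card < 2 ^ L
  hLA : 12 * ((L:ℝ) + 1) ≤ A ^ 2

theorem mem_farF (P : Finset Pt) (A T σ θ : ℝ) (p q : Pt) :
    q ∈ farF P A T σ θ p ↔ q ∈ P ∧ Slab T σ θ (q - p) ∧ T / A < ‖q - p‖ := by
  classical unfold farF; simp only [Finset.mem_filter]
theorem mem_nearF (P : Finset Pt) (A T σ θ : ℝ) (p q : Pt) :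
    q ∈ nearF P A T σ θ p ↔ q ∈ P ∧ Slab T σ θ (q - p) ∧ ‖q - p‖ ≤ T / A := by
  classical unfold nearF; simp only [Finset.mem_filter]

def blk (E : Pt → Finset ℝ) (w : ℝ) (x : Pt × ℤ) : Finset ℝ := (E x.1).filter (fun θ => ⌊θ / w⌋ = x.2)

theorem blk_mem (w θ : ℝ) (hw : 0 < w) (j : ℤ) (h : ⌊θ / w⌋ = j) : j * w ≤ θ ∧ θ < j * w + w := by
  rw [Int.floor_eq_iff, le_div_iff₀ hw, div_lt_iff₀ hw] at h
  exact ⟨h.1, by linarith [h.2]⟩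

theorem blk_card {A δ s P E M L} (C : Cfg A δ s P E M L) (σ w : ℝ) (hσ : δ ≤ σ) (hw : w = σ / A ^ 2)
    (x : Pt × ℤ) (hx : x.1 ∈ P) : ((blk E w x).card : ℝ) ≤ A * M * σ ^ s := by
  have hA := C.hA
  have hσ0 : 0 < σ := C.hδ.trans_le hσ
  have hw0 : 0 < w := by rw [hw]; positivity
  have hwσ : w ≤ σ := by
    rw [hw]; exact div_le_self hσ0.le (by nlinarith)
  refine C.frE x.1 hx _ (Finset.filter_subset _ _) (x.2 * w) σ hσ ?_
  intro θ hθ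
  rw [Finset.mem_filter] at hθ
  obtain ⟨h1, h2⟩ := blk_mem w θ hw0 x.2 hθ.2
  rw [abs_le]; constructor <;> linarith

theorem blk_num {A δ s P E M L} (C : Cfg A δ s P E M L) (w : ℝ) (hw : 0 < w) (p : Pt) (hp : p ∈ P) (S : Finset ℤ)
    (hS : ∀ j ∈ S, 0 < (blk E w (p, j)).card) : (S.card : ℝ) ≤ 7 / w + 3 := by
  have := int_count S w (7/2) (7/2 + w) hw (by positivity) (fun j hj => by
    obtain ⟨θ, hθ⟩ := Finset.card_pos.1 (hS j hj)
    unfold blk at hθ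
    rw [Finset.mem_filter] at hθ
    obtain ⟨h1, h2⟩ := blk_mem w θ hw j hθ.2
    obtain ⟨h3, h4⟩ := C.hE7 p hp θ hθ.1
    rw [abs_le]; constructor <;> linarith)
  have e : 2 * (7/2 + w) / w + 1 = 7 / w + 3 := by field_simp; ring
  linarith

theorem sum_pairs (P : Finset Pt) (W : Finset (Pt × ℤ)) (hW : ∀ x ∈ W, x.1 ∈ P) (f : Pt × ℤ → ℝ) (B n : ℝ) (hB : 0 ≤ B)
    (hf : ∀ x ∈ W, f x ≤ B) (hn : ∀ p ∈ P, ∀ S : Finset ℤ, (∀ j ∈ S, (p, j) ∈ W) → (S.card : ℝ) ≤ n) :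
    ∑ x ∈ W, f x ≤ P.card * (n * B) := by
  classical
  rw [← Finset.sum_fiberwise_of_maps_to hW]
  have : ∀ p ∈ P, ∑ x ∈ W with x.1 = p, f x ≤ n * B := by
    intro p hp
    have h1 : ∑ x ∈ W with x.1 = p, f x ≤ ∑ x ∈ W with x.1 = p, B :=
      Finset.sum_le_sum (fun x hx => hf x (Finset.mem_filter.1 hx).1)
    rw [Finset.sum_const, nsmul_eq_mul] at h1
    have h2 := hn p hp ((W.filter (fun x => x.1 = p)).image Prod.snd) (fun j hj => by
      rw [Finset.mem_image] at hj
      obtain ⟨x, hx, rfl⟩ := hj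
      rw [Finset.mem_filter] at hx
      rw [← hx.2]; exact hx.1)
    rw [Finset.card_image_of_injOn] at h2
    · exact h1.trans (mul_le_mul_of_nonneg_right h2 hB)
    · intro x hx y hy hxy
      simp only [Finset.coe_filter, Set.mem_ofPred_eq] at hx hy
      exact Prod.ext (hx.2.trans hy.2.symm) hxy
  have h3 := Finset.sum_le_sum this
  rw [Finset.sum_const, nsmul_eq_mul] at h3
  exact h3

/-- trivial case -/
theorem tang_triv {A δ s P E M L} (C : Cfg A δ s P E M L) (T σ w D0 : ℝ) (hT : δ ≤ T) (hσ : 0 < σ)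
    (hw : w = σ / A ^ 2) (hσA : 1 ≤ σ * A ^ 4) (hD0 : A ^ 34 ≤ D0) (W : Finset (Pt × ℤ)) (hWP : ∀ x ∈ W, x.1 ∈ P)
    (he0 : ∀ x ∈ W, 0 < (blk E w x).card)
    (hfar : ∀ x ∈ W, ((blk E w x).card : ℝ) * (D0 * ((T / δ) ^ s * (σ ^ s) ^ 2)) ≤
      (farF P A T σ (x.2 * w) x.1).card * (M * σ ^ s)) :
    (∑ x ∈ W, ((blk E w x).card : ℝ)) * A ^ 2 ≤ P.card * M := by
  have hA := C.hA
  have hA0 : 0 < A := by linarith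
  have hδ := C.hδ
  have hT0 : 0 < T := hδ.trans_le hT
  have hw0 : 0 < w := by rw [hw]; positivity
  have hX : 0 < (T / δ) ^ s := by positivity
  have hτ : 0 < σ ^ s := by positivity
  have hD00 : 0 < D0 := lt_of_lt_of_le (by positivity) hD0
  have hτA : 1 ≤ σ ^ s * A ^ 4 := by
    have h1 : (1:ℝ) ≤ (σ * A ^ 4) ^ s := Real.one_le_rpow hσA C.hs.le
    rw [Real.mul_rpow hσ.le (by positivity)] at h1
    have h2 : (A ^ 4) ^ s ≤ A ^ 4 := by
      have := Real.rpow_le_rpow_of_exponent_le (show (1:ℝ) ≤ A ^ 4 from one_le_pow₀ (by linarith)) C.hs1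
      rwa [Real.rpow_one] at this
    exact h1.trans (mul_le_mul_of_nonneg_left h2 hτ.le)
  have hB : ∀ x ∈ W, ((blk E w x).card : ℝ) ≤ A ^ 5 * M / D0 := by
    intro x hx
    have h1 : ((farF P A T σ (x.2 * w) x.1).card : ℝ) ≤ A * (T / δ) ^ s :=
      C.frP _ (fun q hq => ((mem_farF _ _ _ _ _ _ _).1 hq).1) x.1 T hT (fun q hq =>
        ((mem_farF _ _ _ _ _ _ _).1 hq).2.1.1)
    have h2 := (hfar x hx).trans (mul_le_mul_of_nonneg_right h1 (by positivity))
    generalize (T / δ) ^ s = X at *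
    generalize σ ^ s = τ at *
    generalize ((blk E w x).card : ℝ) = e at *
    rw [le_div_iff₀ hD00]
    have h3 : (e * D0 * τ) * (X * τ) ≤ (A * M) * (X * τ) := by
      have : (e * D0 * τ) * (X * τ) = e * (D0 * (X * τ ^ 2)) := by ring
      have : (A * M) * (X * τ) = A * X * (M * τ) := by ring
      linarith
    have h4 := le_of_mul_le_mul_right h3 (by positivity)
    have h5 : (e * D0) * τ * A ^ 4 ≤ A * M * A ^ 4 := mul_le_mul_of_nonneg_right h4 (by positivity)
    rcases le_total (e * D0) 0 with h | h
    · exact h.trans (by positivity)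
    · have h6 := mul_le_mul_of_nonneg_left hτA h
      linarith
  have h1 := sum_pairs P W hWP (fun x => ((blk E w x).card : ℝ)) _ (7 / w + 3) (by positivity) hB
    (fun p hp S hS => blk_num C w hw0 p hp S (fun j hj => he0 _ (hS j hj)))
  have h2 : 7 / w + 3 ≤ A ^ 7 := by
    have : 1 / w ≤ A ^ 6 := by
      rw [hw, div_div_eq_mul_div, div_le_iff₀ hσ, one_mul]
      have := mul_le_mul_of_nonneg_right hσA (show 0 ≤ A ^ 2 by positivity)
      linarith
    have e : 7 / w = 7 * (1 / w) := by ring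
    have h6 : 1 ≤ A ^ 6 := one_le_pow₀ (by linarith)
    have h7 : 1000 * A ^ 6 ≤ A ^ 7 := by
      rw [pow_succ A 6]; nlinarith
    linarith
  have h3 : (∑ x ∈ W, ((blk E w x).card : ℝ)) ≤ P.card * (A ^ 7 * (A ^ 5 * M / D0)) :=
    h1.trans (mul_le_mul_of_nonneg_left (mul_le_mul_of_nonneg_right h2 (by positivity)) (by positivity))
  have h4 : A ^ 14 ≤ D0 := (pow_le_pow_right₀ (by linarith) (by norm_num)).trans hD0
  calc (∑ x ∈ W, ((blk E w x).card : ℝ)) * A ^ 2 ≤ P.card * (A ^ 7 * (A ^ 5 * M / D0)) * A ^ 2 :=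
        mul_le_mul_of_nonneg_right h3 (by positivity)
    _ = P.card * M * (A ^ 14 / D0) := by ring
    _ ≤ P.card * M * 1 := mul_le_mul_of_nonneg_left ((div_le_one hD00).2 h4) (by positivity)
    _ = P.card * M := mul_one _
end
end

section
open Finset

noncomputable section

theorem far_sign (A T σ θ : ℝ) (hA : 1000 ≤ A) (hT : 0 < T) (hσ : 0 < σ) (hσA : σ * A ^ 4 ≤ 1) (u : Pt)
    (hu : Slab T σ θ u) (hf : T / A < ‖u‖) : u.2.2 ≠ 0 := by
  intro h0
  obtain ⟨-, h1, h2⟩ := hu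
  unfold hF at h1
  unfold gF at h2
  rw [h0, add_zero] at h1
  have hcs := Real.sin_sq_add_cos_sq θ
  have hc1 := Real.abs_cos_le_one θ
  have hs1 := Real.abs_sin_le_one θ
  generalize Real.cos θ = c at *
  generalize Real.sin θ = s at *
  obtain ⟨u1, u2, u3⟩ := u
  simp only at *
  have k1 : u1 = (u1 * c + u2 * s) * c - (-u1 * s + u2 * c) * s := by linear_combination -u1 * hcs
  have k2 : u2 = (u1 * c + u2 * s) * s + (-u1 * s + u2 * c) * c := by linear_combination -u2 * hcs
  have hA0 : 0 < A := by linarith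
  have hA4 : 1000 * A ≤ A ^ 4 := by
    have : (1000:ℝ) ≤ A^3 := by
      have : (1000:ℝ)^3 ≤ A^3 := pow_le_pow_left₀ (by norm_num) hA 3
      linarith
    calc (1000:ℝ) * A ≤ A^3 * A := mul_le_mul_of_nonneg_right this (by linarith)
      _ = A ^ 4 := by ring
  have hσ2 : 1000 * (σ * A) ≤ 1 := by
    have := mul_le_mul_of_nonneg_left hA4 hσ.le
    linarith
  have hσ3 : σ ≤ 1 := by nlinarith
  have hb : 10 * (T * σ) ≤ T / A := by
    rw [le_div_iff₀ hA0]
    have := mul_le_mul_of_nonneg_left hσ2 hT.le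
    nlinarith
  have hs2 : T * σ ^ 2 ≤ T * σ := by
    have : σ ^ 2 ≤ σ := by nlinarith
    exact mul_le_mul_of_nonneg_left this hT.le
  have m1 : ∀ a b : ℝ, |b| ≤ 1 → |a * b| ≤ |a| := fun a b hb => by
    rw [abs_mul]; exact mul_le_of_le_one_right (abs_nonneg _) hb
  have a1 : |u1| ≤ T / A := by
    have := abs_sub ((u1 * c + u2 * s) * c) ((-u1 * s + u2 * c) * s)
    rw [← k1] at this
    linarith [m1 (u1 * c + u2 * s) c hc1, m1 (-u1 * s + u2 * c) s hs1]
  have a2 : |u2| ≤ T / A := by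
    have := abs_add_le ((u1 * c + u2 * s) * s) ((-u1 * s + u2 * c) * c)
    rw [← k2] at this
    linarith [m1 (u1 * c + u2 * s) s hs1, m1 (-u1 * s + u2 * c) c hc1]
  have := nrm_le_of (u1, u2, u3) (T / A) a1 a2 (by simp only [h0, abs_zero]; positivity)
  linarith

def cell (T : ℝ) (p : Pt) : ℤ × ℤ × ℤ := (⌊p.1 / T⌋, ⌊p.2.1 / T⌋, ⌊p.2.2 / T⌋)
def ncell (z c : ℤ × ℤ × ℤ) : Prop := |c.1 - z.1| ≤ 1 ∧ |c.2.1 - z.2.1| ≤ 1 ∧ |c.2.2 - z.2.2| ≤ 1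
def Qz (P : Finset Pt) (T : ℝ) (z : ℤ × ℤ × ℤ) : Finset Pt :=
  open Classical in P.filter (fun q => ncell z (cell T q))

theorem overlap (P : Finset Pt) (T : ℝ) (Z : Finset (ℤ × ℤ × ℤ)) : ∑ z ∈ Z, (Qz P T z).card ≤ 27 * P.card := by
  classical
  have h1 : ∀ z ∈ Z, (Qz P T z).card = ∑ q ∈ P, if ncell z (cell T q) then 1 else 0 := by
    intro z _
    unfold Qz
    rw [Finset.card_filter]
  rw [Finset.sum_congr rfl h1, Finset.sum_comm]
  have h2 : ∀ q ∈ P, (∑ z ∈ Z, if ncell z (cell T q) then 1 else 0) ≤ 27 := by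
    intro q _
    rw [← Finset.card_filter]
    obtain ⟨c1, c2, c3⟩ := cell T q
    have : Z.filter (fun z => ncell z (c1, c2, c3)) ⊆ Finset.Icc (c1 - 1) (c1 + 1) ×ˢ Finset.Icc (c2 - 1) (c2 + 1) ×ˢ
        Finset.Icc (c3 - 1) (c3 + 1) := by
      intro z hz
      rw [Finset.mem_filter] at hz
      obtain ⟨-, h⟩ := hz
      unfold ncell at h
      simp only [abs_le] at h
      simp only [Finset.mem_product, Finset.mem_Icc]
      omega
    refine (Finset.card_le_card this).trans ?_
    simp only [Finset.card_product, Int.card_Icc]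
    have e : ∀ c : ℤ, (c + 1 + 1 - (c - 1)).toNat = 3 := fun c => by
      rw [show c + 1 + 1 - (c - 1) = 3 by ring]; rfl
    rw [e, e, e]
  have h3 := Finset.sum_le_sum h2
  rw [Finset.sum_const, smul_eq_mul] at h3
  linarith

theorem floor_near (T x y : ℝ) (hT : 0 < T) (h : |y - x| ≤ T) : |⌊y / T⌋ - ⌊x / T⌋| ≤ 1 := by
  have h1 : y / T - x / T = (y - x) / T := by ring
  rw [abs_le] at h
  have h2 : (y - x) / T ≤ 1 := (div_le_one hT).2 h.2
  have h3 : -1 ≤ (y - x) / T := by rw [le_div_iff₀ hT]; linarith [h.1]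
  have f1 := Int.floor_le (y / T)
  have f2 := Int.lt_floor_add_one (y / T)
  have f3 := Int.floor_le (x / T)
  have f4 := Int.lt_floor_add_one (x / T)
  rw [abs_le]
  constructor
  · have : (⌊x / T⌋ : ℝ) < ⌊y / T⌋ + 2 := by linarith
    have : ⌊x / T⌋ < ⌊y / T⌋ + 2 := by exact_mod_cast this
    omega
  · have : (⌊y / T⌋ : ℝ) < ⌊x / T⌋ + 2 := by linarith
    have : ⌊y / T⌋ < ⌊x / T⌋ + 2 := by exact_mod_cast this
    omega

theorem floor_same (T x y : ℝ) (hT : 0 < T) (h : ⌊x / T⌋ = ⌊y / T⌋) : |y - x| ≤ T := by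
  have := Int.abs_sub_lt_one_of_floor_eq_floor h
  rw [← sub_div, abs_div, abs_of_pos hT, div_lt_one hT] at this
  rw [abs_sub_comm]; exact this.le

theorem floor_ball (T x : ℝ) (z : ℤ) (hT : 0 < T) (h : |⌊x / T⌋ - z| ≤ 1) : |x - (z + 1 / 2) * T| ≤ 2 * T := by
  have f1 := Int.floor_le (x / T)
  have f2 := Int.lt_floor_add_one (x / T)
  rw [abs_le] at h
  have g1 : (z:ℝ) - 1 ≤ ⌊x / T⌋ := by
    have : z - 1 ≤ ⌊x / T⌋ := by omega
    exact_mod_cast this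
  have g2 : (⌊x / T⌋ : ℝ) ≤ z + 1 := by
    have : ⌊x / T⌋ ≤ z + 1 := by omega
    exact_mod_cast this
  have e : x = (x / T) * T := by field_simp
  have k1 : ((z:ℝ) - 1) * T ≤ (x / T) * T := mul_le_mul_of_nonneg_right (by linarith) hT.le
  have k2 : (x / T) * T ≤ ((z:ℝ) + 2) * T := mul_le_mul_of_nonneg_right (by linarith) hT.le
  rw [← e] at k1 k2
  rw [abs_le]; constructor <;> linarith

theorem Qz_card {A δ s P E M L} (C : Cfg A δ s P E M L) (T : ℝ) (hT : δ ≤ T) (z : ℤ × ℤ × ℤ) :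
    ((Qz P T z).card : ℝ) ≤ 2 * A * (T / δ) ^ s := by
  have hT0 := C.hδ.trans_le hT
  have hδ := C.hδ
  have hA := C.hA
  classical
  have h1 := C.frP (Qz P T z) (by unfold Qz; exact Finset.filter_subset _ _)
    ((z.1 + 1/2) * T, (z.2.1 + 1/2) * T, (z.2.2 + 1/2) * T) (2 * T) (by linarith) (fun q hq => by
      unfold Qz at hq
      simp only [Finset.mem_filter] at hq
      obtain ⟨-, g1, g2, g3⟩ := hq
      exact nrm_le_of _ _ (floor_ball T _ _ hT0 g1) (floor_ball T _ _ hT0 g2) (floor_ball T _ _ hT0 g3))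
  have h2 : (2 * T / δ) ^ s ≤ 2 * (T / δ) ^ s := by
    rw [mul_div_assoc, Real.mul_rpow (by norm_num) (by positivity)]
    refine mul_le_mul_of_nonneg_right ?_ (by positivity)
    have := Real.rpow_le_rpow_of_exponent_le (show (1:ℝ) ≤ 2 by norm_num) C.hs1
    rwa [Real.rpow_one] at this
  have := mul_le_mul_of_nonneg_left h2 (show 0 ≤ A by linarith)
  linarith

set_option maxHeartbeats 1600000 in
theorem tang_main {A δ s P E M L} (C : Cfg A δ s P E M L) (T σ w D0 D1 : ℝ) (hT : δ ≤ T) (hσ : δ ≤ σ)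
    (hw : w = σ / A ^ 2) (hσA : σ * A ^ 4 ≤ 1) (hD0 : A ^ 34 ≤ D0) (hD1 : A ^ 34 * D1 ≤ D0 ^ 2) (hD1' : 0 ≤ D1)
    (W : Finset (Pt × ℤ)) (hWP : ∀ x ∈ W, x.1 ∈ P)
    (he0 : ∀ x ∈ W, 0 < (blk E w x).card)
    (hnear : ∀ x ∈ W, ((nearF P A T σ (x.2 * w) x.1).card : ℝ) ≤ D1 * ((T / δ) ^ s * (σ ^ s) ^ 2))
    (hfar : ∀ x ∈ W, ((blk E w x).card : ℝ) * (D0 * ((T / δ) ^ s * (σ ^ s) ^ 2)) ≤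
      (farF P A T σ (x.2 * w) x.1).card * (M * σ ^ s)) :
    (∑ x ∈ W, ((blk E w x).card : ℝ)) * A ^ 2 ≤ P.card * M := by
  classical
  have hA := C.hA
  have hA0 : 0 < A := by linarith
  have hδ := C.hδ
  have hT0 : 0 < T := hδ.trans_le hT
  have hσ0 : 0 < σ := hδ.trans_le hσ
  have hw0 : 0 < w := by rw [hw]; positivity
  obtain ⟨X, hXe⟩ : ∃ X, X = (T / δ) ^ s := ⟨_, rfl⟩
  obtain ⟨τ, hτe⟩ : ∃ τ, τ = σ ^ s := ⟨_, rfl⟩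
  have hX : 0 < X := by rw [hXe]; positivity
  have hτ : 0 < τ := by rw [hτe]; positivity
  have hD00 : 0 < D0 := lt_of_lt_of_le (by positivity) hD0
  rw [← hXe, ← hτe] at hnear hfar
  have hA4 : 1 ≤ A ^ 4 := one_le_pow₀ (by linarith)
  have hσ1 : σ ≤ 1 := by nlinarith
  have hw1 : w ≤ 1 := by
    rw [hw]; exact (div_le_self hσ0.le (one_le_pow₀ (by linarith))).trans hσ1
  obtain ⟨far, hfd⟩ : ∃ far : Pt × ℤ → Finset Pt, far = fun x => farF P A T σ (x.2 * w) x.1 := ⟨_, rfl⟩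
  have hfm : ∀ x q, q ∈ far x ↔ q ∈ P ∧ Slab T σ (x.2 * w) (q - x.1) ∧ T / A < ‖q - x.1‖ := by
    intro x q; rw [hfd]; exact mem_farF _ _ _ _ _ _ _
  have hfar' : ∀ x ∈ W, ((blk E w x).card : ℝ) * (D0 * (X * τ ^ 2)) ≤ (far x).card * (M * τ) := by
    rw [hfd]; exact hfar
  have hfpos : ∀ x ∈ W, 0 < (far x).card := by
    intro x hx
    rcases Nat.eq_zero_or_pos (far x).card with h | h
    · have h1 := hfar' x hx
      rw [h, Nat.cast_zero, zero_mul] at h1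
      have h2 : (0:ℝ) < (blk E w x).card := by exact_mod_cast he0 x hx
      have : 0 < ((blk E w x).card : ℝ) * (D0 * (X * τ ^ 2)) := by positivity
      linarith
    · exact h
  obtain ⟨pos, hpd⟩ : ∃ pos : Pt × ℤ → Finset Pt, pos = fun x => (far x).filter (fun q => (q - x.1).2.2 < 0) := ⟨_, rfl⟩
  obtain ⟨neg, hnd⟩ : ∃ neg : Pt × ℤ → Finset Pt, neg = fun x => (far x).filter (fun q => ¬ (q - x.1).2.2 < 0) := ⟨_, rfl⟩
  have hpn : ∀ x, (pos x).card + (neg x).card = (far x).card := by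
    intro x; rw [hpd, hnd]; exact Finset.card_filter_add_card_filter_not _
  obtain ⟨key, hkd⟩ : ∃ key : Pt × ℤ → (ℤ × ℤ × ℤ) × (ℤ × ℕ × Bool), key = fun x =>
    (cell T x.1, (⌊(x.2:ℝ) * w⌋, Nat.log 2 (far x).card, decide ((far x).card ≤ 2 * (pos x).card))) := ⟨_, rfl⟩
  obtain ⟨Ks, hKs⟩ : ∃ Ks : Finset (ℤ × ℕ × Bool), Ks = Finset.Icc (-1:ℤ) 7 ×ˢ Finset.range L ×ˢ Finset.univ := ⟨_, rfl⟩
  have hmaps : ∀ x ∈ W, key x ∈ (P.image (cell T)) ×ˢ Ks := by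
    intro x hx
    rw [hkd, hKs]
    simp only [Finset.mem_product, Finset.mem_image, Finset.mem_Icc, Finset.mem_range, Finset.mem_univ, and_true]
    refine ⟨⟨x.1, hWP x hx, rfl⟩, ?_, ?_⟩
    · obtain ⟨θ, hθ⟩ := Finset.card_pos.1 (he0 x hx)
      unfold blk at hθ
      rw [Finset.mem_filter] at hθ
      obtain ⟨h1, h2⟩ := blk_mem w θ hw0 x.2 hθ.2
      obtain ⟨h3, h4⟩ := C.hE7 x.1 (hWP x hx) θ hθ.1
      constructor
      · rw [Int.le_floor]; push_cast; linarith
      · have : ⌊(x.2:ℝ) * w⌋ < 8 := by rw [Int.floor_lt]; push_cast; linarith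
        omega
    · refine Nat.log_lt_of_lt_pow (hfpos x hx).ne' (lt_of_le_of_lt (Finset.card_le_card ?_) C.hL)
      intro q hq; exact ((hfm x q).1 hq).1
  have hclass : ∀ y ∈ (P.image (cell T)) ×ˢ Ks,
      (∑ x ∈ W with key x = y, ((blk E w x).card : ℝ)) * A ^ 5 ≤ (Qz P T y.1).card * M := by
    rintro ⟨z, m, i, b⟩ -
    have hk : ∀ x ∈ W.filter (fun x => key x = (z, m, i, b)), x ∈ W ∧ cell T x.1 = z ∧ ⌊(x.2:ℝ) * w⌋ = m ∧
        Nat.log 2 (far x).card = i ∧ decide ((far x).card ≤ 2 * (pos x).card) = b := by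
      intro x hx
      rw [Finset.mem_filter, hkd] at hx
      simpa only [Prod.mk.injEq] using hx
    have hlev : ∀ x ∈ W.filter (fun x => key x = (z, m, i, b)), 2 ^ i ≤ (far x).card ∧ (far x).card ≤ 2 * 2 ^ i := by
      intro x hx
      obtain ⟨h1, -, -, h4, -⟩ := hk x hx
      constructor
      · rw [← h4]; exact Nat.pow_log_le_self 2 (hfpos x h1).ne'
      · have := Nat.lt_pow_succ_log_self (b := 2) (by norm_num) (far x).card
        rw [h4, pow_succ] at this; omega
    have hQP : Qz P T z ⊆ P := by unfold Qz; exact Finset.filter_subset _ _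
    have hmemQ : ∀ q, q ∈ Qz P T z ↔ q ∈ P ∧ ncell z (cell T q) := by
      intro q; unfold Qz; simp only [Finset.mem_filter]
    refine class_bd A T σ w X τ (X * τ ^ 2) D0 D1 hA hT0 hσ0 hσA hw P (Qz P T z) L
      (lt_of_le_of_lt (Finset.card_le_card hQP) C.hL) C.hLA hX hτ rfl M hD0 hD1 hD1'
      (by rw [hXe]; exact Qz_card C T hT z) hQP _ ?_ ?_ ?_ ?_ (if b = true then 1 else -1)
      (by cases b <;> simp) (2 ^ i) (by positivity) ?_ ?_ ?_ (fun x => (blk E w x).card) ?_ ?_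
    · intro x hx
      obtain ⟨h1, h2, -⟩ := hk x hx
      rw [hmemQ, h2]
      refine ⟨hWP x h1, ?_⟩
      unfold ncell; simp
    · intro x hx q hq hqx
      obtain ⟨h1, h2, -⟩ := hk x hx
      rw [hmemQ]
      obtain ⟨n1, n2, n3⟩ := nrm_coord (q - x.1)
      rw [← h2]
      exact ⟨hq, floor_near T _ _ hT0 (n1.trans hqx), floor_near T _ _ hT0 (n2.trans hqx), floor_near T _ _ hT0 (n3.trans hqx)⟩
    · intro x hx y hy
      obtain ⟨-, h2, -⟩ := hk x hx
      obtain ⟨-, g2, -⟩ := hk y hy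
      rw [← g2] at h2
      unfold cell at h2
      simp only [Prod.mk.injEq] at h2
      exact nrm_le_of _ _ (floor_same T _ _ hT0 h2.1) (floor_same T _ _ hT0 h2.2.1) (floor_same T _ _ hT0 h2.2.2)
    · intro x hx y hy
      obtain ⟨-, -, h3, -⟩ := hk x hx
      obtain ⟨-, -, g3, -⟩ := hk y hy
      exact (Int.abs_sub_lt_one_of_floor_eq_floor (h3.trans g3.symm)).le
    · intro x hx
      obtain ⟨h1, -, -, -, h5⟩ := hk x hx
      obtain ⟨l1, l2⟩ := hlev x hx
      have l1' : ((2 ^ i : ℕ) : ℝ) ≤ (far x).card := by exact_mod_cast l1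
      have hp := hpn x
      cases b
      · rw [decide_eq_false_iff_not] at h5
        refine ⟨neg x, fun q hq => ?_, fun q hq => ?_, ?_⟩
        · rw [hnd] at hq; exact ((hfm x q).1 (Finset.mem_filter.1 hq).1).1
        · rw [hnd] at hq
          obtain ⟨q1, q2⟩ := Finset.mem_filter.1 hq
          obtain ⟨-, q3, q4⟩ := (hfm x q).1 q1
          have := far_sign A T σ _ hA hT0 hσ0 hσA _ q3 q4
          refine ⟨q3, q4, ?_⟩
          have : 0 < (q - x.1).2.2 := lt_of_le_of_ne (not_lt.1 q2) this.symm
          simp only [Bool.false_eq_true, if_false]; linarith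
        · have : (far x).card ≤ 2 * (neg x).card := by omega
          have : ((far x).card : ℝ) ≤ 2 * (neg x).card := by exact_mod_cast this
          linarith
      · rw [decide_eq_true_eq] at h5
        refine ⟨pos x, fun q hq => ?_, fun q hq => ?_, ?_⟩
        · rw [hpd] at hq; exact ((hfm x q).1 (Finset.mem_filter.1 hq).1).1
        · rw [hpd] at hq
          obtain ⟨q1, q2⟩ := Finset.mem_filter.1 hq
          obtain ⟨-, q3, q4⟩ := (hfm x q).1 q1
          refine ⟨q3, q4, ?_⟩
          simp only [if_true]; linarith
        · have : ((far x).card : ℝ) ≤ 2 * (pos x).card := by exact_mod_cast h5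
          linarith
    · intro x hx
      have := (hlev x hx).2
      rw [hfd] at this
      exact this
    · intro x hx
      exact hnear x (hk x hx).1
    · intro x hx
      rw [hτe]
      exact blk_card C σ w hσ hw x (hWP x (hk x hx).1)
    · intro x hx
      have h1 := hfar' x (hk x hx).1
      have h2 : ((far x).card : ℝ) ≤ 2 * ((2 ^ i : ℕ) : ℝ) := by exact_mod_cast (hlev x hx).2
      exact h1.trans (mul_le_mul_of_nonneg_right h2 (by positivity))
  have h1 : (∑ x ∈ W, ((blk E w x).card : ℝ)) * A ^ 5 ≤
      ∑ y ∈ (P.image (cell T)) ×ˢ Ks, ((Qz P T y.1).card : ℝ) * M := by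
    rw [← Finset.sum_fiberwise_of_maps_to hmaps, Finset.sum_mul]
    exact Finset.sum_le_sum hclass
  have h2 : ∑ y ∈ (P.image (cell T)) ×ˢ Ks, ((Qz P T y.1).card : ℝ) * M ≤ 27 * P.card * M * (18 * L) := by
    rw [Finset.sum_product]
    simp only [Finset.sum_const, nsmul_eq_mul]
    rw [← Finset.mul_sum, ← Finset.sum_mul]
    have o := overlap P T (P.image (cell T))
    have o' : ∑ z ∈ P.image (cell T), ((Qz P T z).card : ℝ) ≤ 27 * P.card := by exact_mod_cast o
    have c : (Ks.card : ℝ) = 18 * L := by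
      rw [hKs]; simp only [Finset.card_product, Int.card_Icc, Finset.card_range, Finset.card_univ, Fintype.card_bool]
      push_cast; ring
    rw [c, mul_comm]
    exact mul_le_mul_of_nonneg_right (mul_le_mul_of_nonneg_right o' (by positivity)) (by positivity)
  have h3 : 27 * 18 * (L:ℝ) ≤ A ^ 3 := by
    have := C.hLA
    have : A ^ 3 = A * A ^ 2 := by ring
    nlinarith
  have h4 : ((∑ x ∈ W, ((blk E w x).card : ℝ)) * A ^ 2) * A ^ 3 ≤ (P.card * M) * A ^ 3 := by
    have k1 : (P.card * M : ℝ) * (27 * 18 * L) ≤ (P.card * M) * A ^ 3 := mul_le_mul_of_nonneg_left h3 (by positivity)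
    have k2 : ((∑ x ∈ W, ((blk E w x).card : ℝ)) * A ^ 2) * A ^ 3 = (∑ x ∈ W, ((blk E w x).card : ℝ)) * A ^ 5 := by ring
    linarith
  exact le_of_mul_le_mul_right h4 (by positivity)
end
end

section
open Finset

noncomputable section

def incF (p : Pt) (θ : ℝ) (q : Pt) : ℝ :=
  (p.1 + p.2.2 * Real.cos θ - q.1) ^ 2 + (p.2.1 + p.2.2 * Real.sin θ - q.2.1) ^ 2 - q.2.2 ^ 2

theorem inc_eq (p : Pt) (θ : ℝ) (q : Pt) :
    incF p θ q = gF θ (q - p) ^ 2 + hF θ (q - p) * (hF θ (q - p) - 2 * q.2.2) := by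
  unfold incF gF hF
  have hcs := Real.sin_sq_add_cos_sq θ
  generalize Real.cos θ = c at *
  generalize Real.sin θ = s at *
  obtain ⟨p1, p2, p3⟩ := p
  obtain ⟨q1, q2, q3⟩ := q
  simp only [Prod.mk_sub_mk]
  linear_combination (p3 ^ 2 - (q1 - p1) ^ 2 - (q2 - p2) ^ 2) * hcs

theorem g_diff (θ φ : ℝ) (u : Pt) : |gF φ u - gF θ u| ≤ 2 * |φ - θ| * ‖u‖ := by
  obtain ⟨h1, h2, -⟩ := nrm_coord u
  have c1 := Real.abs_cos_sub_cos_le φ θ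
  have c2 := Real.abs_sin_sub_sin_le φ θ
  have e : gF φ u - gF θ u = -(u.1 * (Real.sin φ - Real.sin θ)) + u.2.1 * (Real.cos φ - Real.cos θ) := by
    unfold gF; ring
  rw [e]
  refine (abs_add_le _ _).trans ?_
  rw [abs_neg, abs_mul, abs_mul]
  have a1 := mul_le_mul h1 c2 (abs_nonneg _) (norm_nonneg u)
  have a2 := mul_le_mul h2 c1 (abs_nonneg _) (norm_nonneg u)
  linarith

theorem h_mid (θ φ : ℝ) (u : Pt) : hF φ u - hF θ u = 2 * Real.sin ((φ - θ) / 2) * gF ((φ + θ) / 2) u := by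
  have e1 : Real.cos φ - Real.cos θ = -2 * Real.sin ((φ + θ) / 2) * Real.sin ((φ - θ) / 2) := Real.cos_sub_cos φ θ
  have e2 : Real.sin φ - Real.sin θ = 2 * Real.sin ((φ - θ) / 2) * Real.cos ((φ + θ) / 2) := Real.sin_sub_sin φ θ
  unfold hF gF
  linear_combination u.1 * e1 + u.2.1 * e2

theorem inc_mid (p : Pt) (θ φ : ℝ) (q : Pt) :
    incF p φ q - incF p θ q = -4 * p.2.2 * Real.sin ((φ - θ) / 2) * gF ((φ + θ) / 2) (q - p) := by
  have := h_mid θ φ (q - p)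
  have h1 : incF p φ q - incF p θ q = -2 * p.2.2 * (hF φ (q - p) - hF θ (q - p)) := by
    unfold incF hF
    have hcs := Real.sin_sq_add_cos_sq θ
    have hcs' := Real.sin_sq_add_cos_sq φ
    simp only [Prod.fst_sub, Prod.snd_sub]
    linear_combination p.2.2 ^ 2 * hcs' - p.2.2 ^ 2 * hcs
  rw [h1, this]; ring

theorem h_diff (θ φ : ℝ) (u : Pt) (b : ℝ) (hb : |φ - θ| * ‖u‖ ≤ b) :
    |hF φ u - hF θ u| ≤ |φ - θ| * (|gF θ u| + b) := by
  rw [h_mid, abs_mul, abs_mul, abs_two]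
  have h1 : |Real.sin ((φ - θ) / 2)| ≤ |φ - θ| / 2 := by
    have := Real.abs_sin_le_abs (x := (φ - θ) / 2)
    rw [abs_div, abs_two] at this; exact this
  have h2 := g_diff θ ((φ + θ) / 2) u
  have e : (φ + θ) / 2 - θ = (φ - θ) / 2 := by ring
  rw [e, abs_div, abs_two] at h2
  have h3 : |gF ((φ + θ) / 2) u| ≤ |gF θ u| + b := by
    have := abs_sub_abs_le_abs_sub (gF ((φ + θ) / 2) u) (gF θ u)
    have e2 : 2 * (|φ - θ| / 2) * ‖u‖ = |φ - θ| * ‖u‖ := by ring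
    rw [e2] at h2
    linarith
  exact mul_le_mul (by linarith) h3 (abs_nonneg _) (abs_nonneg _)

theorem reg_bd (p q : Pt) (θ : ℝ) (hp : p.1 ^ 2 + p.2.1 ^ 2 ≤ 1 / 16 ∧ 1 / 2 ≤ p.2.2 ∧ p.2.2 ≤ 1)
    (hq : q.1 ^ 2 + q.2.1 ^ 2 ≤ 1 / 16 ∧ 1 / 2 ≤ q.2.2 ∧ q.2.2 ≤ 1) :
    1 / 2 ≤ |hF θ (q - p) - 2 * q.2.2| ∧ |hF θ (q - p) - 2 * q.2.2| ≤ 3 := by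
  have hcs := Real.sin_sq_add_cos_sq θ
  unfold hF
  simp only [Prod.fst_sub, Prod.snd_sub]
  generalize Real.cos θ = c at *
  generalize Real.sin θ = s at *
  obtain ⟨hp1, hp2, hp3⟩ := hp
  obtain ⟨hq1, hq2, hq3⟩ := hq
  have k : ∀ a b : ℝ, a ^ 2 + b ^ 2 ≤ 1 / 16 → |a * c + b * s| ≤ 1 / 4 := by
    intro a b h
    refine abs_le_of_sq_le_sq ?_ (by norm_num)
    have : (a * c + b * s) ^ 2 + (a * s - b * c) ^ 2 = a ^ 2 + b ^ 2 := by
      linear_combination (a ^ 2 + b ^ 2) * hcs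
    nlinarith [sq_nonneg (a * s - b * c)]
  have k1 := abs_le.1 (k _ _ hp1)
  have k2 := abs_le.1 (k _ _ hq1)
  have e : (q.1 - p.1) * c + (q.2.1 - p.2.1) * s + (q.2.2 - p.2.2) - 2 * q.2.2 =
    -(p.2.2 + q.2.2 - (q.1 * c + q.2.1 * s) + (p.1 * c + p.2.1 * s)) := by ring
  rw [e, abs_neg, abs_of_nonneg (by linarith)]
  constructor <;> linarith

theorem h_of_inc (p q : Pt) (θ : ℝ) (hp : p.1 ^ 2 + p.2.1 ^ 2 ≤ 1 / 16 ∧ 1 / 2 ≤ p.2.2 ∧ p.2.2 ≤ 1)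
    (hq : q.1 ^ 2 + q.2.1 ^ 2 ≤ 1 / 16 ∧ 1 / 2 ≤ q.2.2 ∧ q.2.2 ≤ 1) :
    |hF θ (q - p)| ≤ 2 * (|incF p θ q| + gF θ (q - p) ^ 2) := by
  obtain ⟨r1, -⟩ := reg_bd p q θ hp hq
  have e : incF p θ q - gF θ (q - p) ^ 2 = hF θ (q - p) * (hF θ (q - p) - 2 * q.2.2) := by rw [inc_eq]; ring
  have h1 := abs_sub (incF p θ q) (gF θ (q - p) ^ 2)
  rw [e, abs_mul, abs_of_nonneg (sq_nonneg (gF θ (q - p)))] at h1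
  have h2 := mul_le_mul_of_nonneg_left r1 (abs_nonneg (hF θ (q - p)))
  linarith

theorem inc_of_h (p q : Pt) (θ : ℝ) (hp : p.1 ^ 2 + p.2.1 ^ 2 ≤ 1 / 16 ∧ 1 / 2 ≤ p.2.2 ∧ p.2.2 ≤ 1)
    (hq : q.1 ^ 2 + q.2.1 ^ 2 ≤ 1 / 16 ∧ 1 / 2 ≤ q.2.2 ∧ q.2.2 ≤ 1) :
    |incF p θ q| ≤ gF θ (q - p) ^ 2 + 3 * |hF θ (q - p)| := by
  obtain ⟨-, r1⟩ := reg_bd p q θ hp hq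
  have h1 := abs_add_le (gF θ (q - p) ^ 2) (hF θ (q - p) * (hF θ (q - p) - 2 * q.2.2))
  rw [← inc_eq, abs_mul, abs_of_nonneg (sq_nonneg (gF θ (q - p)))] at h1
  have h2 := mul_le_mul_of_nonneg_left r1 (abs_nonneg (hF θ (q - p)))
  linarith

/-- in-block perturbation -/
theorem blk_pert (A T σ w θ φ : ℝ) (hA : 1000 ≤ A) (hT : 0 < T) (hσ : 0 < σ)
    (hw : w = σ / A ^ 2) (hθ : |φ - θ| ≤ w) (u : Pt) (hu : ‖u‖ ≤ T) :
    |gF φ u| ≤ |gF θ u| + T * σ / 4 ∧ |hF φ u - hF θ u| ≤ σ / 8 * (|gF θ u| + T * σ) ∧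
      |gF φ u - gF θ u| ≤ T * σ / (4 * A) := by
  have hA2 : 8 * A ≤ A ^ 2 := by nlinarith
  have hA0 : 0 < A := by linarith
  have hw1 : w ≤ σ / (8 * A) := by
    rw [hw]; exact div_le_div_of_nonneg_left hσ.le (by positivity) hA2
  have hw2 : σ / (8 * A) ≤ σ / 8 := div_le_div_of_nonneg_left hσ.le (by norm_num) (by linarith)
  have h0 : |φ - θ| * ‖u‖ ≤ σ / (8 * A) * T := mul_le_mul (hθ.trans hw1) hu (norm_nonneg _) (by positivity)
  have h0' : |φ - θ| * ‖u‖ ≤ σ / 8 * T := mul_le_mul (hθ.trans (hw1.trans hw2)) hu (norm_nonneg _) (by positivity)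
  have h1 := g_diff θ φ u
  have h2 := h_diff θ φ u (T * σ) (h0'.trans (by nlinarith))
  refine ⟨?_, ?_, ?_⟩
  · have := abs_sub_abs_le_abs_sub (gF φ u) (gF θ u)
    linarith
  · exact h2.trans (mul_le_mul_of_nonneg_right (hθ.trans (hw1.trans hw2)) (by positivity))
  · have e : T * σ / (4 * A) = 2 * (σ / (8 * A) * T) := by field_simp; ring
    rw [e]; linarith

theorem near_geom (A T σ w θ φ : ℝ) (hA : 1000 ≤ A) (hT : 0 < T) (hT1 : T ≤ 1) (hσ : 0 < σ)
    (hw : w = σ / A ^ 2) (hθ : |φ - θ| ≤ w) (p q : Pt)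
    (hp : p.1 ^ 2 + p.2.1 ^ 2 ≤ 1 / 16 ∧ 1 / 2 ≤ p.2.2 ∧ p.2.2 ≤ 1)
    (hq : q.1 ^ 2 + q.2.1 ^ 2 ≤ 1 / 16 ∧ 1 / 2 ≤ q.2.2 ∧ q.2.2 ≤ 1)
    (h : Slab T σ θ (q - p)) : |incF p φ q| ≤ A * (T * σ ^ 2) := by
  obtain ⟨h1, h2, h3⟩ := h
  obtain ⟨b1, b2, -⟩ := blk_pert A T σ w θ φ hA hT hσ hw hθ _ h1
  have b3 := inc_of_h p q φ hp hq
  have hTσ : 0 < T * σ := by positivity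
  have b4 : gF φ (q - p) ^ 2 ≤ (6 * (T * σ)) ^ 2 := by
    rw [← sq_abs]; exact pow_le_pow_left₀ (abs_nonneg _) (by linarith) 2
  have b5 : (6 * (T * σ)) ^ 2 ≤ 36 * (T * σ ^ 2) := by
    have : (6 * (T * σ)) ^ 2 = 36 * (T * σ ^ 2) * T := by ring
    rw [this]; exact mul_le_of_le_one_right (by positivity) hT1
  have b6 : |hF φ (q - p)| ≤ 6 * (T * σ ^ 2) := by
    have k := abs_sub_abs_le_abs_sub (hF φ (q - p)) (hF θ (q - p))
    have k2 : σ / 8 * (|gF θ (q - p)| + T * σ) ≤ σ / 8 * (6 * (T * σ)) :=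
      mul_le_mul_of_nonneg_left (by linarith) (by positivity)
    have k3 : σ / 8 * (6 * (T * σ)) = 6 / 8 * (T * σ ^ 2) := by ring
    have : 0 < T * σ ^ 2 := by positivity
    linarith
  have : 0 < T * σ ^ 2 := by positivity
  nlinarith

theorem far_geom (A T σ w θ φ Δ : ℝ) (hA : 1000 ≤ A) (hT : 0 < T) (hT1 : T ≤ 1) (hσ : 0 < σ)
    (hw : w = σ / A ^ 2) (hθ : |φ - θ| ≤ w) (p q : Pt)
    (hp : p.1 ^ 2 + p.2.1 ^ 2 ≤ 1 / 16 ∧ 1 / 2 ≤ p.2.2 ∧ p.2.2 ≤ 1)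
    (hq : q.1 ^ 2 + q.2.1 ^ 2 ≤ 1 / 16 ∧ 1 / 2 ≤ q.2.2 ∧ q.2.2 ≤ 1)
    (h1 : ‖q - p‖ ≤ T) (h2 : |incF p θ q| ≤ Δ) (hΔ : Δ ≤ T * σ ^ 2) (h3 : |gF θ (q - p)| ≤ T * σ) :
    Slab T σ φ (q - p) := by
  obtain ⟨b1, b2, -⟩ := blk_pert A T σ w θ φ hA hT hσ hw hθ _ h1
  have b3 := h_of_inc p q θ hp hq
  have hTσ : 0 < T * σ := by positivity
  have : 0 < T * σ ^ 2 := by positivity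
  have b4 : gF θ (q - p) ^ 2 ≤ (T * σ) ^ 2 := by
    rw [← sq_abs]; exact pow_le_pow_left₀ (abs_nonneg _) h3 2
  have b5 : (T * σ) ^ 2 ≤ (T * σ ^ 2) := by
    have : (T * σ) ^ 2 = (T * σ ^ 2) * T := by ring
    rw [this]; exact mul_le_of_le_one_right (by positivity) hT1
  refine ⟨h1, ?_, by linarith⟩
  have k := abs_sub_abs_le_abs_sub (hF φ (q - p)) (hF θ (q - p))
  have k2 : σ / 8 * (|gF θ (q - p)| + T * σ) ≤ σ / 8 * (2 * (T * σ)) :=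
    mul_le_mul_of_nonneg_left (by linarith) (by positivity)
  have k3 : σ / 8 * (2 * (T * σ)) = 2 / 8 * (T * σ ^ 2) := by ring
  linarith

/-- angular separation -/
theorem ang_geom (A T σ w θ φ Δ : ℝ) (hA : 1000 ≤ A) (hT : 0 < T) (hσ : 0 < σ) (hσA : σ ≤ A ^ 2) (hΔ : 0 < Δ)
    (hw : w = σ / A ^ 2) (hθ : |φ - θ| ≤ w) (p q : Pt) (hp : 1 / 2 ≤ p.2.2)
    (h1 : ‖q - p‖ ≤ T) (h2 : |incF p θ q| ≤ Δ) (h3 : |incF p φ q| ≤ Δ)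
    (h4 : Δ = T * σ ^ 2 ∨ T * σ / A < |gF θ (q - p)|) : |φ - θ| ≤ A ^ 2 * Δ / (T * σ) := by
  have hA0 : 0 < A := by linarith
  have hTσ : 0 < T * σ := by positivity
  rcases h4 with h4 | h4
  · rw [h4]
    have e : A ^ 2 * (T * σ ^ 2) / (T * σ) = A ^ 2 * σ := by field_simp
    rw [e]
    refine hθ.trans ?_
    rw [hw]
    have : 1 ≤ A ^ 2 := one_le_pow₀ (by linarith)
    exact (div_le_self hσ.le this).trans (le_mul_of_one_le_left hσ.le this)
  · have hm : |(φ + θ) / 2 - θ| ≤ w := by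
      have e : (φ + θ) / 2 - θ = (φ - θ) / 2 := by ring
      rw [e, abs_div, abs_two]
      linarith [abs_nonneg (φ - θ)]
    obtain ⟨-, -, b⟩ := blk_pert A T σ w θ ((φ + θ) / 2) hA hT hσ hw hm _ h1
    have e : T * σ / (4 * A) = (T * σ / A) / 4 := by field_simp
    have b1 : T * σ / A / 2 ≤ |gF ((φ + θ) / 2) (q - p)| := by
      have := abs_sub_abs_le_abs_sub (gF θ (q - p)) (gF ((φ + θ) / 2) (q - p))
      rw [abs_sub_comm] at this
      have : 0 < T * σ / A := by positivity
      linarith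
    have hw1 : w ≤ 1 := by rw [hw]; exact (div_le_one (by positivity)).2 hσA
    have hs := Real.mul_abs_le_abs_sin (x := (φ - θ) / 2) (by
      rw [abs_div, abs_two]; linarith [Real.two_le_pi])
    rw [abs_div, abs_two] at hs
    have b8 : 1 / 2 ≤ 2 / Real.pi := by
      rw [div_le_div_iff₀ (by norm_num) Real.pi_pos]; linarith [Real.pi_le_four]
    have b9 : |φ - θ| / 4 ≤ |Real.sin ((φ - θ) / 2)| := by
      have := mul_le_mul_of_nonneg_right b8 (show 0 ≤ |φ - θ| / 2 by positivity)
      linarith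
    have hi := inc_mid p θ φ q
    have hi2 : |incF p φ q - incF p θ q| ≤ 2 * Δ := (abs_sub _ _).trans (by linarith)
    rw [hi, abs_mul, abs_mul, abs_mul, abs_of_nonneg (show 0 ≤ p.2.2 by linarith)] at hi2
    have n4 : |(-4:ℝ)| = 4 := by norm_num
    rw [n4] at hi2
    have c1 : 2 * (|φ - θ| / 4) * (T * σ / A / 2) ≤ 4 * p.2.2 * |Real.sin ((φ - θ) / 2)| * |gF ((φ + θ) / 2) (q - p)| := by
      refine mul_le_mul (mul_le_mul (by linarith) b9 (by positivity) (by linarith)) b1 (by positivity) ?_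
      exact mul_nonneg (by linarith) (abs_nonneg _)
    have c2 : |φ - θ| * (T * σ) ≤ 8 * A * Δ := by
      have c3 : 2 * (|φ - θ| / 4) * (T * σ / A / 2) = |φ - θ| * (T * σ) / (4 * A) := by field_simp
      rw [c3] at c1
      have := c1.trans hi2
      rw [div_le_iff₀ (by positivity)] at this
      linarith
    rw [le_div_iff₀ hTσ]
    have : 8 * A * Δ ≤ A ^ 2 * Δ := mul_le_mul_of_nonneg_right (by nlinarith) hΔ.le
    linarith
end
end

section
open Finset

noncomputable section

def ClR (A T σ Δ : ℝ) (p : Pt) (θ : ℝ) (q : Pt) : Prop :=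
  T / A < ‖q - p‖ ∧ ‖q - p‖ ≤ T ∧ |incF p θ q| ≤ Δ ∧ |gF θ (q - p)| ≤ T * σ ∧
    (Δ = T * σ ^ 2 ∨ T * σ / A < |gF θ (q - p)|)

theorem blk_eq (P : Finset Pt) (E : Pt → Finset ℝ) (w : ℝ) (y : Pt × ℤ) (hy : y.1 ∈ P) :
    ((P.sigma E).filter (fun x => (x.1, ⌊x.2 / w⌋) = y)).card = (blk E w y).card := by
  classical
  have : (P.sigma E).filter (fun x => (x.1, ⌊x.2 / w⌋) = y) = (blk E w y).image (fun θ => (⟨y.1, θ⟩ : Σ _ : Pt, ℝ)) := by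
    ext ⟨p, θ⟩
    unfold blk
    simp only [Finset.mem_filter, Finset.mem_sigma, Finset.mem_image, Sigma.mk.injEq, heq_eq_eq]
    constructor
    · rintro ⟨⟨h1, h2⟩, rfl⟩
      exact ⟨θ, ⟨h2, rfl⟩, rfl, rfl⟩
    · rintro ⟨θ', ⟨h1, h2⟩, rfl, rfl⟩
      exact ⟨⟨hy, h1⟩, by rw [h2]⟩
  rw [this, Finset.card_image_of_injective]
  intro a b h
  simpa using h

set_option maxHeartbeats 1600000 in
theorem light_blk {A δ s P E M L} (C : Cfg A δ s P E M L) (T σ w Δ D0 : ℝ) (hT : δ ≤ T) (hT1 : T ≤ 1)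
    (hσ : δ ≤ σ) (hσA : σ ≤ A ^ 2) (hΔ : δ ≤ Δ) (hΔ2 : Δ ≤ T * σ ^ 2) (hw : w = σ / A ^ 2) (hD0 : 0 < D0)
    (y : Pt × ℤ) (hy : y.1 ∈ P) (Th : Finset ℝ) (hTh : Th ⊆ blk E w y)
    (hB : ∀ θ ∈ Th, ∃ S ⊆ P, (∀ q ∈ S, ClR A T σ Δ y.1 θ q) ∧ D0 * A ^ 6 * (Δ / δ) ^ s ≤ S.card)
    (hl : (farF P A T σ (y.2 * w) y.1).card * (M * σ ^ s) ≤ ((blk E w y).card : ℝ) * (D0 * ((T / δ) ^ s * (σ ^ s) ^ 2))) :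
    (Th.card : ℝ) * A ^ 3 ≤ (blk E w y).card := by
  classical
  have hA := C.hA
  have hA0 : 0 < A := by linarith
  have hδ := C.hδ
  have hT0 : 0 < T := hδ.trans_le hT
  have hσ0 : 0 < σ := hδ.trans_le hσ
  have hΔ0 : 0 < Δ := hδ.trans_le hΔ
  have hw0 : 0 < w := by rw [hw]; positivity
  choose! S hSP hSR hSc using hB
  have hblk : ∀ θ ∈ Th, θ ∈ E y.1 ∧ y.2 * w ≤ θ ∧ θ < y.2 * w + w := by
    intro θ hθ
    have := hTh hθ
    unfold blk at this
    rw [Finset.mem_filter] at this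
    exact ⟨this.1, blk_mem w θ hw0 y.2 this.2⟩
  have hfar : ∀ θ ∈ Th, S θ ⊆ farF P A T σ (y.2 * w) y.1 := by
    intro θ hθ q hq
    rw [mem_farF]
    obtain ⟨r1, r2, r3, r4, -⟩ := hSR θ hθ q hq
    obtain ⟨-, b1, b2⟩ := hblk θ hθ
    refine ⟨hSP θ hθ hq, far_geom A T σ w θ _ Δ hA hT0 hT1 hσ0 hw ?_ _ _ (C.reg _ hy) (C.reg _ (hSP θ hθ hq)) r2 r3 hΔ2 r4, r1⟩
    rw [abs_le]; constructor <;> linarith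
  have hang : ∀ q ∈ farF P A T σ (y.2 * w) y.1,
      ((Th.filter (fun θ => q ∈ S θ)).card : ℝ) ≤ A ^ 3 * M * (Δ / (T * σ)) ^ s := by
    intro q _
    rcases (Th.filter (fun θ => q ∈ S θ)).eq_empty_or_nonempty with h | ⟨θ0, h0⟩
    · rw [h, Finset.card_empty, Nat.cast_zero]; positivity
    · rw [Finset.mem_filter] at h0
      have k1 := C.frE y.1 hy (Th.filter (fun θ => q ∈ S θ)) (fun θ hθ => (hblk θ (Finset.mem_filter.1 hθ).1).1) θ0
        (A ^ 2 * Δ / (T * σ)) (by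
          rw [le_div_iff₀ (by positivity)]
          have i1 : T * σ ≤ 1 * A ^ 2 := mul_le_mul hT1 hσA hσ0.le (by norm_num)
          have i2 := mul_le_mul hΔ i1 (by positivity) hΔ0.le
          linarith) (fun θ hθ => by
          rw [Finset.mem_filter] at hθ
          obtain ⟨r1, r2, r3, r4, r5⟩ := hSR θ0 h0.1 q h0.2
          obtain ⟨s1, s2, s3, s4, s5⟩ := hSR θ hθ.1 q hθ.2
          obtain ⟨-, b1, b2⟩ := hblk θ0 h0.1
          obtain ⟨-, b3, b4⟩ := hblk θ hθ.1
          exact ang_geom A T σ w θ0 θ Δ hA hT0 hσ0 hσA hΔ0 hw (by rw [abs_le]; constructor <;> linarith) y.1 q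
            (C.reg _ hy).2.1 r2 r3 s3 r5)
      refine k1.trans ?_
      have e : A ^ 2 * Δ / (T * σ) = A ^ 2 * (Δ / (T * σ)) := by ring
      rw [e, Real.mul_rpow (by positivity) (by positivity)]
      have h2 : (A ^ 2) ^ s ≤ A ^ 2 := by
        have := Real.rpow_le_rpow_of_exponent_le (show (1:ℝ) ≤ A ^ 2 from one_le_pow₀ (by linarith)) C.hs1
        rwa [Real.rpow_one] at this
      have h3 : (A * M * (Δ / (T * σ)) ^ s) * (A ^ 2) ^ s ≤ (A * M * (Δ / (T * σ)) ^ s) * A ^ 2 :=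
        mul_le_mul_of_nonneg_left h2 (by positivity)
      linarith
  -- double count
  have hdc : ∑ θ ∈ Th, ((S θ).card : ℝ) = ∑ q ∈ farF P A T σ (y.2 * w) y.1, ((Th.filter (fun θ => q ∈ S θ)).card : ℝ) := by
    have h1 : ∀ θ ∈ Th, ((S θ).card : ℝ) = ∑ q ∈ farF P A T σ (y.2 * w) y.1, if q ∈ S θ then (1:ℝ) else 0 := by
      intro θ hθ
      rw [← Finset.sum_filter, Finset.filter_mem_eq_inter, Finset.inter_eq_right.2 (hfar θ hθ)]
      simp
    rw [Finset.sum_congr rfl h1, Finset.sum_comm]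
    refine Finset.sum_congr rfl (fun q _ => ?_)
    rw [← Finset.sum_filter]; simp
  have u1 : (Th.card : ℝ) * (D0 * A ^ 6 * (Δ / δ) ^ s) ≤ ∑ θ ∈ Th, ((S θ).card : ℝ) := by
    have := Finset.sum_le_sum (fun θ hθ => hSc θ hθ)
    simpa using this
  have u2 := Finset.sum_le_sum hang
  rw [Finset.sum_const, nsmul_eq_mul] at u2
  rw [hdc] at u1
  have u3 := u1.trans u2
  have e1 : (T / δ) ^ s = T ^ s / δ ^ s := Real.div_rpow hT0.le hδ.le s
  have e2 : (Δ / δ) ^ s = Δ ^ s / δ ^ s := Real.div_rpow hΔ0.le hδ.le s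
  have e3 : (Δ / (T * σ)) ^ s = Δ ^ s / (T ^ s * σ ^ s) := by
    rw [Real.div_rpow hΔ0.le (by positivity), Real.mul_rpow hT0.le hσ0.le]
  rw [e1] at hl
  rw [e2, e3] at u3
  have p1 : 0 < T ^ s := by positivity
  have p2 : 0 < δ ^ s := by positivity
  have p3 : 0 < Δ ^ s := by positivity
  have p4 : 0 < σ ^ s := by positivity
  generalize T ^ s = t at *
  generalize δ ^ s = d at *
  generalize Δ ^ s = D at *
  generalize σ ^ s = τ at *
  generalize ((farF P A T σ (y.2 * w) y.1).card : ℝ) = f at *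
  generalize ((blk E w y).card : ℝ) = e at *
  generalize (Th.card : ℝ) = h at *
  have v1 : h * (D0 * A ^ 6 * (D / d)) ≤ (f * (M * τ)) * (A ^ 3 * (D / (t * τ ^ 2))) := by
    refine u3.trans (le_of_eq ?_)
    field_simp
  have v2 := v1.trans (mul_le_mul_of_nonneg_right hl (by positivity))
  have v3 : e * (D0 * (t / d * τ ^ 2)) * (A ^ 3 * (D / (t * τ ^ 2))) = e * (D0 * A ^ 3 * (D / d)) := by
    field_simp
  rw [v3] at v2
  have v4 : (h * A ^ 3) * (D0 * A ^ 3 * (D / d)) ≤ e * (D0 * A ^ 3 * (D / d)) := by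
    refine le_trans (le_of_eq ?_) v2
    ring
  exact le_of_mul_le_mul_right v4 (by positivity)

set_option maxHeartbeats 1600000 in
theorem step1 {A δ s P E M L} (C : Cfg A δ s P E M L) (T σ w Δ D0 D1 : ℝ) (hT : δ ≤ T) (hT1 : T ≤ 1)
    (hσ : δ ≤ σ) (hσA : σ ≤ A ^ 2) (hΔ : δ ≤ Δ) (hΔ2 : Δ ≤ T * σ ^ 2) (hw : w = σ / A ^ 2)
    (hD0 : A ^ 34 ≤ D0) (hD1 : A ^ 34 * D1 ≤ D0 ^ 2) (hD1' : 0 ≤ D1)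
    (Gs Bd : Finset (Σ _ : Pt, ℝ)) (hGs : Gs ⊆ P.sigma E) (hBG : Bd ⊆ Gs)
    (hnear : ∀ x ∈ Gs, ∀ S ⊆ P, (∀ q ∈ S, ‖q - x.1‖ ≤ T / A ∧ |incF x.1 x.2 q| ≤ A * (T * σ ^ 2)) →
      (S.card : ℝ) ≤ D1 * ((T / δ) ^ s * (σ ^ s) ^ 2))
    (hBd : ∀ x ∈ Bd, ∃ S ⊆ P, (∀ q ∈ S, ClR A T σ Δ x.1 x.2 q) ∧ D0 * A ^ 6 * (Δ / δ) ^ s ≤ S.card) :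
    (Bd.card : ℝ) * A ^ 2 ≤ 2 * (P.card * M) := by
  classical
  have hA := C.hA
  have hA0 : 0 < A := by linarith
  have hδ := C.hδ
  have hT0 : 0 < T := hδ.trans_le hT
  have hσ0 : 0 < σ := hδ.trans_le hσ
  have hw0 : 0 < w := by rw [hw]; positivity
  have hD00 : 0 < D0 := lt_of_lt_of_le (by positivity) hD0
  obtain ⟨β, hβ⟩ : ∃ β : (Σ _ : Pt, ℝ) → Pt × ℤ, β = fun x => (x.1, ⌊x.2 / w⌋) := ⟨_, rfl⟩
  have hBO : ∀ x ∈ Bd, x.1 ∈ P ∧ x.2 ∈ E x.1 := fun x hx => by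
    have := hGs (hBG hx)
    rwa [Finset.mem_sigma] at this
  have hUP : ∀ y ∈ Bd.image β, y.1 ∈ P := by
    intro y hy
    rw [Finset.mem_image] at hy
    obtain ⟨x, hx, rfl⟩ := hy
    rw [hβ]; exact (hBO x hx).1
  have hbe : ∀ y ∈ Bd.image β, ((P.sigma E).filter (fun x => β x = y)).card = (blk E w y).card := by
    intro y hy; rw [hβ]; exact blk_eq P E w y (hUP y hy)
  obtain ⟨hv, hhv⟩ : ∃ hv : Pt × ℤ → Prop, hv = fun y => ((blk E w y).card : ℝ) * (D0 * ((T / δ) ^ s * (σ ^ s) ^ 2)) ≤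
      (farF P A T σ (y.2 * w) y.1).card * (M * σ ^ s) := ⟨_, rfl⟩
  -- heavy
  have hheavy : (∑ y ∈ (Bd.image β).filter hv, ((blk E w y).card : ℝ)) * A ^ 2 ≤ P.card * M := by
    have g1 : ∀ y ∈ (Bd.image β).filter hv, y.1 ∈ P := fun y hy => hUP y (Finset.mem_filter.1 hy).1
    have gx : ∀ y ∈ (Bd.image β).filter hv, ∃ x ∈ Bd, β x = y := fun y hy => by
      have := (Finset.mem_filter.1 hy).1
      rwa [Finset.mem_image] at this
    have g2 : ∀ y ∈ (Bd.image β).filter hv, 0 < (blk E w y).card := fun y hy => by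
      obtain ⟨x, hx, rfl⟩ := gx y hy
      rw [Finset.card_pos]
      refine ⟨x.2, ?_⟩
      rw [hβ]; unfold blk
      rw [Finset.mem_filter]
      exact ⟨(hBO x hx).2, rfl⟩
    have g3 : ∀ y ∈ (Bd.image β).filter hv, ((blk E w y).card : ℝ) * (D0 * ((T / δ) ^ s * (σ ^ s) ^ 2)) ≤
      (farF P A T σ (y.2 * w) y.1).card * (M * σ ^ s) := fun y hy => by
      have := (Finset.mem_filter.1 hy).2
      rw [hhv] at this; exact this
    rcases le_total (σ * A ^ 4) 1 with h | h
    · refine tang_main C T σ w D0 D1 hT hσ hw h hD0 hD1 hD1' _ g1 g2 ?_ g3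
      intro y hy
      obtain ⟨x, hx, rfl⟩ := gx y hy
      refine hnear x (hBG hx) _ (fun q hq => ((mem_nearF _ _ _ _ _ _ _).1 hq).1) ?_
      intro q hq
      rw [mem_nearF] at hq
      rw [hβ] at hq
      refine ⟨hq.2.2, near_geom A T σ w _ x.2 hA hT0 hT1 hσ0 hw ?_ x.1 q (C.reg _ (hBO x hx).1) (C.reg _ hq.1) hq.2.1⟩
      obtain ⟨b1, b2⟩ := blk_mem w x.2 hw0 _ rfl
      simp only
      rw [abs_le]; constructor <;> linarith
    · exact tang_triv C T σ w D0 hT hσ0 hw h hD0 _ g1 g2 g3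
  have hlight : ∀ y ∈ (Bd.image β).filter (fun y => ¬ hv y),
      ((Bd.filter (fun x => β x = y)).card : ℝ) * A ^ 3 ≤ (blk E w y).card := by
    intro y hy
    obtain ⟨hy1, hy2⟩ := Finset.mem_filter.1 hy
    rw [hhv, not_le] at hy2
    have hm : ∀ x ∈ Bd.filter (fun x => β x = y), x ∈ Bd ∧ x.1 = y.1 ∧ ⌊x.2 / w⌋ = y.2 := by
      intro x hx
      rw [Finset.mem_filter, hβ] at hx
      obtain ⟨h1, h2⟩ := hx
      exact ⟨h1, congrArg Prod.fst h2, congrArg Prod.snd h2⟩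
    have := light_blk C T σ w Δ D0 hT hT1 hσ hσA hΔ hΔ2 hw hD00 y (hUP y hy1)
      ((Bd.filter (fun x => β x = y)).image (fun x => x.2)) ?_ ?_ hy2.le
    · rwa [Finset.card_image_of_injOn] at this
      intro a ha b hb hab
      obtain ⟨-, a1, -⟩ := hm a (by exact_mod_cast ha)
      obtain ⟨-, b1, -⟩ := hm b (by exact_mod_cast hb)
      exact Sigma.ext (a1.trans b1.symm) (heq_of_eq hab)
    · intro θ hθ
      rw [Finset.mem_image] at hθ
      obtain ⟨x, hx, rfl⟩ := hθ
      obtain ⟨a1, a2, a3⟩ := hm x hx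
      unfold blk
      rw [Finset.mem_filter, ← a2]
      exact ⟨(hBO x a1).2, a3⟩
    · intro θ hθ
      rw [Finset.mem_image] at hθ
      obtain ⟨x, hx, rfl⟩ := hθ
      obtain ⟨a1, a2, a3⟩ := hm x hx
      rw [← a2]
      exact hBd x a1
  have hsub : ∀ y ∈ (Bd.image β).filter hv, ((Bd.filter (fun x => β x = y)).card : ℝ) ≤ (blk E w y).card := by
    intro y hy
    rw [← hbe y (Finset.mem_filter.1 hy).1]
    exact_mod_cast Finset.card_le_card (Finset.filter_subset_filter _ (hBG.trans hGs))
  have hlt : ∑ y ∈ (Bd.image β).filter (fun y => ¬ hv y), ((blk E w y).card : ℝ) ≤ P.card * M := by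
    have h1 : ∑ y ∈ (Bd.image β).filter (fun y => ¬ hv y), (blk E w y).card ≤ (P.sigma E).card := by
      rw [← Finset.sum_congr rfl (fun y hy => hbe y (Finset.mem_filter.1 hy).1)]
      have := Finset.card_eq_sum_card_fiberwise (s := (P.sigma E).filter (fun x => β x ∈ (Bd.image β).filter (fun y => ¬ hv y)))
        (t := (Bd.image β).filter (fun y => ¬ hv y)) (f := β) (fun x hx => by
          have hx' : x ∈ (P.sigma E).filter (fun x => β x ∈ (Bd.image β).filter (fun y => ¬ hv y)) := hx
          exact (Finset.mem_filter.1 hx').2)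
      refine le_trans (le_of_eq ?_) ((le_of_eq this.symm).trans (Finset.card_filter_le _ _))
      refine Finset.sum_congr rfl (fun y hy => ?_)
      congr 1
      ext x
      simp only [Finset.mem_filter]
      constructor
      · rintro ⟨a, rfl⟩; exact ⟨⟨a, Finset.mem_filter.1 hy⟩, rfl⟩
      · rintro ⟨⟨a, -⟩, b⟩; exact ⟨a, b⟩
    rw [Finset.card_sigma, Finset.sum_congr rfl C.hE, Finset.sum_const, smul_eq_mul] at h1
    exact_mod_cast h1
  have htot : (Bd.card : ℝ) = ∑ y ∈ (Bd.image β).filter hv, ((Bd.filter (fun x => β x = y)).card : ℝ) +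
      ∑ y ∈ (Bd.image β).filter (fun y => ¬ hv y), ((Bd.filter (fun x => β x = y)).card : ℝ) := by
    rw [Finset.sum_filter_add_sum_filter_not]
    have := Finset.card_eq_sum_card_image β Bd
    exact_mod_cast this
  have l1 := Finset.sum_le_sum hsub
  have l2 := Finset.sum_le_sum hlight
  rw [← Finset.sum_mul] at l2
  have l3 : ∑ y ∈ (Bd.image β).filter (fun y => ¬ hv y), ((Bd.filter (fun x => β x = y)).card : ℝ) * A ^ 2 ≤ P.card * M := by
    rw [← Finset.sum_mul]
    refine le_trans ?_ (l2.trans hlt)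
    exact mul_le_mul_of_nonneg_left (pow_le_pow_right₀ (by linarith) (by norm_num))
      (Finset.sum_nonneg (fun _ _ => Nat.cast_nonneg _))
  rw [← Finset.sum_mul] at l3
  have l4 := (mul_le_mul_of_nonneg_right l1 (show 0 ≤ A ^ 2 by positivity)).trans hheavy
  rw [htot, add_mul]
  linarith
end
end

section
open Finset

noncomputable section

theorem g_le (θ : ℝ) (u : Pt) : |gF θ u| ≤ 2 * ‖u‖ := by
  obtain ⟨h1, h2, -⟩ := nrm_coord u
  unfold gF
  refine (abs_add_le _ _).trans ?_
  rw [abs_mul, abs_mul, abs_neg]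
  have a1 := mul_le_mul h1 (Real.abs_sin_le_one θ) (abs_nonneg _) (norm_nonneg u)
  have a2 := mul_le_mul h2 (Real.abs_cos_le_one θ) (abs_nonneg _) (norm_nonneg u)
  linarith

def GoodAt (A δ s : ℝ) (P : Finset Pt) (k : ℕ) (D : ℝ) (x : Σ _ : Pt, ℝ) : Prop :=
  ∀ i : ℕ, ∀ S ⊆ P, (∀ q ∈ S, ‖q - x.1‖ ≤ δ * A ^ k ∧ |incF x.1 x.2 q| ≤ δ * A ^ i) → (S.card : ℝ) ≤ D * (A ^ i) ^ s

def sg (A : ℝ) (k l : ℕ) : ℝ := Real.sqrt A ^ l / Real.sqrt A ^ (k + 1)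

theorem sg_sq (A δ : ℝ) (hA : 1000 ≤ A) (k l : ℕ) : (δ * A ^ (k + 1)) * sg A k l ^ 2 = δ * A ^ l := by
  have h : Real.sqrt A ^ 2 = A := Real.sq_sqrt (by linarith)
  have h0 : 0 < A := by linarith
  unfold sg
  rw [div_pow, ← pow_mul, ← pow_mul, mul_comm l, mul_comm (k + 1), pow_mul, pow_mul, h]
  field_simp

set_option maxHeartbeats 1600000 in
theorem ind_step {A δ s P E M L} (C : Cfg A δ s P E M L) (K : ℕ) (hδK : δ * A ^ K = 1) (k : ℕ) (hk : k + 1 ≤ K)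
    (D : ℝ) (hD : 0 ≤ D) (hDA : D ≤ A ^ 51) (Gs : Finset (Σ _ : Pt, ℝ)) (hGs : Gs ⊆ P.sigma E)
    (hG : ∀ x ∈ Gs, GoodAt A δ s P k D x) :
    ∃ Gs' ⊆ Gs, ((Gs.card : ℝ) - Gs'.card) * A ^ 2 ≤ (K + 2) ^ 2 * (2 * (P.card * M)) ∧
      ∀ x ∈ Gs', GoodAt A δ s P (k + 1) (A + D + (K + 2) * A ^ 49) x := by
  classical
  have hA := C.hA
  have hA0 : 0 < A := by linarith
  have hA1 : 1 ≤ A := by linarith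
  have hδ := C.hδ
  have hB : Real.sqrt A ^ 2 = A := Real.sq_sqrt (by linarith)
  have hB1 : 1 ≤ Real.sqrt A := by rw [Real.one_le_sqrt]; exact hA1
  have hB0 : 0 < Real.sqrt A := by linarith
  have hBA : Real.sqrt A ≤ A := by nlinarith
  have hB2 : 2 ≤ Real.sqrt A := Real.le_sqrt_of_sq_le (by linarith)
  obtain ⟨T, hTe⟩ : ∃ T, T = δ * A ^ (k + 1) := ⟨_, rfl⟩
  have hTA : T / A = δ * A ^ k := by rw [hTe, pow_succ]; field_simp
  have hTδ : δ ≤ T := by rw [hTe]; exact le_mul_of_one_le_right hδ.le (one_le_pow₀ hA1)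
  have hT0 : 0 < T := hδ.trans_le hTδ
  have hT1 : T ≤ 1 := by
    rw [hTe, ← hδK]; exact mul_le_mul_of_nonneg_left (pow_le_pow_right₀ hA1 hk) hδ.le
  have hsq : ∀ l, T * sg A k l ^ 2 = δ * A ^ l := fun l => by rw [hTe]; exact sg_sq A δ hA k l
  have hs0 : ∀ l, 0 < sg A k l := fun l => by unfold sg; positivity
  have hsδ : ∀ l, δ ≤ sg A k l := fun l => by
    have h1 : 1 / A ^ K ≤ sg A k l := by
      unfold sg
      refine div_le_div₀ (by positivity) (one_le_pow₀ hB1) (by positivity) ?_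
      exact (pow_le_pow_left₀ hB0.le hBA _).trans (pow_le_pow_right₀ hA1 hk)
    have : δ = 1 / A ^ K := by rw [eq_div_iff (by positivity)]; exact hδK
    rw [this]; exact h1
  have hsA : ∀ l, l ≤ k + 2 → sg A k l ≤ A ^ 2 := fun l hl => by
    unfold sg
    rw [div_le_iff₀ (by positivity)]
    have h1 : Real.sqrt A ^ l ≤ Real.sqrt A ^ (k + 2) := pow_le_pow_right₀ hB1 hl
    have h2 : Real.sqrt A ^ (k + 2) = Real.sqrt A * Real.sqrt A ^ (k + 1) := by ring
    rw [h2] at h1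
    refine h1.trans (mul_le_mul_of_nonneg_right ?_ (by positivity))
    nlinarith
  have hpw : ∀ l : ℕ, (T / δ) ^ s * (sg A k l ^ s) ^ 2 = (A ^ l) ^ s := fun l => by
    have e1 : (sg A k l ^ s) ^ 2 = (sg A k l ^ 2) ^ s := by
      rw [pow_two, pow_two, Real.mul_rpow (hs0 l).le (hs0 l).le]
    rw [e1, ← Real.mul_rpow (by positivity) (by positivity)]
    congr 1
    rw [div_mul_eq_mul_div, hsq, mul_div_assoc, mul_div_cancel₀]
    exact hδ.ne'
  obtain ⟨Bd, hBd⟩ : ∃ Bd : ℕ × ℕ → Finset (Σ _ : Pt, ℝ), Bd = fun y => Gs.filter (fun x =>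
    ∃ S ⊆ P, (∀ q ∈ S, ClR A T (sg A k y.2) (δ * A ^ y.1) x.1 x.2 q) ∧ A ^ 43 * A ^ 6 * (δ * A ^ y.1 / δ) ^ s ≤ S.card) :=
    ⟨_, rfl⟩
  obtain ⟨Y, hY⟩ : ∃ Y : Finset (ℕ × ℕ), Y = (Finset.range (k + 2) ×ˢ Finset.range (k + 3)).filter (fun y => y.1 ≤ y.2) := ⟨_, rfl⟩
  have hYm : ∀ y, y ∈ Y ↔ (y.1 < k + 2 ∧ y.2 < k + 3) ∧ y.1 ≤ y.2 := fun y => by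
    rw [hY, Finset.mem_filter, Finset.mem_product, Finset.mem_range, Finset.mem_range]
  have hYc : (Y.card : ℝ) ≤ (K + 2) ^ 2 := by
    have h1 : Y.card ≤ (k + 2) * (k + 3) := by
      rw [hY]; refine (Finset.card_filter_le _ _).trans (le_of_eq ?_)
      rw [Finset.card_product, Finset.card_range, Finset.card_range]
    have h2 : (k + 2) * (k + 3) ≤ (K + 2) ^ 2 := by
      rw [pow_two]; exact Nat.mul_le_mul (by omega) (by omega)
    exact_mod_cast h1.trans h2
  have hBdc : ∀ y ∈ Y, ((Bd y).card : ℝ) * A ^ 2 ≤ 2 * (P.card * M) := by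
    intro y hy
    rw [hYm] at hy
    refine step1 C T (sg A k y.2) _ (δ * A ^ y.1) (A ^ 43) (A * D) hTδ hT1 (hsδ _) (hsA _ (by omega))
      (le_mul_of_one_le_right hδ.le (one_le_pow₀ hA1)) ?_ rfl (pow_le_pow_right₀ hA1 (by norm_num)) ?_ (by positivity)
      Gs (Bd y) hGs ?_ ?_ ?_
    · rw [hsq]; exact mul_le_mul_of_nonneg_left (pow_le_pow_right₀ hA1 hy.2) hδ.le
    · calc A ^ 34 * (A * D) ≤ A ^ 34 * (A * A ^ 51) :=
            mul_le_mul_of_nonneg_left (mul_le_mul_of_nonneg_left hDA hA0.le) (by positivity)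
        _ = (A ^ 43) ^ 2 := by ring
    · rw [hBd]; exact Finset.filter_subset _ _
    · intro x hx S hS hSq
      rw [hpw]
      have := hG x hx (y.2 + 1) S hS (fun q hq => by
        obtain ⟨a, b⟩ := hSq q hq
        rw [hTA] at a
        rw [hsq] at b
        refine ⟨a, b.trans (le_of_eq (by ring))⟩)
      rw [pow_succ, Real.mul_rpow (by positivity) hA0.le] at this
      have h2 : A ^ s ≤ A := by
        have := Real.rpow_le_rpow_of_exponent_le hA1 C.hs1
        rwa [Real.rpow_one] at this
      have h3 : D * (A ^ y.2) ^ s * A ^ s ≤ D * (A ^ y.2) ^ s * A := mul_le_mul_of_nonneg_left h2 (by positivity)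
      linarith
    · intro x hx
      rw [hBd] at hx
      exact (Finset.mem_filter.1 hx).2
  refine ⟨Gs \ Y.biUnion Bd, Finset.sdiff_subset, ?_, ?_⟩
  · have h1 : Gs.card ≤ (Gs \ Y.biUnion Bd).card + ∑ y ∈ Y, (Bd y).card := by
      have := Finset.card_le_card_sdiff_add_card (s := Gs) (t := Y.biUnion Bd)
      exact this.trans (Nat.add_le_add_left Finset.card_biUnion_le _)
    have h2 : (Gs.card : ℝ) ≤ (Gs \ Y.biUnion Bd).card + ∑ y ∈ Y, ((Bd y).card : ℝ) := by exact_mod_cast h1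
    have h3 := Finset.sum_le_sum hBdc
    rw [← Finset.sum_mul, Finset.sum_const, nsmul_eq_mul] at h3
    have h4 : (Y.card : ℝ) * (2 * (P.card * M)) ≤ (K + 2) ^ 2 * (2 * (P.card * M)) :=
      mul_le_mul_of_nonneg_right hYc (by positivity)
    have h5 := mul_le_mul_of_nonneg_right (show (Gs.card : ℝ) - (Gs \ Y.biUnion Bd).card ≤ ∑ y ∈ Y, ((Bd y).card : ℝ) by linarith)
      (show 0 ≤ A ^ 2 by positivity)
    linarith
  · intro x hx i S hS hSq
    rw [Finset.mem_sdiff] at hx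
    obtain ⟨hxG, hxB⟩ := hx
    have hAi : 0 < (A ^ i) ^ s := by positivity
    rcases Nat.lt_or_ge (k + 1) i with hi | hi
    · have h1 := C.frP S hS x.1 T hTδ (fun q hq => by rw [hTe]; exact (hSq q hq).1)
      have e : T / δ = A ^ (k + 1) := by rw [hTe]; field_simp
      rw [e] at h1
      have h2 : (A ^ (k + 1)) ^ s ≤ (A ^ i) ^ s :=
        Real.rpow_le_rpow (by positivity) (pow_le_pow_right₀ hA1 hi.le) C.hs.le
      have h3 : A * (A ^ (k + 1)) ^ s ≤ A * (A ^ i) ^ s := mul_le_mul_of_nonneg_left h2 hA0.le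
      have h4 : A * (A ^ i) ^ s ≤ (A + D + (K + 2) * A ^ 49) * (A ^ i) ^ s := by
        refine mul_le_mul_of_nonneg_right ?_ hAi.le
        have : 0 ≤ (K + 2) * A ^ 49 := by positivity
        linarith
      linarith
    · obtain ⟨Sl, hSl⟩ : ∃ Sl : ℕ → Finset Pt, Sl = fun l => S.filter (fun q => ClR A T (sg A k l) (δ * A ^ i) x.1 x.2 q) := ⟨_, rfl⟩
      have hcov : S ⊆ S.filter (fun q => ‖q - x.1‖ ≤ δ * A ^ k) ∪ ((Finset.range (k + 3)).filter (fun l => i ≤ l)).biUnion Sl := by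
        intro q hq
        rw [Finset.mem_union]
        rcases le_or_gt ‖q - x.1‖ (δ * A ^ k) with h | h
        · left; rw [Finset.mem_filter]; exact ⟨hq, h⟩
        · right
          obtain ⟨a1, a2⟩ := hSq q hq
          have hex : ∃ l, i ≤ l ∧ |gF x.2 (q - x.1)| ≤ T * sg A k l := by
            refine ⟨k + 2, by omega, ?_⟩
            refine (g_le _ _).trans ?_
            have e : sg A k (k + 2) = Real.sqrt A := by
              unfold sg; rw [pow_succ _ (k + 1)]; field_simp
            rw [e]
            rw [← hTe] at a1
            have := mul_le_mul_of_nonneg_left hB2 hT0.le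
            linarith
          have hl1 := (Nat.find_spec hex)
          have hl2 : Nat.find hex ≤ k + 2 := by
            apply Nat.find_min'
            refine ⟨by omega, ?_⟩
            refine (g_le _ _).trans ?_
            have e : sg A k (k + 2) = Real.sqrt A := by
              unfold sg; rw [pow_succ _ (k + 1)]; field_simp
            rw [e]
            rw [← hTe] at a1
            have := mul_le_mul_of_nonneg_left hB2 hT0.le
            linarith
          have hl3 : ∀ m, m < Nat.find hex → ¬ (i ≤ m ∧ |gF x.2 (q - x.1)| ≤ T * sg A k m) := fun m hm => Nat.find_min hex hm
          generalize Nat.find hex = l at *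
          rw [Finset.mem_biUnion]
          refine ⟨l, ?_, ?_⟩
          · rw [Finset.mem_filter, Finset.mem_range]; exact ⟨by omega, hl1.1⟩
          · rw [hSl, Finset.mem_filter]
            refine ⟨hq, by rw [hTA]; exact h, by rw [hTe]; exact a1, a2, hl1.2, ?_⟩
            rcases Nat.eq_or_lt_of_le hl1.1 with h5 | h5
            · left; rw [hsq, h5]
            · right
              obtain ⟨m, rfl⟩ : ∃ m, l = m + 1 := ⟨l - 1, by omega⟩
              have h6 := hl3 m (by omega)
              have h7 : T * sg A k m < |gF x.2 (q - x.1)| := by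
                by_contra hcon
                exact h6 ⟨by omega, not_lt.1 hcon⟩
              refine lt_of_le_of_lt ?_ h7
              have e : sg A k (m + 1) = sg A k m * Real.sqrt A := by unfold sg; rw [pow_succ]; ring
              rw [e, div_le_iff₀ hA0]
              have := mul_le_mul_of_nonneg_left hBA (mul_nonneg hT0.le (hs0 m).le)
              linarith
      have hnr : ((S.filter (fun q => ‖q - x.1‖ ≤ δ * A ^ k)).card : ℝ) ≤ D * (A ^ i) ^ s := by
        refine hG x hxG i _ ((Finset.filter_subset _ _).trans hS) (fun q hq => ?_)
        rw [Finset.mem_filter] at hq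
        exact ⟨hq.2, (hSq q hq.1).2⟩
      have hcl : ∀ l ∈ (Finset.range (k + 3)).filter (fun l => i ≤ l), ((Sl l).card : ℝ) ≤ A ^ 49 * (A ^ i) ^ s := by
        intro l hl
        rw [Finset.mem_filter, Finset.mem_range] at hl
        by_contra hcon
        rw [not_le] at hcon
        apply hxB
        rw [Finset.mem_biUnion]
        refine ⟨(i, l), (hYm _).2 ⟨⟨by simp only; omega, hl.1⟩, hl.2⟩, ?_⟩
        rw [hBd, Finset.mem_filter]
        refine ⟨hxG, Sl l, ?_, ?_, ?_⟩
        · rw [hSl]; exact (Finset.filter_subset _ _).trans hS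
        · intro q hq
          rw [hSl, Finset.mem_filter] at hq
          exact hq.2
        · have e : δ * A ^ i / δ = A ^ i := by field_simp
          simp only
          rw [e, ← pow_add]
          exact hcon.le
      have h1 : (S.card : ℝ) ≤ (S.filter (fun q => ‖q - x.1‖ ≤ δ * A ^ k)).card +
          ∑ l ∈ (Finset.range (k + 3)).filter (fun l => i ≤ l), ((Sl l).card : ℝ) := by
        have := (Finset.card_le_card hcov).trans ((Finset.card_union_le _ _).trans (Nat.add_le_add_left Finset.card_biUnion_le _))
        exact_mod_cast this
      have h2 := Finset.sum_le_sum hcl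
      rw [Finset.sum_const, nsmul_eq_mul] at h2
      have h3 : ((((Finset.range (k + 3)).filter (fun l => i ≤ l)).card : ℕ) : ℝ) ≤ K + 2 := by
        have : ((Finset.range (k + 3)).filter (fun l => i ≤ l)).card ≤ K + 2 := by
          refine (Finset.card_filter_le _ _).trans ?_
          rw [Finset.card_range]; omega
        exact_mod_cast this
      have h4 := mul_le_mul_of_nonneg_right h3 (show 0 ≤ A ^ 49 * (A ^ i) ^ s by positivity)
      have h5 : 0 ≤ A * (A ^ i) ^ s := by positivity
      linarith

theorem quarter {a b : ℝ} (h : a ^ 2 + b ^ 2 ≤ 1 / 16) : |a| ≤ 1 / 4 ∧ |b| ≤ 1 / 4 :=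
  ⟨abs_le_of_sq_le_sq (by nlinarith [sq_nonneg b]) (by norm_num), abs_le_of_sq_le_sq (by nlinarith [sq_nonneg a]) (by norm_num)⟩

theorem main_ind {A δ s P E M L} (C : Cfg A δ s P E M L) (K : ℕ) (hδK : δ * A ^ K = 1)
    (hKA : 4 * ((K:ℝ) + 2) ^ 3 ≤ A) :
    ∃ Gs ⊆ P.sigma E, ((P.sigma E).card : ℝ) ≤ 2 * Gs.card ∧
      ∀ x ∈ Gs, ∀ i : ℕ, ∀ S ⊆ P, (∀ q ∈ S, |incF x.1 x.2 q| ≤ δ * A ^ i) → (S.card : ℝ) ≤ A ^ 51 * (A ^ i) ^ s := by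
  classical
  have hA := C.hA
  have hA0 : 0 < A := by linarith
  have hA1 : 1 ≤ A := by linarith
  have hδ := C.hδ
  have hK0 : (0:ℝ) ≤ K := Nat.cast_nonneg _
  have hDb : ∀ k : ℕ, k ≤ K → A + k * (A + (K + 2) * A ^ 49) ≤ A ^ 51 := by
    intro k hk
    have hk' : (k:ℝ) ≤ K := by exact_mod_cast hk
    have h1 : A ≤ A ^ 49 := by
      have := pow_le_pow_right₀ hA1 (show 1 ≤ 49 by norm_num)
      rwa [pow_one] at this
    have h2 : (k:ℝ) * (A + (K + 2) * A ^ 49) ≤ K * ((K + 3) * A ^ 49) :=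
      mul_le_mul hk' (by linarith) (by positivity) hK0
    have h3 : (1 + (K:ℝ) * (K + 3)) ≤ A := by nlinarith [mul_nonneg hK0 hK0, mul_nonneg (mul_nonneg hK0 hK0) hK0]
    have h4 := mul_le_mul_of_nonneg_right h3 (show 0 ≤ A ^ 49 by positivity)
    have h5 : A * A ^ 49 ≤ A ^ 51 := by rw [← pow_succ']; exact pow_le_pow_right₀ hA1 (by norm_num)
    linarith
  have hind : ∀ k : ℕ, k ≤ K → ∃ Gs ⊆ P.sigma E, (((P.sigma E).card : ℝ) - Gs.card) * A ^ 2 ≤ k * ((K + 2) ^ 2 * (2 * (P.card * M))) ∧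
      ∀ x ∈ Gs, GoodAt A δ s P k (A + k * (A + (K + 2) * A ^ 49)) x := by
    intro k
    induction k with
    | zero =>
      intro _
      refine ⟨P.sigma E, Finset.Subset.refl _, by simp, ?_⟩
      intro x hx i S hS hSq
      have h1 := C.frP S hS x.1 δ le_rfl (fun q hq => by simpa using (hSq q hq).1)
      rw [div_self hδ.ne', Real.one_rpow] at h1
      have h2 : 1 ≤ (A ^ i) ^ s := Real.one_le_rpow (one_le_pow₀ hA1) C.hs.le
      have h3 := mul_le_mul_of_nonneg_left h2 hA0.le
      simp only [Nat.cast_zero, zero_mul, add_zero]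
      linarith
    | succ k ih =>
      intro hk
      obtain ⟨Gs, h1, h2, h3⟩ := ih (by omega)
      obtain ⟨Gs', g1, g2, g3⟩ := ind_step C K hδK k hk _ (by positivity) (hDb k (by omega)) Gs h1 h3
      refine ⟨Gs', g1.trans h1, ?_, ?_⟩
      · push_cast
        linarith
      · intro x hx
        have := g3 x hx
        have e : A + (A + k * (A + (K + 2) * A ^ 49)) + (K + 2) * A ^ 49 = A + ((k + 1 : ℕ) : ℝ) * (A + (K + 2) * A ^ 49) := by
          push_cast; ring
        rw [e] at this
        exact this
  obtain ⟨Gs, h1, h2, h3⟩ := hind K le_rfl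
  refine ⟨Gs, h1, ?_, ?_⟩
  · have hc : ((P.sigma E).card : ℝ) = P.card * M := by
      rw [Finset.card_sigma, Finset.sum_congr rfl C.hE, Finset.sum_const, smul_eq_mul]; push_cast; ring
    rw [← hc] at h2
    have h4 : (K:ℝ) * ((K + 2) ^ 2 * 2) * 2 ≤ A ^ 2 := by
      have : A ≤ A ^ 2 := by nlinarith
      nlinarith [mul_nonneg hK0 hK0]
    have h5 := mul_le_mul_of_nonneg_left h4 (show (0:ℝ) ≤ (P.sigma E).card by positivity)
    have h6 : (((P.sigma E).card : ℝ) - Gs.card) * 2 * A ^ 2 ≤ (P.sigma E).card * A ^ 2 := by linarith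
    have h7 := le_of_mul_le_mul_right h6 (by positivity)
    linarith
  · intro x hx i S hS hSq
    have hx' := h1 hx
    rw [Finset.mem_sigma] at hx'
    have h4 := h3 x hx i S hS (fun q hq => ⟨?_, hSq q hq⟩)
    · exact h4.trans (mul_le_mul_of_nonneg_right (hDb K le_rfl) (by positivity))
    · rw [hδK]
      have a := C.reg _ hx'.1
      have b := C.reg _ (hS hq)
      obtain ⟨a1, a2⟩ := quarter a.1
      obtain ⟨b1, b2⟩ := quarter b.1
      rw [abs_le] at a1 a2 b1 b2
      refine nrm_le_of _ _ ?_ ?_ ?_ <;> simp only [Prod.fst_sub, Prod.snd_sub] <;> rw [abs_le] <;> constructor <;> linarith [a.2.1, a.2.2, b.2.1, b.2.2, a1.1, a1.2, a2.1, a2.2, b1.1, b1.2, b2.1, b2.2]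
end
end

section
open Finset

noncomputable section

theorem heron_aux (D₁ D₂ T ℓ τ η r r' : ℝ) (h1 : |D₁ - r| ≤ η) (h2 : |D₂ - r'| ≤ η) (hη : η ≤ 1 / 4)
    (hr : 1 / 2 ≤ r) (hr1 : r ≤ 1) (hr' : 1 / 2 ≤ r') (hr1' : r' ≤ 1) (hT : 0 ≤ T) (hT2 : T ≤ τ)
    (hm : |r - r'| ≤ τ) (hl : abs (T - |r - r'|) ≤ ℓ) :
    (T ^ 2 - (D₁ - D₂) ^ 2) * ((D₁ + D₂) ^ 2 - T ^ 2) ≤ 9 * ((ℓ + 2 * η) * (2 * τ + 2 * η)) := by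
  have hη0 : 0 ≤ η := (abs_nonneg _).trans h1
  have hl0 : 0 ≤ ℓ := (abs_nonneg _).trans hl
  have hτ0 : 0 ≤ τ := hT.trans hT2
  rw [abs_le] at h1 h2 hl
  obtain ⟨μ, hμ⟩ : ∃ μ, μ = |D₁ - D₂| := ⟨_, rfl⟩
  have hμ0 : 0 ≤ μ := by rw [hμ]; exact abs_nonneg _
  have e1 : |D₁ - D₂| ≤ |r - r'| + 2 * η := by
    have : D₁ - D₂ = (r - r') + ((D₁ - r) - (D₂ - r')) := by ring
    rw [this]
    refine (abs_add_le _ _).trans (add_le_add le_rfl ?_)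
    rw [abs_le]; constructor <;> linarith
  have e2 : |r - r'| ≤ |D₁ - D₂| + 2 * η := by
    have : r - r' = (D₁ - D₂) + (-((D₁ - r) - (D₂ - r'))) := by ring
    rw [this]
    refine (abs_add_le _ _).trans (add_le_add le_rfl ?_)
    rw [abs_le]; constructor <;> linarith
  rw [← hμ] at e1 e2
  have hsq : (D₁ - D₂) ^ 2 = μ ^ 2 := by rw [hμ, sq_abs]
  have hμs : μ ≤ D₁ + D₂ := by
    rw [hμ, abs_le]; constructor <;> linarith
  rw [hsq]
  have hs0 : 0 ≤ D₁ + D₂ := by linarith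
  have hR : 0 ≤ (ℓ + 2 * η) * (2 * τ + 2 * η) := mul_nonneg (by linarith) (by linarith)
  rcases le_total T μ with h | h
  · have a1 : T ^ 2 - μ ^ 2 ≤ 0 := by nlinarith
    have a2 : 0 ≤ (D₁ + D₂) ^ 2 - T ^ 2 := by nlinarith
    have := mul_nonpos_of_nonpos_of_nonneg a1 a2
    linarith
  · have a1 : 0 ≤ T ^ 2 - μ ^ 2 := by nlinarith
    have a2 : (D₁ + D₂) ^ 2 - T ^ 2 ≤ 9 := by nlinarith [sq_nonneg T]
    have a3 : T ^ 2 - μ ^ 2 ≤ (ℓ + 2 * η) * (2 * τ + 2 * η) := by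
      have : T ^ 2 - μ ^ 2 = (T - μ) * (T + μ) := by ring
      rw [this]
      exact mul_le_mul (by linarith) (by linarith) (by linarith) (by linarith)
    have := mul_le_mul_of_nonneg_left a2 a1
    linarith

theorem inc_bound (n1 n2 u1 u2 d1 d2 r r' D₁ D₂ T ℓ τ η ς Q : ℝ)
    (hD1 : 0 ≤ D₁) (hD1s : D₁ ^ 2 = n1 ^ 2 + n2 ^ 2)
    (hD2s : D₂ ^ 2 = (n1 - u1) ^ 2 + (n2 - u2) ^ 2)
    (hT : 0 ≤ T) (hTs : T ^ 2 = u1 ^ 2 + u2 ^ 2)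
    (h1 : |D₁ - r| ≤ η) (h2 : |D₂ - r'| ≤ η) (hη : η ≤ 1 / 4)
    (hr : 1 / 2 ≤ r) (hr1 : r ≤ 1) (hr' : 1 / 2 ≤ r') (hr1' : r' ≤ 1) (hT2 : T ≤ τ)
    (hm : |r - r'| ≤ τ) (hl : abs (T - |r - r'|) ≤ ℓ) (hς : 0 ≤ ς)
    (hd : d1 ^ 2 + d2 ^ 2 ≤ ς ^ 2) (hv : (n1 - d1) ^ 2 + (n2 - d2) ^ 2 = r ^ 2)
    (hQ0 : 0 ≤ Q) (hQ : 9 * ((ℓ + 2 * η) * (2 * τ + 2 * η)) ≤ 4 * Q ^ 2) :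
    |(n1 - d1 - u1) ^ 2 + (n2 - d2 - u2) ^ 2 - r' ^ 2| ≤ 5 * η + 4 * ((ς ^ 2 + 3 * η) * τ) + 8 * (ς * Q) := by
  have hη0 : 0 ≤ η := (abs_nonneg _).trans h1
  have hH := heron_aux D₁ D₂ T ℓ τ η r r' h1 h2 hη hr hr1 hr' hr1' hT hT2 hm hl
  have hD2' : |D₂ ^ 2 - r' ^ 2| ≤ 9 / 4 * η := by
    have : D₂ ^ 2 - r' ^ 2 = (D₂ - r') * (D₂ + r') := by ring
    rw [this, abs_mul]
    have h3 : |D₂ + r'| ≤ 9 / 4 := by rw [abs_le] at h2 ⊢; constructor <;> linarith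
    have := mul_le_mul h2 h3 (abs_nonneg _) hη0
    linarith
  have hD1' : |D₁ ^ 2 - r ^ 2| ≤ 9 / 4 * η := by
    have : D₁ ^ 2 - r ^ 2 = (D₁ - r) * (D₁ + r) := by ring
    rw [this, abs_mul]
    have h3 : |D₁ + r| ≤ 9 / 4 := by rw [abs_le] at h1 ⊢; constructor <;> linarith
    have := mul_le_mul h1 h3 (abs_nonneg _) hη0
    linarith
  have hDq : 1 / 4 ≤ D₁ := by rw [abs_le] at h1; linarith
  have hX : |u1 * n2 - u2 * n1| ≤ Q := by
    refine abs_le_of_sq_le_sq ?_ hQ0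
    have e : 4 * (u1 * n2 - u2 * n1) ^ 2 = (T ^ 2 - (D₁ - D₂) ^ 2) * ((D₁ + D₂) ^ 2 - T ^ 2) := by
      have e1 : (T ^ 2 - (D₁ - D₂) ^ 2) * ((D₁ + D₂) ^ 2 - T ^ 2) = 4 * D₁ ^ 2 * T ^ 2 - (D₁ ^ 2 + T ^ 2 - D₂ ^ 2) ^ 2 := by ring
      rw [e1, hD1s, hD2s, hTs]; ring
    linarith
  have hdot : |n1 * u1 + n2 * u2| ≤ D₁ * T := by
    refine abs_le_of_sq_le_sq ?_ (mul_nonneg hD1 hT)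
    rw [mul_pow, hD1s, hTs]
    nlinarith [sq_nonneg (n1 * u2 - n2 * u1)]
  have hcr : |d1 * n2 - d2 * n1| ≤ ς * D₁ := by
    refine abs_le_of_sq_le_sq ?_ (mul_nonneg hς hD1)
    rw [mul_pow]
    have := mul_le_mul_of_nonneg_right hd (sq_nonneg D₁)
    rw [hD1s] at this ⊢
    nlinarith [sq_nonneg (n1 * d1 + n2 * d2)]
  have hdn : |d1 * n1 + d2 * n2| ≤ (ς ^ 2 + 3 * η) / 2 := by
    have e : d1 * n1 + d2 * n2 = ((d1 ^ 2 + d2 ^ 2) + (D₁ ^ 2 - r ^ 2)) / 2 := by rw [hD1s, ← hv]; ring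
    rw [e]
    have h3 : 0 ≤ d1 ^ 2 + d2 ^ 2 := by positivity
    rw [abs_le] at hD1' ⊢
    constructor <;> linarith [sq_nonneg ς]
  have hmain : D₁ * |d1 * u1 + d2 * u2| ≤ (ς ^ 2 + 3 * η) / 2 * T + ς * Q := by
    have e : D₁ ^ 2 * (d1 * u1 + d2 * u2) = (d1 * n1 + d2 * n2) * (n1 * u1 + n2 * u2) + (d1 * n2 - d2 * n1) * (u1 * n2 - u2 * n1) := by
      rw [hD1s]; ring
    have h3 : D₁ ^ 2 * |d1 * u1 + d2 * u2| ≤ (ς ^ 2 + 3 * η) / 2 * (D₁ * T) + ς * D₁ * Q := by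
      rw [← abs_of_nonneg (sq_nonneg D₁), ← abs_mul, e]
      refine (abs_add_le _ _).trans ?_
      rw [abs_mul, abs_mul]
      exact add_le_add (mul_le_mul hdn hdot (abs_nonneg _) (by positivity)) (mul_le_mul hcr hX (abs_nonneg _) (by positivity))
    have hD0 : 0 < D₁ := by linarith
    refine le_of_mul_le_mul_left ?_ hD0
    calc D₁ * (D₁ * |d1 * u1 + d2 * u2|) = D₁ ^ 2 * |d1 * u1 + d2 * u2| := by ring
      _ ≤ _ := h3
      _ = _ := by ring
  have hmain2 : |d1 * u1 + d2 * u2| ≤ 4 * ((ς ^ 2 + 3 * η) / 2 * τ + ς * Q) := by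
    have h3 := mul_le_mul_of_nonneg_right hDq (abs_nonneg (d1 * u1 + d2 * u2))
    have h4 := mul_le_mul_of_nonneg_left hT2 (show 0 ≤ (ς ^ 2 + 3 * η) / 2 by positivity)
    linarith
  have e : (n1 - d1 - u1) ^ 2 + (n2 - d2 - u2) ^ 2 - r' ^ 2 = (D₂ ^ 2 - r' ^ 2) - (D₁ ^ 2 - r ^ 2) + 2 * (d1 * u1 + d2 * u2) := by
    rw [hD1s, hD2s, ← hv]; ring
  rw [e]
  rw [abs_le] at hD1' hD2' hmain2 ⊢
  constructor <;> linarith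

set_option maxHeartbeats 1000000 in
theorem inc_bound2 (n1 n2 u1 u2 d1 d2 r r' D₁ D₂ T lam t δ σ C ρ : ℝ)
    (hD1 : 0 ≤ D₁) (hD1s : D₁ ^ 2 = n1 ^ 2 + n2 ^ 2)
    (hD2s : D₂ ^ 2 = (n1 - u1) ^ 2 + (n2 - u2) ^ 2)
    (hT : 0 ≤ T) (hTs : T ^ 2 = u1 ^ 2 + u2 ^ 2)
    (hδ : 0 < δ) (hC : 1 ≤ C) (hρ : 1 ≤ ρ) (hlam : δ ≤ lam) (hlt : lam ≤ t) (ht : t ≤ 1)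
    (hσ0 : 0 ≤ σ) (hσ : σ ≤ 2 * (δ / Real.sqrt (lam * t)))
    (h1 : |D₁ - r| ≤ C * δ) (h2 : |D₂ - r'| ≤ C * δ) (hη : C * δ ≤ 1 / 4)
    (hr : 1 / 2 ≤ r) (hr1 : r ≤ 1) (hr' : 1 / 2 ≤ r') (hr1' : r' ≤ 1) (hT2 : T ≤ ρ * t)
    (hm : |r - r'| ≤ ρ * t) (hl : abs (T - |r - r'|) ≤ ρ * lam)
    (hd : d1 ^ 2 + d2 ^ 2 ≤ (C * σ) ^ 2) (hv : (n1 - d1) ^ 2 + (n2 - d2) ^ 2 = r ^ 2) :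
    |(n1 - d1 - u1) ^ 2 + (n2 - d2 - u2) ^ 2 - r' ^ 2| ≤ 129 * (C ^ 2 * ρ) * δ := by
  have hl0 : 0 < lam := by linarith
  have ht0 : 0 < t := by linarith
  obtain ⟨q, hq⟩ : ∃ q, q = Real.sqrt (lam * t) := ⟨_, rfl⟩
  have hq0 : 0 < q := by rw [hq]; exact Real.sqrt_pos.2 (mul_pos hl0 ht0)
  have hqs : q ^ 2 = lam * t := by rw [hq]; exact Real.sq_sqrt (mul_pos hl0 ht0).le
  rw [← hq] at hσ
  have hσq : σ * q ≤ 2 * δ := by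
    have := mul_le_mul_of_nonneg_right hσ hq0.le
    rwa [show 2 * (δ / q) * q = 2 * δ by field_simp] at this
  have hσ2 : σ ^ 2 * t ≤ 4 * δ := by
    have h3 : (σ * q) ^ 2 ≤ (2 * δ) ^ 2 := pow_le_pow_left₀ (by positivity) hσq 2
    rw [mul_pow, hqs] at h3
    have h4 : σ ^ 2 * t * lam ≤ 4 * δ * lam := by
      have := mul_le_mul_of_nonneg_left hlam (show 0 ≤ 4 * δ by linarith)
      linarith
    exact le_of_mul_le_mul_right h4 hl0
  have hρC : 1 ≤ ρ * C := one_le_mul_of_one_le_of_one_le hρ hC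
  have a1 : ρ * lam + 2 * (C * δ) ≤ 3 * (ρ * C) * lam := by
    have h3 := mul_le_mul_of_nonneg_right hC (show 0 ≤ ρ * lam by positivity)
    have h4 := mul_le_mul_of_nonneg_right hρ (show 0 ≤ C * δ by positivity)
    have h5 := mul_le_mul_of_nonneg_left hlam (show 0 ≤ ρ * C by positivity)
    linarith
  have a2 : 2 * (ρ * t) + 2 * (C * δ) ≤ 4 * (ρ * C) * t := by
    have h3 := mul_le_mul_of_nonneg_right hC (show 0 ≤ ρ * t by positivity)
    have h4 := mul_le_mul_of_nonneg_right hρ (show 0 ≤ C * δ by positivity)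
    have h5 := mul_le_mul_of_nonneg_left (hlam.trans hlt) (show 0 ≤ ρ * C by positivity)
    linarith
  have key := inc_bound n1 n2 u1 u2 d1 d2 r r' D₁ D₂ T (ρ * lam) (ρ * t) (C * δ) (C * σ) (6 * (ρ * C) * q)
    hD1 hD1s hD2s hT hTs h1 h2 hη hr hr1 hr' hr1' hT2 hm hl (by positivity) hd hv (by positivity) (by
      have := mul_le_mul a1 a2 (by positivity) (by positivity)
      have e : (6 * (ρ * C) * q) ^ 2 = 36 * (ρ * C) ^ 2 * (lam * t) := by rw [← hqs]; ring
      rw [e]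
      have h6 : 0 ≤ (ρ * C) ^ 2 * (lam * t) := by positivity
      linarith)
  refine key.trans ?_
  have hC2 : C ≤ C ^ 2 := le_self_pow₀ hC two_ne_zero
  have hb : C ≤ C ^ 2 * ρ := hC2.trans (le_mul_of_one_le_right (sq_nonneg C) hρ)
  have hb' : C * ρ ≤ C ^ 2 * ρ := mul_le_mul_of_nonneg_right hC2 (by linarith)
  have b1 : C * δ ≤ (C ^ 2 * ρ) * δ := mul_le_mul_of_nonneg_right hb hδ.le
  have b2 : (C * σ) ^ 2 * (ρ * t) ≤ 4 * ((C ^ 2 * ρ) * δ) := by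
    have := mul_le_mul_of_nonneg_left hσ2 (show 0 ≤ C ^ 2 * ρ by positivity)
    linarith
  have b3 : C * δ * (ρ * t) ≤ (C ^ 2 * ρ) * δ := by
    have h3 := mul_le_mul_of_nonneg_left ht (show 0 ≤ C * δ * ρ by positivity)
    have h4 := mul_le_mul_of_nonneg_right hb' hδ.le
    linarith
  have b4 : C * σ * (6 * (ρ * C) * q) ≤ 12 * ((C ^ 2 * ρ) * δ) := by
    have := mul_le_mul_of_nonneg_left hσq (show 0 ≤ 6 * (C ^ 2 * ρ) by positivity)
    linarith
  linarith

theorem ang_close (θ θ' d : ℝ) (hd : 0 ≤ d) (h : |θ - θ'| ≤ Real.pi)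
    (hc : (Real.cos θ - Real.cos θ') ^ 2 + (Real.sin θ - Real.sin θ') ^ 2 ≤ d ^ 2) :
    |θ - θ'| ≤ Real.pi / 2 * d := by
  have e : (Real.cos θ - Real.cos θ') ^ 2 + (Real.sin θ - Real.sin θ') ^ 2 = (2 * Real.sin (|θ - θ'| / 2)) ^ 2 := by
    have e1 : Real.cos (|θ - θ'|) = Real.cos θ * Real.cos θ' + Real.sin θ * Real.sin θ' := by
      rw [Real.cos_abs, Real.cos_sub]
    have e2 : Real.cos (|θ - θ'|) = 1 - 2 * Real.sin (|θ - θ'| / 2) ^ 2 := by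
      rw [← mul_div_cancel₀ (|θ - θ'|) (two_ne_zero' ℝ), mul_div_assoc, Real.cos_two_mul, Real.cos_sq']
      ring_nf
    nlinarith [Real.sin_sq_add_cos_sq θ, Real.sin_sq_add_cos_sq θ']
  rw [e] at hc
  have h1 : 2 * Real.sin (|θ - θ'| / 2) ≤ d := (abs_le_of_sq_le_sq hc hd) |> (le_abs_self _).trans
  have h2 := Real.mul_le_sin (show 0 ≤ |θ - θ'| / 2 by positivity) (by linarith)
  have h3 : 2 / Real.pi * |θ - θ'| ≤ d := by linarith
  have hpi := Real.pi_pos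
  calc |θ - θ'| = Real.pi / 2 * (2 / Real.pi * |θ - θ'|) := by field_simp
    _ ≤ _ := mul_le_mul_of_nonneg_left h3 (by positivity)

theorem int_card (S : Finset ℤ) (D : ℝ) (hD : 0 ≤ D) (h : ∀ i ∈ S, ∀ j ∈ S, |(i:ℝ) - j| ≤ D) : (S.card : ℝ) ≤ D + 1 := by
  rcases S.eq_empty_or_nonempty with h0 | h0
  · rw [h0]; simp; linarith
  · have h1 : S ⊆ Finset.Icc (S.min' h0) (S.max' h0) := fun i hi => Finset.mem_Icc.2 ⟨S.min'_le i hi, S.le_max' i hi⟩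
    have h2 := Finset.card_le_card h1
    rw [Int.card_Icc] at h2
    have h3 := h _ (S.max'_mem h0) _ (S.min'_mem h0)
    have h4 : S.min' h0 ≤ S.max' h0 := S.min'_le _ (S.max'_mem h0)
    have h5 : (S.card : ℤ) ≤ S.max' h0 + 1 - S.min' h0 := by omega
    have h6 : (S.card : ℝ) ≤ S.max' h0 + 1 - S.min' h0 := by exact_mod_cast h5
    rw [abs_le] at h3
    linarith

theorem arc_card (S : Finset ℤ) (σ d : ℝ) (hσ : 0 < σ) (hσ1 : σ ≤ 1) (hd : 0 ≤ d)
    (hv : ∀ j ∈ S, 0 ≤ j ∧ (j:ℝ) < σ⁻¹)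
    (h : ∀ i ∈ S, ∀ j ∈ S,
      (Real.cos (((i:ℝ) + 1 / 2) * (2 * Real.pi * σ)) - Real.cos (((j:ℝ) + 1 / 2) * (2 * Real.pi * σ))) ^ 2 +
      (Real.sin (((i:ℝ) + 1 / 2) * (2 * Real.pi * σ)) - Real.sin (((j:ℝ) + 1 / 2) * (2 * Real.pi * σ))) ^ 2 ≤ d ^ 2) :
    (S.card : ℝ) ≤ 3 * (d / (4 * σ) + 1) := by
  classical
  have hpi := Real.pi_pos
  have hσi : σ * σ⁻¹ = 1 := mul_inv_cancel₀ hσ.ne'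
  obtain ⟨f, hf⟩ : ∃ f : ℤ → ℤ, f = fun j : ℤ => ⌊((j:ℝ) + 1 / 2) * (2 * σ)⌋ := ⟨_, rfl⟩
  have hmap : ∀ j ∈ S, f j ∈ Finset.Icc (0:ℤ) 2 := by
    intro j hj
    obtain ⟨h1, h2⟩ := hv j hj
    have h1' : (0:ℝ) ≤ j := by exact_mod_cast h1
    rw [hf, Finset.mem_Icc]
    constructor
    · exact Int.floor_nonneg.2 (by positivity)
    · have h3 := mul_lt_mul_of_pos_left h2 hσ
      rw [hσi] at h3
      have : ⌊((j:ℝ) + 1 / 2) * (2 * σ)⌋ < 3 := by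
        rw [Int.floor_lt]; push_cast; linarith
      show ⌊((j:ℝ) + 1 / 2) * (2 * σ)⌋ ≤ 2
      omega
  have hc := Finset.card_eq_sum_card_fiberwise hmap
  have hb : ∀ c ∈ Finset.Icc (0:ℤ) 2, ((S.filter (fun j => f j = c)).card : ℝ) ≤ d / (4 * σ) + 1 := by
    intro c _
    refine int_card _ _ (by positivity) ?_
    intro i hi j hj
    rw [Finset.mem_filter] at hi hj
    have hij : f i = f j := hi.2.trans hj.2.symm
    rw [hf] at hij
    have h1 := Int.abs_sub_lt_one_of_floor_eq_floor hij
    have e : ((i:ℝ) + 1 / 2) * (2 * Real.pi * σ) - ((j:ℝ) + 1 / 2) * (2 * Real.pi * σ) = Real.pi * (((i:ℝ) + 1 / 2) * (2 * σ) - ((j:ℝ) + 1 / 2) * (2 * σ)) := by ring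
    have h2 := ang_close _ _ d hd (by
      rw [e, abs_mul, abs_of_pos hpi]
      have := mul_le_mul_of_nonneg_left h1.le hpi.le
      linarith) (h i hi.1 j hj.1)
    have e2 : ((i:ℝ) + 1 / 2) * (2 * Real.pi * σ) - ((j:ℝ) + 1 / 2) * (2 * Real.pi * σ) = (2 * Real.pi * σ) * ((i:ℝ) - j) := by ring
    rw [e2, abs_mul, abs_of_pos (show 0 < 2 * Real.pi * σ by positivity)] at h2
    rw [le_div_iff₀ (by positivity)]
    refine le_of_mul_le_mul_left ?_ (show 0 < Real.pi / 2 by positivity)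
    linarith
  rw [hc]
  push_cast
  refine (Finset.sum_le_sum hb).trans ?_
  rw [Finset.sum_const, nsmul_eq_mul]
  simp
end
end

section
open Metric Set
noncomputable section

def toP (δ : ℝ) (k : CubeIdx) : Pt := (((k.1.1 : ℝ) + 1 / 2) * δ, ((k.1.2 : ℝ) + 1 / 2) * δ, ((k.2 : ℝ) + 1 / 2) * δ)
def ofP (δ : ℝ) (p : Pt) : CubeIdx := ((⌊p.1 / δ⌋, ⌊p.2.1 / δ⌋), ⌊p.2.2 / δ⌋)
def ang (σ : ℝ) (j : ℤ) : ℝ := ((j : ℝ) + 1 / 2) * (2 * Real.pi * σ)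

theorem floor_half {δ : ℝ} (hδ : 0 < δ) (k : ℤ) : ⌊((k : ℝ) + 1 / 2) * δ / δ⌋ = k := by
  rw [mul_div_cancel_right₀ _ hδ.ne', Int.floor_eq_iff]
  constructor <;> linarith

theorem ofP_toP {δ : ℝ} (hδ : 0 < δ) (k : CubeIdx) : ofP δ (toP δ k) = k := by
  unfold ofP toP
  simp only [floor_half hδ]

theorem toP_inj {δ : ℝ} (hδ : 0 < δ) : Function.Injective (toP δ) := fun a b h => by
  rw [← ofP_toP hδ a, h, ofP_toP hδ]

theorem ang_inj {σ : ℝ} (hσ : 0 < σ) : Function.Injective (ang σ) := fun a b h => by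
  unfold ang at h
  have hpi := Real.pi_pos
  have h1 := mul_right_cancel₀ (show 2 * Real.pi * σ ≠ 0 by positivity) h
  have : (a:ℝ) = b := by linarith
  exact_mod_cast this

theorem mk2_0 (a b : ℝ) : (mk2 a b) 0 = a := by simp [mk2]
theorem mk2_1 (a b : ℝ) : (mk2 a b) 1 = b := by simp [mk2]

theorem dist_sq2 (v w : Plane) : dist v w ^ 2 = (v 0 - w 0) ^ 2 + (v 1 - w 1) ^ 2 := by
  rw [EuclideanSpace.dist_eq, Real.sq_sqrt (by positivity), Fin.sum_univ_two, Real.dist_eq, Real.dist_eq, sq_abs, sq_abs]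

theorem pt_0 (p : Param) (θ : ℝ) : (p.1 + p.2 • dir θ) 0 = p.1 0 + p.2 * Real.cos θ := by
  simp [dir, mk2]
theorem pt_1 (p : Param) (θ : ℝ) : (p.1 + p.2 • dir θ) 1 = p.1 1 + p.2 * Real.sin θ := by
  simp [dir, mk2]

theorem annulus_dist {η : ℝ} {p : Param} {w : Plane} (hp : 0 ≤ p.2) (h : w ∈ annulus η p) : |dist w p.1 - p.2| ≤ η := by
  unfold annulus at h
  rw [Set.mem_ofPred_eq] at h
  refine le_trans ?_ h
  unfold circ
  rw [Metric.le_infDist (NormedSpace.sphere_nonempty.2 hp)]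
  intro y hy
  have hy' : dist y p.1 = p.2 := hy
  rw [← hy']
  have := abs_dist_sub_le w y p.1
  exact this

theorem ctr_mem {δ : ℝ} (hδ : 0 < δ) (k : CubeIdx) : cubeCtr δ k ∈ cubeSet δ k := by
  unfold cubeCtr cubeSet
  rw [Set.mem_ofPred_eq, mk2_0, mk2_1]
  refine ⟨?_, ?_, ?_, ?_, ?_, ?_⟩ <;> nlinarith

theorem idx3_cube {δ : ℝ} (hδ : 0 < δ) {k : CubeIdx} {p : Param} (h : p ∈ cubeSet δ k) : idx3 δ p = k := by
  obtain ⟨h1, h2, h3, h4, h5, h6⟩ := h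
  unfold idx3 idx2
  have f : ∀ (x : ℝ) (m : ℤ), (m:ℝ) * δ ≤ x → x < ((m:ℝ) + 1) * δ → ⌊x / δ⌋ = m := by
    intro x m a b
    rw [Int.floor_eq_iff]
    exact ⟨(le_div_iff₀ hδ).2 a, (div_lt_iff₀ hδ).2 b⟩
  rw [f _ _ h1 h2, f _ _ h3 h4, f _ _ h5 h6]

theorem cube_sub {δ : ℝ} (hδ : 0 < δ) {k k' : CubeIdx} (h : cubeSet δ k ⊆ cubeSet δ k') : k = k' := by
  rw [← idx3_cube hδ (ctr_mem hδ k), idx3_cube hδ (h (ctr_mem hδ k))]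

theorem ctr_reg {δ : ℝ} (hδ : 0 < δ) {k : CubeIdx} (h : cubeSet δ k ⊆ domD) :
    (toP δ k).1 ^ 2 + (toP δ k).2.1 ^ 2 ≤ 1 / 16 ∧ 1 / 2 ≤ (toP δ k).2.2 ∧ (toP δ k).2.2 ≤ 1 := by
  obtain ⟨h1, h2, h3⟩ := h (ctr_mem hδ k)
  refine ⟨?_, h2, h3⟩
  have h4 := dist_sq2 (cubeCtr δ k).1 0
  rw [dist_zero_right] at h4
  have h5 : ‖(cubeCtr δ k).1‖ ^ 2 ≤ (1 / 4) ^ 2 := pow_le_pow_left₀ (norm_nonneg _) h1 2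
  rw [h4] at h5
  unfold cubeCtr at h5
  simp only [mk2_0, mk2_1] at h5
  unfold toP
  simp at h5 ⊢
  linarith

theorem geom_main {δ σ lam t C ρ θ θ' : ℝ} {k k' : CubeIdx} (hδ : 0 < δ)
    (hk : cubeSet δ k ⊆ domD) (hk' : cubeSet δ k' ⊆ domD) (hC : 1 ≤ C) (hρ : 1 ≤ ρ) (hlam : δ ≤ lam)
    (hlt : lam ≤ t) (ht : t ≤ 1) (hσ0 : 0 ≤ σ) (hσ : σ ≤ 2 * (δ / Real.sqrt (lam * t))) (hη : C * δ ≤ 1 / 4)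
    (h1 : tang (cubeCtr δ k) (cubeCtr δ k') ≤ ρ * lam) (h2 : pdist (cubeCtr δ k) (cubeCtr δ k') ≤ ρ * t)
    (h3 : (rect (C * δ) (C * σ) (cubeCtr δ k) ((cubeCtr δ k).1 + (cubeCtr δ k).2 • dir θ) ∩
      rect (C * δ) (C * σ) (cubeCtr δ k') ((cubeCtr δ k').1 + (cubeCtr δ k').2 • dir θ')).Nonempty) :
    |incF (toP δ k) θ (toP δ k')| ≤ 129 * (C ^ 2 * ρ) * δ ∧
    dist ((cubeCtr δ k').1 + (cubeCtr δ k').2 • dir θ') ((cubeCtr δ k).1 + (cubeCtr δ k).2 • dir θ) ≤ 2 * C * σ := by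
  obtain ⟨w, ⟨hw1, hw2⟩, hw3, hw4⟩ := h3
  have r1 := ctr_reg hδ hk
  have r2 := ctr_reg hδ hk'
  rw [mem_closedBall] at hw2 hw4
  constructor
  swap
  · have := dist_triangle_left ((cubeCtr δ k').1 + (cubeCtr δ k').2 • dir θ') ((cubeCtr δ k).1 + (cubeCtr δ k).2 • dir θ) w
    linarith
  have e0 : ∀ k : CubeIdx, (cubeCtr δ k).1 0 = (toP δ k).1 := fun k => mk2_0 _ _
  have e1 : ∀ k : CubeIdx, (cubeCtr δ k).1 1 = (toP δ k).2.1 := fun k => mk2_1 _ _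
  have e2 : ∀ k : CubeIdx, (cubeCtr δ k).2 = (toP δ k).2.2 := fun k => rfl
  have a1 := annulus_dist (by rw [e2]; linarith [r1.2.1]) hw1
  have a2 := annulus_dist (by rw [e2]; linarith [r2.2.1]) hw3
  have s1 := dist_sq2 w (cubeCtr δ k).1
  have s2 := dist_sq2 w (cubeCtr δ k').1
  have s3 := dist_sq2 (cubeCtr δ k).1 (cubeCtr δ k').1
  have s4 := dist_sq2 w ((cubeCtr δ k).1 + (cubeCtr δ k).2 • dir θ)
  have q1 : dist (cubeCtr δ k).1 (cubeCtr δ k').1 ^ 2 + ((cubeCtr δ k).2 - (cubeCtr δ k').2) ^ 2 ≤ (ρ * t) ^ 2 := by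
    unfold pdist at h2
    rw [Real.sqrt_le_iff] at h2
    exact h2.2
  have hρt : 0 ≤ ρ * t := mul_nonneg (by linarith) (by linarith)
  have q2 : dist (cubeCtr δ k).1 (cubeCtr δ k').1 ≤ ρ * t :=
    abs_le_of_sq_le_sq (by linarith [sq_nonneg ((cubeCtr δ k).2 - (cubeCtr δ k').2)]) hρt |> (le_abs_self _).trans
  have q3 : |(cubeCtr δ k).2 - (cubeCtr δ k').2| ≤ ρ * t :=
    abs_le_of_sq_le_sq (by linarith [sq_nonneg (dist (cubeCtr δ k).1 (cubeCtr δ k').1)]) hρt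
  have q4 := pow_le_pow_left₀ dist_nonneg hw2 2
  unfold tang at h1
  rw [s4, pt_0, pt_1, e0, e1, e2] at q4
  rw [e0, e1] at s1 s2
  rw [e0, e1, e0, e1] at s3
  rw [e2] at a1 a2
  rw [e2, e2] at h1 q3
  have d1 := dist_nonneg (x := w) (y := (cubeCtr δ k).1)
  have d3 := dist_nonneg (x := (cubeCtr δ k).1) (y := (cubeCtr δ k').1)
  have hcs := Real.sin_sq_add_cos_sq θ
  generalize dist w (cubeCtr δ k).1 = D₁ at a1 s1 d1
  generalize dist w (cubeCtr δ k').1 = D₂ at a2 s2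
  generalize dist (cubeCtr δ k).1 (cubeCtr δ k').1 = T at h1 s3 q2 d3
  have key := inc_bound2 (w 0 - (toP δ k).1) (w 1 - (toP δ k).2.1) ((toP δ k').1 - (toP δ k).1) ((toP δ k').2.1 - (toP δ k).2.1)
    (w 0 - ((toP δ k).1 + (toP δ k).2.2 * Real.cos θ)) (w 1 - ((toP δ k).2.1 + (toP δ k).2.2 * Real.sin θ))
    (toP δ k).2.2 (toP δ k').2.2 D₁ D₂ T lam t δ σ C ρ d1 s1 (by rw [s2]; ring) d3 (by rw [s3]; ring) hδ hC hρ hlam hlt ht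
    hσ0 hσ a1 a2 hη r1.2.1 r1.2.2 r2.2.1 r2.2.2 q2 q3 h1 q4 (by
      have : (toP δ k).2.2 ^ 2 * (Real.sin θ ^ 2 + Real.cos θ ^ 2) = (toP δ k).2.2 ^ 2 := by rw [hcs, mul_one]
      rw [← this]; ring)
  have e : incF (toP δ k) θ (toP δ k') = (w 0 - (toP δ k).1 - (w 0 - ((toP δ k).1 + (toP δ k).2.2 * Real.cos θ)) - ((toP δ k').1 - (toP δ k).1)) ^ 2 +
    (w 1 - (toP δ k).2.1 - (w 1 - ((toP δ k).2.1 + (toP δ k).2.2 * Real.sin θ)) - ((toP δ k').2.1 - (toP δ k).2.1)) ^ 2 - (toP δ k').2.2 ^ 2 := by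
    unfold incF; ring
  rw [e]; exact key

theorem ceil_bd {σ : ℝ} (h : 0 < σ) (h1 : σ ≤ 1) : σ ≤ dyadicCeil σ ∧ dyadicCeil σ ≤ 2 * σ ∧ dyadicCeil σ ≤ 1 ∧ 0 < dyadicCeil σ := by
  unfold dyadicCeil
  have a1 := Int.floor_le (Real.logb 2 σ⁻¹)
  have a2 := Int.lt_floor_add_one (Real.logb 2 σ⁻¹)
  have a3 : 0 ≤ ⌊Real.logb 2 σ⁻¹⌋ := Int.floor_nonneg.2 (Real.logb_nonneg (by norm_num) (one_le_inv₀ h |>.2 h1))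
  generalize ⌊Real.logb 2 σ⁻¹⌋ = n at a1 a2 a3
  rw [Real.logb_inv] at a1 a2
  have e : (2:ℝ) ^ (-n) = (2:ℝ) ^ (-(n:ℝ)) := by rw [← Real.rpow_intCast]; push_cast; rfl
  have es : σ = (2:ℝ) ^ (Real.logb 2 σ) := (Real.rpow_logb (by norm_num) (by norm_num) h).symm
  rw [e]
  refine ⟨?_, ?_, ?_, by positivity⟩
  · conv_lhs => rw [es]
    exact Real.rpow_le_rpow_of_exponent_le (by norm_num) (by linarith)
  · have : (2:ℝ) * σ = 2 ^ (1 + Real.logb 2 σ) := by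
      rw [Real.rpow_add (by norm_num), Real.rpow_one, ← es]
    rw [this]
    exact Real.rpow_le_rpow_of_exponent_le (by norm_num) (by linarith)
  · refine Real.rpow_le_one_of_one_le_of_nonpos (by norm_num) ?_
    have : (0:ℝ) ≤ n := by exact_mod_cast a3
    linarith
end
end

section
open Metric Set
noncomputable section

theorem le_of_sqs {a b : ℝ} (h : a ^ 2 ≤ b ^ 2) (hb : 0 ≤ b) : a ≤ b := (le_abs_self a).trans (abs_le_of_sq_le_sq h hb)

theorem dir_diff (θ θ' : ℝ) : (Real.cos θ - Real.cos θ') ^ 2 + (Real.sin θ - Real.sin θ') ^ 2 ≤ (θ - θ') ^ 2 := by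
  have h := Real.one_sub_sq_div_two_le_cos (x := θ - θ')
  rw [Real.cos_sub] at h
  nlinarith [Real.sin_sq_add_cos_sq θ, Real.sin_sq_add_cos_sq θ']

theorem pt_dist (p : Param) (hp : 0 ≤ p.2) (θ θ' : ℝ) :
    dist (p.1 + p.2 • dir θ) (p.1 + p.2 • dir θ') ^ 2 = p.2 ^ 2 * ((Real.cos θ - Real.cos θ') ^ 2 + (Real.sin θ - Real.sin θ') ^ 2) := by
  rw [dist_sq2, pt_0, pt_0, pt_1, pt_1]; ring

theorem pt_dist_le (p : Param) (hp : 0 ≤ p.2) (hp1 : p.2 ≤ 1) (θ θ' : ℝ) :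
    dist (p.1 + p.2 • dir θ) (p.1 + p.2 • dir θ') ≤ |θ - θ'| := by
  refine le_of_sqs ?_ (abs_nonneg _)
  rw [pt_dist p hp, sq_abs]
  have h1 : p.2 ^ 2 ≤ 1 := pow_le_one₀ hp hp1
  have h2 := mul_le_mul_of_nonneg_right h1 (show 0 ≤ (Real.cos θ - Real.cos θ') ^ 2 + (Real.sin θ - Real.sin θ') ^ 2 by positivity)
  have := dir_diff θ θ'
  linarith

theorem dir_of_pt (p : Param) (hp : 1 / 2 ≤ p.2) (θ θ' d : ℝ) (h : dist (p.1 + p.2 • dir θ) (p.1 + p.2 • dir θ') ≤ d) :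
    (Real.cos θ - Real.cos θ') ^ 2 + (Real.sin θ - Real.sin θ') ^ 2 ≤ (2 * d) ^ 2 := by
  have h1 := pow_le_pow_left₀ dist_nonneg h 2
  rw [pt_dist p (by linarith)] at h1
  have h2 : (1 / 2 : ℝ) ^ 2 ≤ p.2 ^ 2 := pow_le_pow_left₀ (by norm_num) hp 2
  have h3 := mul_le_mul_of_nonneg_right h2 (show 0 ≤ (Real.cos θ - Real.cos θ') ^ 2 + (Real.sin θ - Real.sin θ') ^ 2 by positivity)
  linarith

theorem coord_le (v w : Plane) : |v 0 - w 0| ≤ dist v w ∧ |v 1 - w 1| ≤ dist v w := by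
  have h := dist_sq2 v w
  exact ⟨abs_le_of_sq_le_sq (by nlinarith [sq_nonneg (v 1 - w 1)]) dist_nonneg,
    abs_le_of_sq_le_sq (by nlinarith [sq_nonneg (v 0 - w 0)]) dist_nonneg⟩

theorem floor_close {δ a b : ℝ} (hδ : 0 < δ) (n : ℕ) (h : |a - b| ≤ n * δ) :
    ⌊a / δ⌋ ∈ Finset.Icc (⌊b / δ⌋ - (n + 1)) (⌊b / δ⌋ + (n + 1)) := by
  have e : |a / δ - b / δ| ≤ n := by
    rw [← sub_div, abs_div, abs_of_pos hδ, div_le_iff₀ hδ]; exact h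
  rw [abs_le] at e
  have a1 := Int.floor_le (a / δ)
  have a2 := Int.lt_floor_add_one (a / δ)
  have b1 := Int.floor_le (b / δ)
  have b2 := Int.lt_floor_add_one (b / δ)
  rw [Finset.mem_Icc]
  constructor
  · have : (⌊b / δ⌋:ℝ) - (n + 1) < ⌊a / δ⌋ + 1 := by linarith
    have : ⌊b / δ⌋ - (n + 1) < ⌊a / δ⌋ + 1 := by exact_mod_cast this
    omega
  · have : (⌊a / δ⌋:ℝ) < ⌊b / δ⌋ + (n + 1) + 1 := by linarith
    have : ⌊a / δ⌋ < ⌊b / δ⌋ + (n + 1) + 1 := by exact_mod_cast this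
    omega

def box (δ : ℝ) (v : Plane) : Finset (ℤ × ℤ) :=
  (Finset.Icc (⌊v 0 / δ⌋ - ((7:ℕ) + 1)) (⌊v 0 / δ⌋ + ((7:ℕ) + 1))) ×ˢ (Finset.Icc (⌊v 1 / δ⌋ - ((7:ℕ) + 1)) (⌊v 1 / δ⌋ + ((7:ℕ) + 1)))

theorem box_card (δ : ℝ) (v : Plane) : (box δ v).card = 289 := by
  unfold box
  rw [Finset.card_product, Int.card_Icc, Int.card_Icc]
  have : ∀ a : ℤ, (a + ((7:ℕ) + 1) + 1 - (a - ((7:ℕ) + 1))).toNat = 17 := by intro a; omega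
  rw [this, this]

theorem arc_box {δ : ℝ} (hδ : 0 < δ) (p : Param) (hp : 0 ≤ p.2) (hp1 : p.2 ≤ 1) (j : ℤ) (w : Plane) (hw : w ∈ arcSet p δ j) :
    idx2 δ w ∈ box δ (arcCenterAt p δ j) := by
  obtain ⟨θ, h1, h2, rfl⟩ := hw
  have hpi := Real.pi_lt_d2
  have hpi0 := Real.pi_pos
  have h3 : dist (p.1 + p.2 • dir θ) (arcCenterAt p δ j) ≤ (7:ℕ) * δ := by
    refine (pt_dist_le p hp hp1 _ _).trans ?_
    have : 2 * Real.pi * δ ≤ 7 * δ := mul_le_mul_of_nonneg_right (by linarith) hδ.le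
    rw [abs_le]; push_cast; constructor <;> linarith
  obtain ⟨a, b⟩ := coord_le (p.1 + p.2 • dir θ) (arcCenterAt p δ j)
  unfold box idx2
  rw [Finset.mem_product]
  exact ⟨floor_close hδ 7 (a.trans h3), floor_close hδ 7 (b.trans h3)⟩

theorem ctr_in_arc {δ : ℝ} (hδ : 0 < δ) (p : Param) (j : ℤ) : arcCenterAt p δ j ∈ arcSet p δ j := by
  have hpi := Real.pi_pos
  have : 0 < 2 * Real.pi * δ := by positivity
  exact ⟨_, by linarith, by linarith, rfl⟩

theorem idx2_same {δ : ℝ} (hδ : 0 < δ) (v w : Plane) (h : idx2 δ v = idx2 δ w) : dist v w ≤ 2 * δ := by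
  unfold idx2 at h
  rw [Prod.mk.injEq] at h
  have h1 := Int.abs_sub_lt_one_of_floor_eq_floor h.1
  have h2 := Int.abs_sub_lt_one_of_floor_eq_floor h.2
  rw [← sub_div, abs_div, abs_of_pos hδ, div_lt_iff₀ hδ, one_mul] at h1 h2
  refine le_of_sqs ?_ (by linarith)
  rw [dist_sq2, ← sq_abs (v 0 - w 0), ← sq_abs (v 1 - w 1)]
  have a1 := pow_le_pow_left₀ (abs_nonneg _) h1.le 2
  have a2 := pow_le_pow_left₀ (abs_nonneg _) h2.le 2
  nlinarith

theorem frE_aux {δ s B : ℝ} (hδ : 0 < δ) (hδ1 : δ ≤ 1) (hB : 0 ≤ B) (p : Param) (hp : 1 / 2 ≤ p.2) (hp1 : p.2 ≤ 1)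
    (Ej : Finset ℤ) (hv : ∀ j ∈ Ej, validArc δ j)
    (h : IsDSet2 δ s B (⋃ j ∈ (Ej : Set ℤ), arcSet p δ j))
    (S : Finset ℤ) (hS : S ⊆ Ej) (φ ρ : ℝ) (hρ : δ ≤ ρ) (hφ : ∀ j ∈ S, |ang δ j - φ| ≤ ρ) :
    (S.card : ℝ) ≤ 1734 * B * Ej.card * ρ ^ s := by
  classical
  obtain ⟨U, hU⟩ : ∃ U, U = (⋃ j ∈ (Ej : Set ℤ), arcSet p δ j) := ⟨_, rfl⟩
  rw [← hU] at h
  have hsub : idx2 δ '' U ⊆ ((Ej.biUnion fun j => box δ (arcCenterAt p δ j) : Finset (ℤ × ℤ)) : Set (ℤ × ℤ)) := by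
    rintro _ ⟨w, hw, rfl⟩
    rw [hU] at hw
    simp only [Set.mem_iUnion] at hw
    obtain ⟨j, hj, hw⟩ := hw
    rw [Finset.mem_coe, Finset.mem_biUnion]
    exact ⟨j, hj, arc_box hδ p (by linarith) hp1 j w hw⟩
  have hfin : (idx2 δ '' U).Finite := Set.Finite.subset (Finset.finite_toSet _) hsub
  have hcU : (count2 δ U : ℝ) ≤ 289 * Ej.card := by
    unfold count2
    rw [Nat.card_coe_set_eq]
    have h1 := Set.ncard_le_ncard hsub (Finset.finite_toSet _)
    rw [Set.ncard_coe_finset] at h1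
    have h2 := Finset.card_biUnion_le (s := Ej) (t := fun j => box δ (arcCenterAt p δ j))
    simp only [box_card, Finset.sum_const, smul_eq_mul] at h2
    have h3 := h1.trans h2
    have : ((idx2 δ '' U).ncard : ℝ) ≤ ((Ej.card * 289 : ℕ) : ℝ) := by exact_mod_cast h3
    push_cast at this; linarith
  have hb := h.2 (p.1 + p.2 • dir φ) ρ hρ
  obtain ⟨f, hf⟩ : ∃ f : ℤ → ℤ × ℤ, f = fun j => idx2 δ (arcCenterAt p δ j) := ⟨_, rfl⟩
  have hS1 : ((S.image f).card : ℝ) ≤ count2 δ (U ∩ closedBall (p.1 + p.2 • dir φ) ρ) := by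
    unfold count2
    rw [Nat.card_coe_set_eq, ← Set.ncard_coe_finset]
    have : (S.image f : Set (ℤ × ℤ)) ⊆ idx2 δ '' (U ∩ closedBall (p.1 + p.2 • dir φ) ρ) := by
      intro x hx
      rw [Finset.mem_coe, Finset.mem_image] at hx
      obtain ⟨j, hj, rfl⟩ := hx
      rw [hf]
      refine ⟨_, ⟨?_, ?_⟩, rfl⟩
      · rw [hU]
        simp only [Set.mem_iUnion]
        exact ⟨j, hS hj, ctr_in_arc hδ p j⟩
      · rw [mem_closedBall]
        exact (pt_dist_le p (by linarith) hp1 _ _).trans (hφ j hj)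
    exact_mod_cast Set.ncard_le_ncard this (hfin.subset (Set.image_mono Set.inter_subset_left))
  have hS2 : (S.card : ℝ) ≤ 6 * (S.image f).card := by
    have h1 := Finset.card_le_mul_card_image (f := f) S 6 (by
      intro b _
      have := arc_card (S.filter (fun j => f j = b)) δ (2 * (2 * δ)) hδ hδ1 (by linarith)
        (fun j hj => hv j (hS (Finset.mem_filter.1 hj).1)) (by
          intro i hi j hj
          rw [Finset.mem_filter] at hi hj
          have hij := hi.2.trans hj.2.symm
          rw [hf] at hij
          exact dir_of_pt p hp _ _ _ (idx2_same hδ _ _ hij))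
      rw [show 2 * (2 * δ) / (4 * δ) = 1 by field_simp; norm_num] at this
      have h2 : ((S.filter (fun j => f j = b)).card : ℝ) ≤ (6:ℕ) := by push_cast; linarith
      exact_mod_cast h2)
    exact_mod_cast h1
  have hρs : 0 ≤ B * ρ ^ s := mul_nonneg hB (Real.rpow_nonneg (hδ.le.trans hρ) s)
  have := mul_le_mul_of_nonneg_left hcU hρs
  linarith
end
end

section
open Metric Set
noncomputable section

theorem frP_aux {δ s B : ℝ} (hδ : 0 < δ) (hB : 0 ≤ B)
    (Pk : Finset CubeIdx) (h : IsDSet3 δ s B (⋃ k ∈ (Pk : Set CubeIdx), cubeSet δ k))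
    (S : Finset CubeIdx) (hS : S ⊆ Pk) (x : Pt) (ρ : ℝ) (hρ : δ ≤ ρ) (hx : ∀ k ∈ S, ‖toP δ k - x‖ ≤ ρ) :
    (S.card : ℝ) ≤ B * (2 * ρ) ^ s * Pk.card := by
  classical
  obtain ⟨U, hU⟩ : ∃ U, U = (⋃ k ∈ (Pk : Set CubeIdx), cubeSet δ k) := ⟨_, rfl⟩
  rw [← hU] at h
  have hsub : idx3 δ '' U ⊆ (Pk : Set CubeIdx) := by
    rintro _ ⟨w, hw, rfl⟩
    rw [hU] at hw
    simp only [Set.mem_iUnion] at hw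
    obtain ⟨j, hj, hw⟩ := hw
    rw [idx3_cube hδ hw]; exact hj
  have hfin : (idx3 δ '' U).Finite := Set.Finite.subset (Finset.finite_toSet _) hsub
  have hcU : (count3 δ U : ℝ) ≤ Pk.card := by
    unfold count3
    rw [Nat.card_coe_set_eq]
    have h1 := Set.ncard_le_ncard hsub (Finset.finite_toSet _)
    rw [Set.ncard_coe_finset] at h1
    exact_mod_cast h1
  have hb := h.2 (mk2 x.1 x.2.1, x.2.2) (2 * ρ) (by linarith)
  have hS1 : (S.card : ℝ) ≤ count3 δ (U ∩ {q | pdist q (mk2 x.1 x.2.1, x.2.2) ≤ 2 * ρ}) := by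
    unfold count3
    rw [Nat.card_coe_set_eq, ← Set.ncard_coe_finset]
    have : (S : Set CubeIdx) ⊆ idx3 δ '' (U ∩ {q | pdist q (mk2 x.1 x.2.1, x.2.2) ≤ 2 * ρ}) := by
      intro k hk
      refine ⟨cubeCtr δ k, ⟨?_, ?_⟩, idx3_cube hδ (ctr_mem hδ k)⟩
      · rw [hU]
        simp only [Set.mem_iUnion]
        exact ⟨k, hS hk, ctr_mem hδ k⟩
      · have h1 := hx k hk
        obtain ⟨a1, a2, a3⟩ := nrm_coord (toP δ k - x)
        have b1 := pow_le_pow_left₀ (abs_nonneg _) (a1.trans h1) 2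
        have b2 := pow_le_pow_left₀ (abs_nonneg _) (a2.trans h1) 2
        have b3 := pow_le_pow_left₀ (abs_nonneg _) (a3.trans h1) 2
        rw [sq_abs] at b1 b2 b3
        rw [Set.mem_ofPred_eq]
        unfold pdist
        rw [Real.sqrt_le_iff]
        refine ⟨by linarith, ?_⟩
        rw [dist_sq2]
        have e0 : (cubeCtr δ k).1 0 = (toP δ k).1 := mk2_0 _ _
        have e1 : (cubeCtr δ k).1 1 = (toP δ k).2.1 := mk2_1 _ _
        have e2 : (cubeCtr δ k).2 = (toP δ k).2.2 := rfl
        rw [e0, e1, e2, mk2_0, mk2_1]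
        simp only [Prod.fst_sub, Prod.snd_sub] at b1 b2 b3
        nlinarith [sq_nonneg ρ]
    exact_mod_cast Set.ncard_le_ncard this (hfin.subset (Set.image_mono Set.inter_subset_left))
  have hρs : 0 ≤ B * (2 * ρ) ^ s := mul_nonneg hB (Real.rpow_nonneg (by linarith) s)
  have := mul_le_mul_of_nonneg_left hcU hρs
  linarith

theorem int_box {δ : ℝ} (hδ : 0 < δ) (a : ℤ) (h : |((a:ℝ) + 1 / 2) * δ| ≤ 1) :
    a ∈ Finset.Icc (-(⌈δ⁻¹⌉ + 1)) (⌈δ⁻¹⌉ + 1) := by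
  have h1 := Int.le_ceil δ⁻¹
  have h0 := one_div δ
  rw [abs_mul, abs_of_pos hδ, ← le_div_iff₀ hδ, one_div, abs_le] at h
  rw [Finset.mem_Icc]
  constructor
  · have : -((⌈δ⁻¹⌉:ℝ) + 1) ≤ a := by linarith
    exact_mod_cast this
  · have : (a:ℝ) ≤ ⌈δ⁻¹⌉ + 1 := by linarith
    exact_mod_cast this

theorem cubes_fin {δ : ℝ} (hδ : 0 < δ) (Q : Set CubeIdx) (h : ∀ k ∈ Q, cubeSet δ k ⊆ domD) : Q.Finite := by
  refine Set.Finite.subset (Finset.finite_toSet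
    (((Finset.Icc (-(⌈δ⁻¹⌉ + 1)) (⌈δ⁻¹⌉ + 1)) ×ˢ (Finset.Icc (-(⌈δ⁻¹⌉ + 1)) (⌈δ⁻¹⌉ + 1))) ×ˢ (Finset.Icc (-(⌈δ⁻¹⌉ + 1)) (⌈δ⁻¹⌉ + 1)))) ?_
  intro k hk
  obtain ⟨h1, h2, h3⟩ := ctr_reg hδ (h k hk)
  obtain ⟨q1, q2⟩ := quarter h1
  rw [Finset.mem_coe, Finset.mem_product, Finset.mem_product]
  refine ⟨⟨int_box hδ _ (q1.trans (by norm_num)), int_box hδ _ (q2.trans (by norm_num))⟩, int_box hδ _ ?_⟩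
  rw [abs_le]
  unfold toP at h2 h3
  exact ⟨by linarith, h3⟩

theorem arcs_fin {σ : ℝ} (Q : Set ℤ) (h : ∀ j ∈ Q, validArc σ j) : Q.Finite := by
  refine Set.Finite.subset (Finset.finite_toSet (Finset.Icc 0 ⌈σ⁻¹⌉)) ?_
  intro j hj
  obtain ⟨h1, h2⟩ := h j hj
  rw [Finset.mem_coe, Finset.mem_Icc]
  refine ⟨h1, ?_⟩
  have : (j:ℝ) < ⌈σ⁻¹⌉ := h2.trans_le (Int.le_ceil _)
  exact_mod_cast this.le

theorem ang_rng {δ : ℝ} (hδ : 0 < δ) (hδ2 : δ ≤ 1 / 100) (j : ℤ) (h : validArc δ j) : 0 ≤ ang δ j ∧ ang δ j ≤ 7 := by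
  obtain ⟨h1, h2⟩ := h
  have h1' : (0:ℝ) ≤ j := by exact_mod_cast h1
  have hpi := Real.pi_lt_d2
  have hpi0 := Real.pi_pos
  unfold ang
  refine ⟨by positivity, ?_⟩
  have h3 := mul_lt_mul_of_pos_right h2 hδ
  rw [inv_mul_cancel₀ hδ.ne'] at h3
  have h4 : ((j:ℝ) + 1 / 2) * δ ≤ 1.005 := by linarith
  have h5 := mul_le_mul h4 (show 2 * Real.pi ≤ 6.3 by linarith) (by positivity) (by norm_num)
  linarith

theorem mk_cfg {δ s B A : ℝ} {K M : ℕ} {Ω : Set DPair} (hδ : 0 < δ) (hδ2 : δ ≤ 1 / 100) (hs : 0 < s) (hs1 : s ≤ 1)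
    (hB : 10000 ≤ B) (hA : A = B ^ 4) (hK : δ * A ^ K = 1) (hKB : 100 * ((K:ℝ) + 2) ^ 3 ≤ B)
    (hΩ : IsConfigD δ δ s B M Ω) (hc : (Nat.card (configP Ω) : ℝ) ≤ δ ^ (-s) * B)
    (Pk : Finset CubeIdx) (hPk : (Pk : Set CubeIdx) = configP Ω)
    (Ek : CubeIdx → Finset ℤ) (hEk : ∀ k, (Ek k : Set ℤ) = configE Ω k) :
    ∃ L, Cfg A δ s (Pk.image (toP δ)) (fun p => (Ek (ofP δ p)).image (ang δ)) M L := by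
  classical
  obtain ⟨-, hD, hP, hE⟩ := hΩ
  have hB0 : 0 < B := by linarith
  have hBA : B ≤ A := by rw [hA]; exact le_self_pow₀ (by linarith) (by norm_num)
  have hA0 : 0 < A := by linarith
  have hK0 : (0:ℝ) ≤ K := Nat.cast_nonneg K
  have hmem : ∀ k ∈ Pk, k ∈ configP Ω := fun k hk => by rw [← hPk]; exact hk
  have hcP : (Pk.card : ℝ) ≤ δ ^ (-s) * B := by
    rw [← hPk, Nat.card_coe_set_eq, Set.ncard_coe_finset] at hc; exact hc
  have hδs : δ ^ (-s) ≤ A ^ K := by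
    have e : A ^ K = δ⁻¹ := eq_inv_of_mul_eq_one_right hK
    rw [e, Real.rpow_neg hδ.le, ← Real.inv_rpow hδ.le]
    have h1 : 1 ≤ δ⁻¹ := (one_le_inv₀ hδ).2 (by linarith)
    have := Real.rpow_le_rpow_of_exponent_le h1 hs1
    rwa [Real.rpow_one] at this
  have hci : (Pk.image (toP δ)).card = Pk.card := Finset.card_image_of_injective _ (toP_inj hδ)
  have hEv : ∀ k ∈ Pk, ∀ j ∈ Ek k, validArc δ j := by
    intro k hk j hj
    refine (hE k (hmem k hk)).1 j ?_
    rw [← hEk]; exact hj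
  have hcE : ∀ k ∈ Pk, (Ek k).card = M := by
    intro k hk
    have := (hE k (hmem k hk)).2.2
    rw [← hEk, Nat.card_coe_set_eq, Set.ncard_coe_finset] at this
    exact this
  refine ⟨(K + 1) * ⌈A⌉₊ + 1, ⟨by linarith, hδ, by linarith, hs, hs1, ?_, ?_, ?_, ?_, ?_, ?_, ?_⟩⟩
  · intro p hp
    obtain ⟨k, hk, rfl⟩ := Finset.mem_image.1 hp
    exact ctr_reg hδ (hD k (hmem k hk))
  · intro p hp
    obtain ⟨k, hk, rfl⟩ := Finset.mem_image.1 hp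
    simp only [ofP_toP hδ]
    rw [Finset.card_image_of_injective _ (ang_inj hδ), hcE k hk]
  · intro p hp θ hθ
    obtain ⟨k, hk, rfl⟩ := Finset.mem_image.1 hp
    simp only [ofP_toP hδ] at hθ
    obtain ⟨j, hj, rfl⟩ := Finset.mem_image.1 hθ
    exact ang_rng hδ hδ2 j (hEv k hk j hj)
  · intro p hp S hS φ ρ hρ hφ
    obtain ⟨k, hk, rfl⟩ := Finset.mem_image.1 hp
    simp only [ofP_toP hδ] at hS
    obtain ⟨S', hS', rfl⟩ := Finset.subset_image_iff.1 hS
    have r := ctr_reg hδ (hD k (hmem k hk))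
    have hd := (hE k (hmem k hk)).2.1
    rw [← hEk] at hd
    have h1 := frE_aux hδ (by linarith) hB0.le (cubeCtr δ k) r.2.1 r.2.2 (Ek k) (hEv k hk) hd S' hS' φ ρ hρ
      (fun j hj => hφ _ (Finset.mem_image_of_mem _ hj))
    rw [Finset.card_image_of_injective _ (ang_inj hδ)]
    rw [hcE k hk] at h1
    have h2 : 1734 * B ≤ A := by
      have h3 : B ^ 2 ≤ A := by rw [hA]; exact pow_le_pow_right₀ (by linarith) (by norm_num)
      nlinarith
    have h4 := mul_le_mul_of_nonneg_right h2 (show 0 ≤ (M:ℝ) * ρ ^ s from mul_nonneg (Nat.cast_nonneg _) (Real.rpow_nonneg (hδ.le.trans hρ) s))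
    linarith
  · intro S hS x ρ hρ hx
    obtain ⟨S', hS', rfl⟩ := Finset.subset_image_iff.1 hS
    rw [← hPk] at hP
    have h1 := frP_aux hδ hB0.le Pk hP S' hS' x ρ hρ (fun k hk => hx _ (Finset.mem_image_of_mem _ hk))
    rw [Finset.card_image_of_injective _ (toP_inj hδ)]
    have hρ0 : 0 ≤ ρ := hδ.le.trans hρ
    rw [Real.mul_rpow (by norm_num) hρ0] at h1
    rw [Real.div_rpow hρ0 hδ.le]
    have h2 : (2:ℝ) ^ s ≤ 2 := by
      have := Real.rpow_le_rpow_of_exponent_le (show (1:ℝ) ≤ 2 by norm_num) hs1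
      rwa [Real.rpow_one] at this
    have hr : 0 ≤ ρ ^ s := Real.rpow_nonneg hρ0 s
    have h3 : B * (2 ^ s * ρ ^ s) * Pk.card ≤ B * (2 * ρ ^ s) * (δ ^ (-s) * B) :=
      mul_le_mul (mul_le_mul_of_nonneg_left (mul_le_mul_of_nonneg_right h2 hr) hB0.le) hcP (Nat.cast_nonneg _) (by positivity)
    rw [Real.rpow_neg hδ.le] at h3
    have h4 : 2 * B ^ 2 ≤ A := by
      have : B ^ 3 ≤ A := by rw [hA]; exact pow_le_pow_right₀ (by linarith) (by norm_num)
      nlinarith [sq_nonneg B]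
    have hd : 0 ≤ (δ ^ s)⁻¹ := inv_nonneg.2 (Real.rpow_nonneg hδ.le s)
    have h5 := mul_le_mul_of_nonneg_right h4 (mul_nonneg hr hd)
    rw [div_eq_mul_inv]
    linarith
  · rw [hci]
    have h1 : (Pk.card : ℝ) ≤ A ^ (K + 1) := by
      rw [pow_succ]
      exact hcP.trans (mul_le_mul hδs hBA hB0.le (by positivity))
    have h2 : A ≤ 2 ^ ⌈A⌉₊ := (Nat.le_ceil A).trans (by exact_mod_cast Nat.lt_two_pow_self.le)
    have h3 : A ^ (K + 1) ≤ 2 ^ ((K + 1) * ⌈A⌉₊) := by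
      rw [mul_comm, pow_mul]
      exact pow_le_pow_left₀ hA0.le h2 _
    have h4 : Pk.card ≤ 2 ^ ((K + 1) * ⌈A⌉₊) := by exact_mod_cast h1.trans h3
    exact h4.trans_lt (Nat.pow_lt_pow_right (by norm_num) (by omega))
  · push_cast
    have h1 : (⌈A⌉₊:ℝ) ≤ A + 1 := (Nat.ceil_lt_add_one hA0.le).le
    have h2 := mul_le_mul_of_nonneg_left h1 (show 0 ≤ (K:ℝ) + 1 by linarith)
    have h3 : 100 * ((K:ℝ) + 2) ≤ A := by nlinarith [mul_nonneg hK0 hK0, mul_nonneg (mul_nonneg hK0 hK0) hK0]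
    have h4 := mul_le_mul_of_nonneg_right h3 hA0.le
    nlinarith [mul_nonneg hK0 hA0.le]
end
end

section
open Metric Set
noncomputable section

theorem mult_bd {δ s A B C σ lam t : ℝ} {Ω G : Set DPair} (hδ : 0 < δ) (hs : 0 < s) (hs1 : s ≤ 1)
    (hB : 10000 ≤ B) (hA : A = B ^ 4) (hC1 : 1 ≤ C) (hCB : C ≤ B) (hδB : B * δ ≤ 1 / 4)
    (hD : ∀ k ∈ configP Ω, cubeSet δ k ⊆ domD)
    (Pk : Finset CubeIdx) (hPk : (Pk : Set CubeIdx) = configP Ω) (hG : G ⊆ Ω) (ω : DPair) (hω : ω ∈ G)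
    (hgood : ∀ i : ℕ, ∀ S ⊆ Pk.image (toP δ), (∀ q ∈ S, |incF (toP δ ω.1) (ang δ ω.2) q| ≤ δ * A ^ i) →
      (S.card : ℝ) ≤ A ^ 51 * (A ^ i) ^ s)
    (hlam : δ ≤ lam) (hlt : lam ≤ t) (ht : t ≤ 1) (hσ : 0 < σ) (hσ1 : σ ≤ 1) (hσ2 : σ ≤ 2 * (δ / Real.sqrt (lam * t))) :
    (pMult δ δ δ σ lam t B B C G (cubeCtr δ ω.1) (arcCenterAt (cubeCtr δ ω.1) δ ω.2) : ℝ) ≤ A ^ 53 := by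
  classical
  have hB0 : 0 < B := by linarith
  have hBA : B ≤ A := by rw [hA]; exact le_self_pow₀ (by linarith) (by norm_num)
  have hA0 : 0 < A := by linarith
  have hωP : cubeSet δ ω.1 ⊆ domD := hD _ ⟨ω, hG hω, rfl⟩
  unfold pMult
  obtain ⟨X, hX⟩ : ∃ X, X = {ω' : DPair | ω' ∈ skeleton δ δ δ σ G ∧
    (lam ≤ B * δ ∨ lam / B ≤ tang (cubeCtr δ ω.1) (cubeCtr δ ω'.1)) ∧
    tang (cubeCtr δ ω.1) (cubeCtr δ ω'.1) ≤ B * lam ∧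
    t / B ≤ pdist (cubeCtr δ ω.1) (cubeCtr δ ω'.1) ∧
    pdist (cubeCtr δ ω.1) (cubeCtr δ ω'.1) ≤ B * t ∧
    (rect (C * δ) (C * σ) (cubeCtr δ ω.1) (arcCenterAt (cubeCtr δ ω.1) δ ω.2) ∩
      rect (C * δ) (C * σ) (cubeCtr δ ω'.1) (arcCenterAt (cubeCtr δ ω'.1) σ ω'.2)).Nonempty} := ⟨_, rfl⟩
  rw [← hX]
  have hXP : ∀ ω' ∈ X, ω'.1 ∈ configP Ω ∧ validArc σ ω'.2 ∧
      |incF (toP δ ω.1) (ang δ ω.2) (toP δ ω'.1)| ≤ δ * A ^ 1 ∧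
      dist (arcCenterAt (cubeCtr δ ω'.1) σ ω'.2) (arcCenterAt (cubeCtr δ ω.1) δ ω.2) ≤ 2 * C * σ := by
    intro ω' hω'
    rw [hX] at hω'
    obtain ⟨⟨h1, h2, ω0, h3, h4, -⟩, -, h5, -, h6, h7⟩ := hω'
    have e := cube_sub hδ h4
    obtain ⟨g1, g2⟩ := geom_main hδ hωP h1 hC1 (by linarith) hlam hlt ht hσ.le hσ2
      (by
        have := mul_le_mul_of_nonneg_right hCB hδ.le
        linarith) h5 h6 h7
    refine ⟨?_, h2, g1.trans ?_, g2⟩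
    · rw [← e]; exact ⟨ω0, hG h3, rfl⟩
    · rw [pow_one, mul_comm]
      refine mul_le_mul_of_nonneg_left ?_ hδ.le
      have a1 : C ^ 2 * B ≤ B ^ 2 * B := mul_le_mul_of_nonneg_right (pow_le_pow_left₀ (by linarith) hCB 2) hB0.le
      have a2 : 129 * B ^ 3 ≤ B * B ^ 3 := mul_le_mul_of_nonneg_right (by linarith) (by positivity)
      rw [hA]
      linarith
  have hXf : X.Finite := by
    refine Set.Finite.subset ((Finset.finite_toSet Pk).prod (arcs_fin {j | validArc σ j} (fun j hj => hj))) ?_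
    intro ω' hω'
    obtain ⟨h1, h2, -⟩ := hXP ω' hω'
    exact ⟨by rw [hPk]; exact h1, h2⟩
  rw [Nat.card_coe_set_eq, Set.ncard_eq_toFinset_card X hXf]
  obtain ⟨Y, hY⟩ : ∃ Y, Y = hXf.toFinset := ⟨_, rfl⟩
  rw [← hY]
  have hYm : ∀ y ∈ Y, y ∈ X := fun y hy => by rw [hY] at hy; exact (hXf.mem_toFinset).1 hy
  have hfib : ∀ b ∈ Y.image Prod.fst, ((Y.filter (fun y => y.1 = b)).card : ℝ) ≤ A := by
    intro b _
    have hinj : ((Y.filter (fun y => y.1 = b)).image Prod.snd).card = (Y.filter (fun y => y.1 = b)).card := by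
      refine Finset.card_image_of_injOn ?_
      intro x hx y hy hxy
      have hx' := (Finset.mem_filter.1 (Finset.mem_coe.1 hx)).2
      have hy' := (Finset.mem_filter.1 (Finset.mem_coe.1 hy)).2
      exact Prod.ext (hx'.trans hy'.symm) hxy
    rw [← hinj]
    have hel : ∀ j ∈ (Y.filter (fun y => y.1 = b)).image Prod.snd, (b, j) ∈ X := by
      intro j hj
      obtain ⟨y, hy, rfl⟩ := Finset.mem_image.1 hj
      rw [Finset.mem_filter] at hy
      rw [← hy.2]; exact hYm y hy.1
    have := arc_card ((Y.filter (fun y => y.1 = b)).image Prod.snd) σ (2 * (4 * C * σ)) hσ hσ1 (by positivity)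
      (fun j hj => (hXP _ (hel j hj)).2.1) (by
        intro i hi j hj
        obtain ⟨a1, -, -, a4⟩ := hXP _ (hel i hi)
        obtain ⟨-, -, -, b4⟩ := hXP _ (hel j hj)
        have r := (ctr_reg hδ (hD _ a1)).2.1
        refine dir_of_pt (cubeCtr δ b) r _ _ _ ?_
        have := dist_triangle_right (arcCenterAt (cubeCtr δ b) σ i) (arcCenterAt (cubeCtr δ b) σ j) (arcCenterAt (cubeCtr δ ω.1) δ ω.2)
        simp only at a4 b4
        refine this.trans ?_
        linarith)
    refine this.trans ?_
    rw [show 2 * (4 * C * σ) / (4 * σ) = 2 * C by field_simp]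
    have : B * B ≤ A := by
      have h3 : B ^ 2 ≤ A := by rw [hA]; exact pow_le_pow_right₀ (by linarith) (by norm_num)
      linarith
    nlinarith
  have hs := hgood 1 ((Y.image Prod.fst).image (toP δ)) (by
      refine Finset.image_subset_image ?_
      intro k hk
      obtain ⟨y, hy, rfl⟩ := Finset.mem_image.1 hk
      rw [← Finset.mem_coe, hPk]
      exact (hXP y (hYm y hy)).1) (by
      intro q hq
      obtain ⟨k, hk, rfl⟩ := Finset.mem_image.1 hq
      obtain ⟨y, hy, rfl⟩ := Finset.mem_image.1 hk
      exact (hXP y (hYm y hy)).2.2.1)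
  rw [Finset.card_image_of_injective _ (toP_inj hδ), pow_one] at hs
  have hAs : A ^ s ≤ A := by
    have := Real.rpow_le_rpow_of_exponent_le (show 1 ≤ A by linarith) hs1
    rwa [Real.rpow_one] at this
  rw [Finset.card_eq_sum_card_image Prod.fst Y]
  push_cast
  refine (Finset.sum_le_sum hfib).trans ?_
  rw [Finset.sum_const, nsmul_eq_mul]
  have h1 := mul_le_mul_of_nonneg_left hAs (show 0 ≤ A ^ 51 by positivity)
  have h2 := mul_le_mul_of_nonneg_right (hs.trans h1) hA0.le
  calc _ ≤ _ := h2
    _ = A ^ 53 := by ring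

theorem reduce {δ s A B C : ℝ} {K M : ℕ} {Ω : Set DPair} (hδ : 0 < δ) (hδ2 : δ ≤ 1 / 100) (hs : 0 < s) (hs1 : s ≤ 1)
    (hB : 10000 ≤ B) (hA : A = B ^ 4) (hK : δ * A ^ K = 1) (hKB : 100 * ((K:ℝ) + 2) ^ 3 ≤ B)
    (hC1 : 1 ≤ C) (hCB : C ≤ B) (hδB : B * δ ≤ 1 / 4)
    (hΩ : IsConfigD δ δ s B M Ω) (hc : (Nat.card (configP Ω) : ℝ) ≤ δ ^ (-s) * B) :
    ∃ G ⊆ Ω, (Nat.card Ω : ℝ) ≤ 2 * (Nat.card G : ℝ) ∧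
      ∀ lam t : ℝ, δ ≤ lam → lam ≤ t → t ≤ 1 → ∀ ω ∈ G,
        (pMult δ δ δ (dyadicCeil (δ / Real.sqrt (lam * t))) lam t B B C G
          (cubeCtr δ ω.1) (arcCenterAt (cubeCtr δ ω.1) δ ω.2) : ℝ) ≤ A ^ 53 := by
  classical
  have hD := hΩ.2.1
  have hPfin : (configP Ω).Finite := cubes_fin hδ _ hD
  have hEfin : ∀ k, (configE Ω k).Finite := by
    intro k
    by_cases hk : k ∈ configP Ω
    · exact arcs_fin _ (hΩ.2.2.2 k hk).1
    · have : configE Ω k = ∅ := by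
        rw [Set.eq_empty_iff_forall_notMem]
        intro j hj
        exact hk ⟨(k, j), hj, rfl⟩
      rw [this]; exact Set.finite_empty
  obtain ⟨Pk, hPk⟩ : ∃ Pk : Finset CubeIdx, (Pk : Set CubeIdx) = configP Ω := ⟨hPfin.toFinset, hPfin.coe_toFinset⟩
  obtain ⟨Ek, hEk⟩ : ∃ Ek : CubeIdx → Finset ℤ, ∀ k, (Ek k : Set ℤ) = configE Ω k :=
    ⟨fun k => (hEfin k).toFinset, fun k => (hEfin k).coe_toFinset⟩
  obtain ⟨L, hcfg⟩ := mk_cfg hδ hδ2 hs hs1 hB hA hK hKB hΩ hc Pk hPk Ek hEk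
  have hBA : B ≤ A := by rw [hA]; exact le_self_pow₀ (by linarith) (by norm_num)
  have hK0 : (0:ℝ) ≤ ((K:ℝ) + 2) ^ 3 := by positivity
  obtain ⟨Gs, hGs, hcard, hgood⟩ := main_ind hcfg K hK (by linarith)
  obtain ⟨f, hf⟩ : ∃ f : DPair → (Σ _ : Pt, ℝ), f = fun ω => ⟨toP δ ω.1, ang δ ω.2⟩ := ⟨_, rfl⟩
  have hfinj : Function.Injective f := by
    intro a b h
    rw [hf] at h
    simp only [Sigma.mk.injEq, heq_eq_eq] at h
    exact Prod.ext (toP_inj hδ h.1) (ang_inj hδ h.2)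
  have hΩfin : Ω.Finite := by
    refine Set.Finite.subset ((Finset.finite_toSet (Pk.sigma Ek)).image (fun x => ((x.1, x.2) : DPair))) ?_
    intro ω hω
    refine ⟨⟨ω.1, ω.2⟩, ?_, rfl⟩
    rw [Finset.mem_coe, Finset.mem_sigma]
    constructor
    · rw [← Finset.mem_coe, hPk]; exact ⟨ω, hω, rfl⟩
    · rw [← Finset.mem_coe, hEk]; exact hω
  have hmap : f '' Ω ⊆ (((Pk.image (toP δ)).sigma (fun p => (Ek (ofP δ p)).image (ang δ)) : Finset (Σ _ : Pt, ℝ)) : Set (Σ _ : Pt, ℝ)) := by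
    rintro _ ⟨ω, hω, rfl⟩
    rw [hf, Finset.mem_coe, Finset.mem_sigma]
    constructor
    · refine Finset.mem_image_of_mem _ ?_
      rw [← Finset.mem_coe, hPk]; exact ⟨ω, hω, rfl⟩
    · simp only [ofP_toP hδ]
      refine Finset.mem_image_of_mem _ ?_
      rw [← Finset.mem_coe, hEk]; exact hω
  have hc1 : Nat.card Ω ≤ ((Pk.image (toP δ)).sigma (fun p => (Ek (ofP δ p)).image (ang δ))).card := by
    rw [Nat.card_coe_set_eq, ← Set.ncard_image_of_injective Ω hfinj, ← Set.ncard_coe_finset]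
    exact Set.ncard_le_ncard hmap (Finset.finite_toSet _)
  obtain ⟨G, hG⟩ : ∃ G, G = {ω | ω ∈ Ω ∧ f ω ∈ Gs} := ⟨_, rfl⟩
  have hGΩ : G ⊆ Ω := by rw [hG]; exact fun ω h => h.1
  have hc2 : Gs.card ≤ Nat.card G := by
    rw [Nat.card_coe_set_eq, ← Set.ncard_image_of_injective G hfinj, ← Set.ncard_coe_finset]
    refine Set.ncard_le_ncard ?_ ((hΩfin.subset hGΩ).image f)
    intro x hx
    have hx' := hGs hx
    obtain ⟨xp, xθ⟩ := x
    rw [Finset.mem_sigma] at hx'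
    obtain ⟨h1, h2⟩ := hx'
    obtain ⟨k, hk, h1⟩ := Finset.mem_image.1 h1
    simp only at h1 h2
    subst h1
    rw [ofP_toP hδ] at h2
    obtain ⟨j, hj, h2⟩ := Finset.mem_image.1 h2
    subst h2
    have e : f (k, j) = ⟨toP δ k, ang δ j⟩ := by rw [hf]
    refine ⟨(k, j), ?_, e⟩
    rw [hG]
    refine ⟨?_, by rw [e]; exact hx⟩
    rw [← Finset.mem_coe, hEk] at hj
    exact hj
  refine ⟨G, hGΩ, ?_, ?_⟩
  · have a1 : (Nat.card Ω : ℝ) ≤ ((Pk.image (toP δ)).sigma (fun p => (Ek (ofP δ p)).image (ang δ))).card := by exact_mod_cast hc1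
    have a2 : (Gs.card : ℝ) ≤ Nat.card G := by exact_mod_cast hc2
    linarith
  · intro lam t hlam hlt ht ω hω
    have hl0 : 0 < lam := by linarith
    have ht0 : 0 < t := by linarith
    have hq : 0 < Real.sqrt (lam * t) := Real.sqrt_pos.2 (mul_pos hl0 ht0)
    have hδq : δ ≤ Real.sqrt (lam * t) := by
      refine Real.le_sqrt_of_sq_le ?_
      rw [sq]; exact mul_le_mul hlam (hlam.trans hlt) hδ.le hl0.le
    obtain ⟨-, c2, c3, c4⟩ := ceil_bd (div_pos hδ hq) ((div_le_one hq).2 hδq)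
    have hω' := hω
    rw [hG] at hω'
    have hg := hgood _ hω'.2
    rw [hf] at hg
    exact mult_bd hδ hs hs1 hB hA hC1 hCB hδB hD Pk hPk hGΩ ω hω hg hlam hlt ht c4 c3 c2

theorem final_thm :
    ∀ κ : ℝ, 0 < κ → κ ≤ 1 / 2 → ∀ s : ℝ, 0 < s → s ≤ 1 →
    ∃ ε > (0 : ℝ), ∃ δ₀ > (0 : ℝ), ∀ δ : ℝ, 0 < δ → δ ≤ δ₀ →
      ∀ (Ω : Set DPair) (M : ℕ), IsConfigD δ δ s (δ ^ (-ε)) M Ω →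
        (Nat.card (configP Ω) : ℝ) ≤ δ ^ (-s - ε) →
        ∃ G ⊆ Ω, δ ^ κ * (Nat.card Ω : ℝ) ≤ (Nat.card G : ℝ) ∧
          ∀ lam t : ℝ, δ ≤ lam → lam ≤ t → t ≤ 1 → ∀ ω ∈ G,
            (pMult δ δ δ (dyadicCeil (δ / Real.sqrt (lam * t))) lam t
                (δ ^ (-ε)) (δ ^ (-ε)) κ⁻¹ G
                (cubeCtr δ ω.1) (arcCenterAt (cubeCtr δ ω.1) δ ω.2) : ℝ) ≤ δ ^ (-κ) := by
  intro κ hκ hκ2 s hs hs1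
  obtain ⟨K, hK⟩ : ∃ K : ℕ, 53 / κ ≤ K := exists_nat_ge _
  have hK0 : (0:ℝ) < K := lt_of_lt_of_le (by positivity) hK
  have hKκ : 53 ≤ κ * K := by rw [div_le_iff₀ hκ] at hK; linarith
  have hκi : 0 < κ⁻¹ := inv_pos.2 hκ
  obtain ⟨B0, hB0⟩ : ∃ B0 : ℝ, B0 = 10000 + 100 * ((K:ℝ) + 2) ^ 3 + κ⁻¹ := ⟨_, rfl⟩
  have hK3 : 0 ≤ 100 * ((K:ℝ) + 2) ^ 3 := by positivity
  have hB0p : 0 < B0 := by linarith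
  obtain ⟨ε, hε⟩ : ∃ ε : ℝ, ε = 1 / (4 * K) := ⟨_, rfl⟩
  have hε0 : 0 < ε := by rw [hε]; positivity
  have hεK : ε * (4 * K) = 1 := by rw [hε]; field_simp
  refine ⟨ε, hε0, (B0 ^ (4 * K))⁻¹, by positivity, ?_⟩
  intro δ hδ hδ0 Ω M hΩ hc
  obtain ⟨B, hB⟩ : ∃ B : ℝ, B = δ ^ (-ε) := ⟨_, rfl⟩
  have hBp : 0 < B := by rw [hB]; exact Real.rpow_pos_of_pos hδ _
  have hBpow : ∀ n : ℕ, B ^ n = δ ^ (-(ε * n)) := by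
    intro n
    rw [hB, ← Real.rpow_natCast, ← Real.rpow_mul hδ.le]
    congr 1; ring
  have hBK : B ^ (4 * K) = δ⁻¹ := by
    rw [hBpow]; push_cast; rw [hεK, Real.rpow_neg_one]
  have hK1 : K ≠ 0 := by rintro rfl; simp at hK0
  have hBB : B0 ≤ B := by
    refine le_of_pow_le_pow_left₀ (n := 4 * K) (by omega) hBp.le ?_
    rw [hBK]
    exact (le_inv_comm₀ hδ (by positivity)).1 hδ0
  have hB1 : 1 ≤ B := by linarith
  have hδ1 : δ * B ^ (4 * K) = 1 := by rw [hBK, mul_inv_cancel₀ hδ.ne']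
  have hδB2 : δ * B ^ 2 ≤ 1 := by
    rw [← hδ1]
    exact mul_le_mul_of_nonneg_left (pow_le_pow_right₀ hB1 (by omega)) hδ.le
  have hδB : B * δ ≤ 1 / 10000 := by
    have : 10000 * (B * δ) ≤ B * (B * δ) := mul_le_mul_of_nonneg_right (by linarith) (by positivity)
    linarith
  have hδ100 : δ ≤ 1 / 100 := by
    have : 1 * δ ≤ B * δ := mul_le_mul_of_nonneg_right hB1 hδ.le
    linarith
  rw [← hB] at hΩ ⊢
  obtain ⟨G, hG, h1, h2⟩ := reduce (K := K) hδ hδ100 hs hs1 (by linarith) rfl (by rw [← pow_mul]; exact hδ1) (by linarith)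
    (C := κ⁻¹) ((one_le_inv₀ hκ).2 (by linarith)) (by linarith) (by linarith) hΩ (by
      rw [hB, ← Real.rpow_add hδ]; exact hc)
  have hfin : (B ^ 4) ^ 53 ≤ δ ^ (-κ) := by
    rw [← pow_mul, hBpow]
    refine Real.rpow_le_rpow_of_exponent_ge hδ (by linarith) ?_
    push_cast
    have : 53 * (4 * ε) ≤ κ * K * (4 * ε) := mul_le_mul_of_nonneg_right hKκ (by linarith)
    have e : κ * K * (4 * ε) = κ * (ε * (4 * K)) := by ring
    rw [e, hεK] at this
    linarith
  refine ⟨G, hG, ?_, fun lam t a b c ω hω => (h2 lam t a b c ω hω).trans hfin⟩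
  have h3 : 2 ≤ δ ^ (-κ) := by
    refine le_trans ?_ hfin
    rw [← pow_mul]
    have := le_self_pow₀ hB1 (show 4 * 53 ≠ 0 by norm_num)
    linarith
  have h4 : δ ^ κ * δ ^ (-κ) = 1 := by rw [← Real.rpow_add hδ, add_neg_cancel, Real.rpow_zero]
  have h5 : 0 ≤ δ ^ κ := Real.rpow_nonneg hδ.le κ
  have h6 : δ ^ κ * 2 ≤ 1 := by rw [← h4]; exact mul_le_mul_of_nonneg_left h3 h5
  have h7 := mul_le_mul_of_nonneg_left h1 h5
  have h8 := mul_le_mul_of_nonneg_right h6 (show (0:ℝ) ≤ Nat.card G from Nat.cast_nonneg _)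
  linarith
end
end

/-- for every `κ ∈ (0,1/2]` and `s ∈ (0,1]` there are `ε > 0`, `δ₀ > 0`
such that for all `δ ∈ (0,δ₀]` and every `(δ,δ,s,δ^{-ε})`-configuration `Ω` with
`|P| ≤ δ^{-s-ε}`, there is `G ⊆ Ω` with `|G| ≥ δ^κ |Ω|` such that simultaneously for all
`δ ≤ λ ≤ t ≤ 1` and all `ω ∈ G` one has `m^{δ^{-ε},κ⁻¹}_{δ,λ,t}(ω ∣ G) ≤ δ^{-κ}`. -/
theorem partial_multiplicity_all_scales :
    ∀ κ : ℝ, 0 < κ → κ ≤ 1 / 2 → ∀ s : ℝ, 0 < s → s ≤ 1 →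
    ∃ ε > (0 : ℝ), ∃ δ₀ > (0 : ℝ), ∀ δ : ℝ, 0 < δ → δ ≤ δ₀ →
      ∀ (Ω : Set DPair) (M : ℕ), IsConfigD δ δ s (δ ^ (-ε)) M Ω →
        (Nat.card (configP Ω) : ℝ) ≤ δ ^ (-s - ε) →
        ∃ G ⊆ Ω, δ ^ κ * (Nat.card Ω : ℝ) ≤ (Nat.card G : ℝ) ∧
          ∀ lam t : ℝ, δ ≤ lam → lam ≤ t → t ≤ 1 → ∀ ω ∈ G,
            (pMult δ δ δ (dyadicCeil (δ / Real.sqrt (lam * t))) lam t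
                (δ ^ (-ε)) (δ ^ (-ε)) κ⁻¹ G
                (cubeCtr δ ω.1) (arcCenterAt (cubeCtr δ ω.1) δ ω.2) : ℝ) ≤ δ ^ (-κ) := by
  exact final_thm

end
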